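/- The primitive elements of Ū = U/K⁺U are exactly P(Ū) = span{F_β, E_{β'} : β, β' ∈ Φ⁺_r}. -/

import Mathlib

noncomputable section

open scoped TensorProduct

/-- Cartan integers of `sl_N`. -/
def cartanSL (i j : ℕ) : ℤ :=
  if i = j then 2 else if ((i : ℤ) - j).natAbs = 1 then -1 else 0

/-- The defining relations of `U_q(sl_N)` for a candidate family of generators. -/
def UqslRels (q : ℝ) (N : ℕ) {V : Type} [Ring V] [Algebra ℂ V]
    (e f kg ki : ℕ → V) : Prop :=
  (∀ i ∈ Finset.Icc 1 (N - 1), kg i * ki i = 1 ∧ ki i * kg i = 1) ∧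
  (∀ i ∈ Finset.Icc 1 (N - 1), ∀ j ∈ Finset.Icc 1 (N - 1),
      kg i * kg j = kg j * kg i) ∧
  (∀ i ∈ Finset.Icc 1 (N - 1), ∀ j ∈ Finset.Icc 1 (N - 1),
      kg i * e j = ((q : ℂ) ^ (cartanSL i j)) • (e j * kg i)) ∧
  (∀ i ∈ Finset.Icc 1 (N - 1), ∀ j ∈ Finset.Icc 1 (N - 1),
      kg i * f j = ((q : ℂ) ^ (-cartanSL i j)) • (f j * kg i)) ∧
  (∀ i ∈ Finset.Icc 1 (N - 1), ∀ j ∈ Finset.Icc 1 (N - 1),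
      e i * f j - f j * e i =
        if i = j then (((q : ℂ) - (q : ℂ)⁻¹)⁻¹) • (kg i - ki i) else 0) ∧
  (∀ i ∈ Finset.Icc 1 (N - 1), ∀ j ∈ Finset.Icc 1 (N - 1), ((i : ℤ) - j).natAbs = 1 →
      e i * e i * e j - ((q : ℂ) + (q : ℂ)⁻¹) • (e i * e j * e i) + e j * e i * e i = 0) ∧
  (∀ i ∈ Finset.Icc 1 (N - 1), ∀ j ∈ Finset.Icc 1 (N - 1), 2 ≤ ((i : ℤ) - j).natAbs →
      e i * e j = e j * e i) ∧
  (∀ i ∈ Finset.Icc 1 (N - 1), ∀ j ∈ Finset.Icc 1 (N - 1), ((i : ℤ) - j).natAbs = 1 →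
      f i * f i * f j - ((q : ℂ) + (q : ℂ)⁻¹) • (f i * f j * f i) + f j * f i * f i = 0) ∧
  (∀ i ∈ Finset.Icc 1 (N - 1), ∀ j ∈ Finset.Icc 1 (N - 1), 2 ≤ ((i : ℤ) - j).natAbs →
      f i * f j = f j * f i)

/-- The quantized enveloping algebra `U_q(sl_N)` together with its Hopf algebra
structure, generators, defining relations and universal property. -/
structure UqslData (q : ℝ) (N : ℕ) where
  U : Type
  [instRing : Ring U]
  [instHopf : HopfAlgebra ℂ U]
  E : ℕ → U
  F : ℕ → U
  Kg : ℕ → U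
  Ki : ℕ → U
  rels : UqslRels q N E F Kg Ki
  comul_E : ∀ i ∈ Finset.Icc 1 (N - 1),
    Coalgebra.comul (R := ℂ) (E i) = E i ⊗ₜ[ℂ] 1 + Kg i ⊗ₜ[ℂ] E i
  comul_F : ∀ i ∈ Finset.Icc 1 (N - 1),
    Coalgebra.comul (R := ℂ) (F i) = F i ⊗ₜ[ℂ] Ki i + 1 ⊗ₜ[ℂ] F i
  comul_Kg : ∀ i ∈ Finset.Icc 1 (N - 1),
    Coalgebra.comul (R := ℂ) (Kg i) = Kg i ⊗ₜ[ℂ] Kg i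
  comul_Ki : ∀ i ∈ Finset.Icc 1 (N - 1),
    Coalgebra.comul (R := ℂ) (Ki i) = Ki i ⊗ₜ[ℂ] Ki i
  counit_E : ∀ i ∈ Finset.Icc 1 (N - 1), Coalgebra.counit (R := ℂ) (E i) = 0
  counit_F : ∀ i ∈ Finset.Icc 1 (N - 1), Coalgebra.counit (R := ℂ) (F i) = 0
  counit_Kg : ∀ i ∈ Finset.Icc 1 (N - 1), Coalgebra.counit (R := ℂ) (Kg i) = 1
  counit_Ki : ∀ i ∈ Finset.Icc 1 (N - 1), Coalgebra.counit (R := ℂ) (Ki i) = 1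
  gen : Algebra.adjoin ℂ
      {x : U | ∃ i ∈ Finset.Icc 1 (N - 1), x = E i ∨ x = F i ∨ x = Kg i ∨ x = Ki i} = ⊤
  univ : ∀ (V : Type) [Ring V] [Algebra ℂ V] (e f kg ki : ℕ → V),
      UqslRels q N e f kg ki → ∃ φ : U →ₐ[ℂ] V,
        ∀ i ∈ Finset.Icc 1 (N - 1),
          φ (E i) = e i ∧ φ (F i) = f i ∧ φ (Kg i) = kg i ∧ φ (Ki i) = ki i

attribute [instance] UqslData.instRing UqslData.instHopf

namespace UqslData

variable {q : ℝ} {N : ℕ} (D : UqslData q N)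

/-- Root vectors `E_{α_{i,i+d}}` (iterated `q`-commutators with respect to the
standard reduced decomposition of the longest Weyl group element). -/
def Ev : ℕ → ℕ → D.U
  | 0, i => D.E i
  | d + 1, i => D.E i * Ev d (i + 1) - (q : ℂ)⁻¹ • (Ev d (i + 1) * D.E i)

/-- Root vectors `F_{α_{i,i+d}}`. -/
def Fv : ℕ → ℕ → D.U
  | 0, i => D.F i
  | d + 1, i => Fv d (i + 1) * D.F i - (q : ℂ)⁻¹ • (D.F i * Fv d (i + 1))

/-- The Hopf subalgebra `K` generated by `E_i, F_i (i ≠ r)` and all `K_j^{±1}`. -/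
def Ksub (r : ℕ) : Subalgebra ℂ D.U :=
  Algebra.adjoin ℂ
    ({x : D.U | ∃ i ∈ Finset.Icc 1 (N - 1), i ≠ r ∧ (x = D.E i ∨ x = D.F i)} ∪
     {x : D.U | ∃ j ∈ Finset.Icc 1 (N - 1), x = D.Kg j ∨ x = D.Ki j})

/-- The subspace `K⁺U ⊆ U`. -/
def Jsub (r : ℕ) : Submodule ℂ D.U :=
  Submodule.span ℂ
    {x : D.U | ∃ k ∈ D.Ksub r, Coalgebra.counit (R := ℂ) k = 0 ∧ ∃ u : D.U, x = k * u}

/-- The subspace `K⁺U ⊗ U + U ⊗ K⁺U` of `U ⊗ U`, i.e. the kernel of `π ⊗ π` where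
`π : U → U/K⁺U` is the canonical projection. -/
def JUU (r : ℕ) : Submodule ℂ (D.U ⊗[ℂ] D.U) :=
  LinearMap.range (TensorProduct.map (D.Jsub r).subtype LinearMap.id) ⊔
  LinearMap.range (TensorProduct.map LinearMap.id (D.Jsub r).subtype)

/-- `x ∈ U` represents a primitive element of the quotient coalgebra `Ū = U/K⁺U`. -/
def IsPrimitiveMod (r : ℕ) (x : D.U) : Prop :=
  Coalgebra.comul (R := ℂ) x - x ⊗ₜ[ℂ] 1 - 1 ⊗ₜ[ℂ] x ∈ D.JUU r

end UqslData

/-- Membership of the pair `(i,j)` in (the index set of) `Φ⁺_r`, the set of positive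
roots `α_{ij} = α_i + ⋯ + α_j` of `sl_N` with `i ≤ r ≤ j`. -/
def inPhiR (N r : ℕ) (p : ℕ × ℕ) : Prop :=
  1 ≤ p.1 ∧ p.1 ≤ r ∧ r ≤ p.2 ∧ p.2 ≤ N - 1

/-- The linear map `x ↦ Δ(x) - x ⊗ 1 - 1 ⊗ x` measuring the failure of primitivity. -/
noncomputable def primDefect {q : ℝ} {N : ℕ} (D : UqslData q N) :
    D.U →ₗ[ℂ] D.U ⊗[ℂ] D.U :=
  Coalgebra.comul (R := ℂ) - (TensorProduct.mk ℂ D.U D.U).flip 1 -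
    TensorProduct.mk ℂ D.U D.U 1

/-- The set of root vectors `E_{β'}`, `β' ∈ Φ⁺_r`. -/
def EvSet {q : ℝ} {N : ℕ} (D : UqslData q N) (r : ℕ) : Set D.U :=
  {x : D.U | ∃ p : ℕ × ℕ, inPhiR N r p ∧ x = D.Ev (p.2 - p.1) p.1}

/-- The set of root vectors `F_β`, `β ∈ Φ⁺_r`. -/
def FvSet {q : ℝ} {N : ℕ} (D : UqslData q N) (r : ℕ) : Set D.U :=
  {x : D.U | ∃ p : ℕ × ℕ, inPhiR N r p ∧ x = D.Fv (p.2 - p.1) p.1}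

/-- The `q`-commutator `x c - q⁻¹ c x`. -/
def qComm {V : Type} [Ring V] [Algebra ℂ V] (q : ℂ) (x c : V) : V :=
  x * c - q⁻¹ • (c * x)

/-- The quantum Serre relation for the ordered pair `(c, x)`. -/
def QSerre {V : Type} [Ring V] [Algebra ℂ V] (q : ℂ) (c x : V) : Prop :=
  c * c * x - (q + q⁻¹) • (c * x * c) + x * c * c = 0

/-- Iterated `q`-commutators of `u` with `c 0, c 1, …`. -/
def qChain {V : Type} [Ring V] [Algebra ℂ V] (q : ℂ) (u : V) (c : ℕ → V) : ℕ → V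
  | 0 => u
  | t + 1 => qComm q (qChain q u c t) (c t)

section Chain

variable {V : Type} [Ring V] [Algebra ℂ V] {q : ℂ}

theorem Commute.qComm_left {x c d : V} (hx : Commute x d) (hc : Commute c d) :
    Commute (qComm q x c) d :=
  (hx.mul_left hc).sub_left ((hc.mul_left hx).smul_left _)

theorem QSerre.mul_mul {c x : V} (h : QSerre q c x) :
    x * c * c = (q + q⁻¹) • (c * x * c) - c * c * x := by
  have h' : c * c * x - (q + q⁻¹) • (c * x * c) + x * c * c = 0 := h
  rw [← sub_eq_zero, ← h']; abel

theorem qComm_mul_self (hq : q ≠ 0) {c x : V} (h : QSerre q c x) :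
    qComm q x c * c = q • (c * qComm q x c) := by
  have h1 := h.mul_mul
  simp only [qComm, sub_mul, mul_sub, smul_mul_assoc, mul_smul_comm, smul_sub, smul_smul,
    mul_inv_cancel₀ hq, one_smul, add_smul, ← mul_assoc] at h1 ⊢
  rw [h1]; abel

/-- If `u` commutes with `d`, then `[[u,c],d] = [u,[c,d]]`. -/
theorem qComm_qComm {u c d : V} (h : Commute u d) :
    qComm q (qComm q u c) d = qComm q u (qComm q c d) := by
  have h1 : u * d = d * u := h
  have h2 : u * d * c = d * u * c := by rw [h1]
  have h3 : c * (u * d) = c * (d * u) := by rw [h1]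
  simp only [qComm, sub_mul, mul_sub, smul_mul_assoc, mul_smul_comm, smul_sub, smul_smul,
    ← mul_assoc] at h2 h3 ⊢
  rw [h2, h3]; abel

theorem qComm_mul_right {u c y : V} (h : Commute u c) (hy : y * c = q • (c * y)) :
    qComm q u y * c = q • (c * qComm q u y) := by
  have h1 : u * c = c * u := h
  simp only [qComm, sub_mul, mul_sub, smul_mul_assoc, mul_smul_comm, smul_sub]
  rw [mul_assoc, hy, mul_assoc y, h1, ← mul_assoc y, hy]
  simp only [mul_smul_comm, smul_mul_assoc, ← mul_assoc, h1]
  rw [smul_comm]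

theorem commute_qComm_qComm (hq : q ≠ 0) (hq2 : q + q⁻¹ ≠ 0) {u c d : V} (hud : Commute u d)
    (h1 : QSerre q c u) (h2 : QSerre q c d) :
    Commute (qComm q (qComm q u c) d) c := by
  have e1 := h1.mul_mul
  have e2 := h2.mul_mul
  have hud' : u * d = d * u := hud
  have hl : u * (d * c * c) = d * (u * c * c) := by simp only [← mul_assoc, hud']
  have hr : c * c * u * d = c * c * d * u := by rw [mul_assoc, hud', ← mul_assoc]
  have hm : c * u * d * c = c * d * u * c := by rw [mul_assoc c, hud', ← mul_assoc]
  have hm1 : c * u * c * d = c * (u * c * d) := by simp only [mul_assoc]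
  have hm2 : c * d * c * u = c * (d * c * u) := by simp only [mul_assoc]
  have k1 : u * c * d * c = d * c * u * c - c * d * c * u + c * u * c * d := by
    have e3 : u * (c * c * d) = (q + q⁻¹) • (u * c * d * c) - u * (d * c * c) := by
      have : c * c * d = (q + q⁻¹) • (c * d * c) - d * c * c := by rw [e2]; abel
      rw [this]; simp only [mul_sub, mul_smul_comm, ← mul_assoc]
    have e4 : u * c * c * d = (q + q⁻¹) • (c * u * c * d) - c * c * u * d := by
      rw [e1]; simp only [sub_mul, smul_mul_assoc]
    have e5 : d * (u * c * c) = (q + q⁻¹) • (d * c * u * c) - d * c * c * u := by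
      rw [e1]; simp only [mul_sub, mul_smul_comm, ← mul_assoc]
    have e6 : d * c * c * u = (q + q⁻¹) • (c * d * c * u) - c * c * d * u := by
      rw [e2]; simp only [sub_mul, smul_mul_assoc]
    have e7 : u * (c * c * d) = u * c * c * d := by simp only [mul_assoc]
    have : (q + q⁻¹) • (u * c * d * c - (d * c * u * c - c * d * c * u + c * u * c * d)) = 0 := by
      rw [smul_sub, smul_add, smul_sub]
      rw [hl, e7, e4, e5, e6, hr] at e3
      rw [← sub_eq_zero] at e3
      rw [← neg_eq_zero, ← e3]; abel
    exact sub_eq_zero.mp ((smul_eq_zero.mp this).resolve_left hq2)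
  have k2 : d * u * c * c = (q + q⁻¹) • (d * c * u * c) - ((q + q⁻¹) • (c * d * c * u)
      - c * c * d * u) := by
    have e5 : d * (u * c * c) = (q + q⁻¹) • (d * c * u * c) - d * c * c * u := by
      rw [e1]; simp only [mul_sub, mul_smul_comm, ← mul_assoc]
    have e6 : d * c * c * u = (q + q⁻¹) • (c * d * c * u) - c * c * d * u := by
      rw [e2]; simp only [sub_mul, smul_mul_assoc]
    rw [← e6, ← e5]; simp only [mul_assoc]
  have hqq : 1 - q⁻¹ * (q + q⁻¹) + q⁻¹ * q⁻¹ = 0 := by field_simp; ring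
  have h0 : qComm q (qComm q u c) d * c - c * qComm q (qComm q u c) d =
      (1 - q⁻¹ * (q + q⁻¹) + q⁻¹ * q⁻¹) • (d * c * u * c - c * d * c * u) := by
    simp only [qComm, sub_mul, mul_sub, smul_mul_assoc, mul_smul_comm, ← mul_assoc]
    rw [k1, k2, hm, hr]
    module
  rw [hqq, zero_smul] at h0
  exact sub_eq_zero.mp h0

theorem qSerre_of_qComm_mul (hq : q ≠ 0) {c x : V}
    (h : qComm q x c * c = q • (c * qComm q x c)) : QSerre q c x := by
  simp only [qComm, sub_mul, mul_sub, smul_mul_assoc, mul_smul_comm, smul_sub, smul_smul,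
    mul_inv_cancel₀ hq, one_smul, ← mul_assoc] at h
  rw [← sub_eq_zero] at h
  rw [QSerre, ← h]
  module

/-- `q`-commutators with commuting elements commute with each other. -/
theorem qComm_right_comm (s t : ℂ) {x c d : V} (h : Commute c d) :
    qComm s (qComm t x d) c = qComm t (qComm s x c) d := by
  have h1 : d * c = c * d := h.symm.eq
  have h2 : x * d * c = x * c * d := by rw [mul_assoc, h1, mul_assoc]
  have h3 : c * d * x = d * c * x := by rw [h1]
  simp only [qComm, sub_mul, mul_sub, smul_mul_assoc, mul_smul_comm, ← mul_assoc]
  rw [h2, h3]; module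

theorem QSerre.qComm {c d x : V} (s : ℂ) (h : QSerre q c x) (hcd : Commute c d) :
    QSerre q c (qComm s x d) := by
  have h1 : d * c = c * d := hcd.symm.eq
  have e1 : QSerre q c (x * d) := by
    have : c * c * (x * d) - (q + q⁻¹) • (c * (x * d) * c) + x * d * c * c =
        (c * c * x - (q + q⁻¹) • (c * x * c) + x * c * c) * d := by
      have h2 : c * (x * d) * c = c * x * c * d := by
        simp only [mul_assoc, h1]
      have h3 : x * d * c * c = x * c * c * d := by
        rw [mul_assoc x, h1, ← mul_assoc, mul_assoc (x * c), h1, ← mul_assoc]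
      rw [h2, h3]; simp only [sub_mul, add_mul, smul_mul_assoc, ← mul_assoc]
    rw [QSerre, this, show c * c * x - (q + q⁻¹) • (c * x * c) + x * c * c = 0 from h, zero_mul]
  have e2 : QSerre q c (d * x) := by
    have : c * c * (d * x) - (q + q⁻¹) • (c * (d * x) * c) + d * x * c * c =
        d * (c * c * x - (q + q⁻¹) • (c * x * c) + x * c * c) := by
      have h2 : c * (d * x) * c = d * c * x * c := by rw [← mul_assoc, h1]
      have h3 : c * c * (d * x) = d * c * c * x := by
        rw [h1, mul_assoc c d c, h1, ← mul_assoc, ← mul_assoc]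
      rw [h2, h3]; simp only [mul_sub, mul_add, mul_smul_comm, ← mul_assoc]
    rw [QSerre, this, show c * c * x - (q + q⁻¹) • (c * x * c) + x * c * c = 0 from h, mul_zero]
  rw [QSerre] at e1 e2 ⊢
  have : c * c * _root_.qComm s x d - (q + q⁻¹) • (c * _root_.qComm s x d * c)
      + _root_.qComm s x d * c * c =
      (c * c * (x * d) - (q + q⁻¹) • (c * (x * d) * c) + x * d * c * c) - s⁻¹ •
      (c * c * (d * x) - (q + q⁻¹) • (c * (d * x) * c) + d * x * c * c) := by
    simp only [_root_.qComm, sub_mul, mul_sub, smul_mul_assoc, mul_smul_comm, ← mul_assoc]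
    module
  rw [this, e1, e2, smul_zero, sub_zero]

/-- Hypotheses under which the elements of a `q`-chain satisfy the type `A` relations. -/
structure IsQChain (q : ℂ) (u : V) (c : ℕ → V) (n : ℕ) : Prop where
  serre_zero : 0 < n → QSerre q (c 0) u
  commute_base : ∀ t < n, 1 ≤ t → Commute u (c t)
  serre_up : ∀ t, t + 1 < n → QSerre q (c t) (c (t + 1))
  serre_down : ∀ t, t + 1 < n → QSerre q (c (t + 1)) (c t)
  commute_far : ∀ s t, s + 2 ≤ t → t < n → Commute (c s) (c t)

theorem Commute.qChain_left {u d : V} {c : ℕ → V} (hu : Commute u d) {t : ℕ}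
    (h : ∀ s < t, Commute (c s) d) : Commute (qChain q u c t) d := by
  induction t with
  | zero => exact hu
  | succ t ih => exact (ih fun s hs => h s (by omega)).qComm_left (h t (by omega))

theorem qComm_qChain (s : ℂ) {u d : V} {c : ℕ → V} {t : ℕ} (h : ∀ s < t, Commute (c s) d) :
    qComm s (qChain q u c t) d = qChain q (qComm s u d) c t := by
  induction t with
  | zero => rfl
  | succ t ih =>
    rw [qChain, qComm_right_comm _ _ (h t (by omega)).symm, ih fun s hs => h s (by omega), qChain]

theorem qChain_zero_left (c : ℕ → V) (t : ℕ) : qChain q 0 c t = 0 := by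
  induction t with
  | zero => rfl
  | succ t ih => simp [qChain, ih, qComm]

theorem QSerre.qChain {u d : V} {c : ℕ → V} (h : QSerre q d u) {t : ℕ}
    (hc : ∀ s < t, Commute (c s) d) : QSerre q d (qChain q u c t) := by
  induction t with
  | zero => exact h
  | succ t ih => exact (ih fun s hs => hc s (by omega)).qComm _ (hc t (by omega)).symm

namespace IsQChain

variable {u : V} {c : ℕ → V} {n : ℕ}

theorem commute_of_lt (h : IsQChain q u c n) {t k : ℕ} (htk : t < k) (hk : k < n) :
    Commute (qChain q u c t) (c k) :=
  (h.commute_base k hk (by omega)).qChain_left fun s hs => h.commute_far s k (by omega) hk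

theorem qChain_succ_mul (hq : q ≠ 0) (h : IsQChain q u c n) {t : ℕ} (ht : t < n) :
    qChain q u c (t + 1) * c t = q • (c t * qChain q u c (t + 1)) := by
  cases t with
  | zero => exact qComm_mul_self hq (h.serre_zero ht)
  | succ s =>
    rw [qChain, qChain, qComm_qComm (h.commute_of_lt (by omega) ht)]
    exact qComm_mul_right (h.commute_of_lt (by omega) ht) (qComm_mul_self hq (h.serre_down s ht))

theorem commute_of_gt (hq : q ≠ 0) (hq2 : q + q⁻¹ ≠ 0) (h : IsQChain q u c n) {t k : ℕ}
    (hkt : k < t) (ht : t < n) : Commute (qChain q u c (t + 1)) (c k) := by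
  induction t with
  | zero => omega
  | succ s ih =>
    obtain rfl | hk := Nat.lt_succ_iff_lt_or_eq.mp hkt |>.symm
    · exact commute_qComm_qComm hq hq2 (h.commute_of_lt (by omega) ht)
        (qSerre_of_qComm_mul hq (h.qChain_succ_mul hq (by omega))) (h.serre_up k ht)
    · exact (ih hk (by omega)).qComm_left (h.commute_far k _ (by omega) ht).symm

/-- The `q`-commutator of a chain element with any `c k` is zero or the next chain element. -/
theorem exists_qComm (hq : q ≠ 0) (hq2 : q + q⁻¹ ≠ 0) (h : IsQChain q u c n) {t k : ℕ}
    (ht : t ≤ n) (hk : k < n) :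
    (k = t ∧ qComm q (qChain q u c t) (c k) = qChain q u c (t + 1)) ∨
      ∃ s : ℂ, (s = 1 ∨ s = q⁻¹) ∧ qComm s (qChain q u c t) (c k) = 0 := by
  rcases lt_trichotomy k t with hkt | rfl | hkt
  · right
    obtain ⟨t, rfl⟩ : ∃ t', t = t' + 1 := ⟨t - 1, by omega⟩
    rcases Nat.lt_succ_iff_lt_or_eq.mp hkt with hkt | rfl
    · exact ⟨1, Or.inl rfl, by
        rw [qComm, inv_one, one_smul, h.commute_of_gt hq hq2 hkt (by omega), sub_self]⟩
    · exact ⟨q⁻¹, Or.inr rfl, by rw [qComm, inv_inv, h.qChain_succ_mul hq hk, sub_self]⟩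
  · exact Or.inl ⟨rfl, rfl⟩
  · exact Or.inr ⟨1, Or.inl rfl, by
      rw [qComm, inv_one, one_smul, h.commute_of_lt hkt hk, sub_self]⟩

end IsQChain

/-- The quantum Serre relations of type `A` among `e 1, …, e (N - 1)`. -/
structure SerreRels (q : ℂ) (N : ℕ) (e : ℕ → V) : Prop where
  serre : ∀ i ∈ Finset.Icc 1 (N - 1), ∀ j ∈ Finset.Icc 1 (N - 1),
    ((i : ℤ) - j).natAbs = 1 → QSerre q (e i) (e j)
  commute : ∀ i ∈ Finset.Icc 1 (N - 1), ∀ j ∈ Finset.Icc 1 (N - 1),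
    2 ≤ ((i : ℤ) - j).natAbs → Commute (e i) (e j)

/-- The root vector of weight `e_{r-a} + ⋯ + e_{r+b}` obtained from `e r` by first going up
and then going down. -/
def rootVec (q : ℂ) (e : ℕ → V) (r a b : ℕ) : V :=
  qChain q (qChain q (e r) (fun t => e (r + 1 + t)) b) (fun t => e (r - 1 - t)) a

section RootVec

variable {N r : ℕ} {e : ℕ → V}

theorem SerreRels.isQChain_up (h : SerreRels q N e) (hr1 : 1 ≤ r) :
    IsQChain q (e r) (fun t => e (r + 1 + t)) (N - 1 - r) where
  serre_zero h0 := h.serre _ (by simp; omega) _ (by simp; omega) (by omega)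
  commute_base t ht h1 := h.commute _ (by simp; omega) _ (by simp; omega) (by omega)
  serre_up t ht := h.serre _ (by simp; omega) _ (by simp; omega) (by omega)
  serre_down t ht := h.serre _ (by simp; omega) _ (by simp; omega) (by omega)
  commute_far s t hs ht := h.commute _ (by simp; omega) _ (by simp; omega) (by omega)

theorem SerreRels.isQChain_down (h : SerreRels q N e) {b : ℕ} (hb : b < N - r) :
    IsQChain q (qChain q (e r) (fun t => e (r + 1 + t)) b) (fun t => e (r - 1 - t)) (r - 1) where
  serre_zero h0 := (h.serre _ (by simp; omega) _ (by simp; omega) (by omega)).qChain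
    fun s hs => h.commute _ (by simp; omega) _ (by simp; omega) (by omega)
  commute_base t ht h1 :=
    (h.commute _ (by simp; omega) _ (by simp; omega) (by omega)).qChain_left
      fun s hs => h.commute _ (by simp; omega) _ (by simp; omega) (by omega)
  serre_up t ht := h.serre _ (by simp; omega) _ (by simp; omega) (by omega)
  serre_down t ht := h.serre _ (by simp; omega) _ (by simp; omega) (by omega)
  commute_far s t hs ht := h.commute _ (by simp; omega) _ (by simp; omega) (by omega)

/-- The `q`-commutator of a root vector with `e k` (`k ≠ r`) is zero or another root vector. -/
theorem SerreRels.exists_qComm_rootVec (hq : q ≠ 0) (hq2 : q + q⁻¹ ≠ 0) (h : SerreRels q N e)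
    (hr1 : 1 ≤ r) {a b k : ℕ} (ha : a < r) (hb : b < N - r) (hk : k ∈ Finset.Icc 1 (N - 1))
    (hkr : k ≠ r) : ∃ s : ℂ, (s = 1 ∨ s = q ∨ s = q⁻¹) ∧
      (qComm s (rootVec q e r a b) (e k) = 0 ∨ ∃ a' < r, ∃ b' < N - r,
        qComm s (rootVec q e r a b) (e k) = rootVec q e r a' b') := by
  rw [Finset.mem_Icc] at hk
  rcases Nat.lt_or_gt_of_ne hkr with hlt | hgt
  · rcases (h.isQChain_down hb).exists_qComm hq hq2 (t := a) (k := r - 1 - k) (by omega)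
      (by omega) with ⟨hka, h1⟩ | ⟨s, hs, h1⟩
    · rw [show r - 1 - (r - 1 - k) = k by omega] at h1
      exact ⟨q, Or.inr (Or.inl rfl), Or.inr ⟨a + 1, by omega, b, hb, h1⟩⟩
    · rw [show r - 1 - (r - 1 - k) = k by omega] at h1
      exact ⟨s, by tauto, Or.inl h1⟩
  · have hc : ∀ s < a, Commute (e (r - 1 - s)) (e k) := fun s hs =>
      h.commute _ (by simp; omega) _ (by simp; omega) (by omega)
    rcases (h.isQChain_up hr1).exists_qComm hq hq2 (t := b) (k := k - r - 1) (by omega)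
      (by omega) with ⟨hka, h1⟩ | ⟨s, hs, h1⟩
    · rw [show r + 1 + (k - r - 1) = k by omega] at h1
      refine ⟨q, Or.inr (Or.inl rfl), Or.inr ⟨a, ha, b + 1, by omega, ?_⟩⟩
      rw [rootVec, qComm_qChain _ hc, h1, rootVec]
    · rw [show r + 1 + (k - r - 1) = k by omega] at h1
      refine ⟨s, by tauto, Or.inl ?_⟩
      rw [rootVec, qComm_qChain _ hc, h1, qChain_zero_left]

theorem rootVec_zero_zero : rootVec q e r 0 0 = e r := rfl

theorem rootVec_succ_left (a b : ℕ) :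
    rootVec q e r (a + 1) b = qComm q (rootVec q e r a b) (e (r - 1 - a)) := rfl

theorem rootVec_zero_succ (b : ℕ) :
    rootVec q e r 0 (b + 1) = qComm q (rootVec q e r 0 b) (e (r + 1 + b)) := rfl

/-- Induction along the construction of root vectors. -/
theorem rootVec_induction {P : V → Prop} {n : ℕ} (h0 : P (e r))
    (hstep : ∀ a < r, ∀ b < n - r, ∀ k ∈ Finset.Icc 1 (n - 1), k ≠ r → P (rootVec q e r a b) →
      P (qComm q (rootVec q e r a b) (e k)))
    {a b : ℕ} (ha : a < r) (hb : b < n - r) : P (rootVec q e r a b) := by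
  induction a with
  | zero =>
    induction b with
    | zero => exact h0
    | succ b ih => exact hstep 0 ha b (by omega) _ (by simp; omega) (by omega) (ih (by omega))
  | succ a ih => exact hstep a (by omega) b hb _ (by simp; omega) (by omega) (ih (by omega))

end RootVec

end Chain

/-- The rational functions in `q` (with rational coefficients) that are regular at `q = 1`. -/
def localSubring (q : ℝ) : Subring ℂ where
  carrier := {z | ∃ p s : Polynomial ℚ, s.eval 1 ≠ 0 ∧
    z * Polynomial.aeval (q : ℂ) s = Polynomial.aeval (q : ℂ) p}
  mul_mem' := by
    rintro z w ⟨p, s, hs, hz⟩ ⟨p', s', hs', hw⟩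
    refine ⟨p * p', s * s', by simp [hs, hs'], ?_⟩
    rw [map_mul, map_mul, ← hz, ← hw]; ring
  one_mem' := ⟨1, 1, by simp, by simp⟩
  add_mem' := by
    rintro z w ⟨p, s, hs, hz⟩ ⟨p', s', hs', hw⟩
    refine ⟨p * s' + p' * s, s * s', by simp [hs, hs'], ?_⟩
    rw [map_mul, map_add, map_mul, map_mul, ← hz, ← hw]; ring
  zero_mem' := ⟨0, 1, by simp, by simp⟩
  neg_mem' := by
    rintro z ⟨p, s, hs, hz⟩
    exact ⟨-p, s, hs, by rw [map_neg, ← hz]; ring⟩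

section LocalSubring

variable {q : ℝ}

theorem aeval_ne_zero_of_transcendental (hq : Transcendental ℚ q) {s : Polynomial ℚ}
    (hs : s ≠ 0) : Polynomial.aeval (q : ℂ) s ≠ 0 := by
  have h1 : (q : ℂ) = algebraMap ℝ ℂ q := rfl
  rw [h1, Polynomial.aeval_algebraMap_apply]
  intro h
  exact (transcendental_iff.mp hq s).mt hs ((algebraMap ℝ ℂ).injective (by rw [h, map_zero]))

theorem ne_ratCast_of_transcendental (hq : Transcendental ℚ q) (c : ℚ) : (q : ℂ) ≠ c := by
  intro h
  have := aeval_ne_zero_of_transcendental hq (Polynomial.X_sub_C_ne_zero c)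
  simp [h] at this

theorem ne_zero_of_transcendental (hq : Transcendental ℚ q) : (q : ℂ) ≠ 0 := by
  simpa using ne_ratCast_of_transcendental hq 0

theorem ne_one_of_transcendental (hq : Transcendental ℚ q) : (q : ℂ) ≠ 1 := by
  simpa using ne_ratCast_of_transcendental hq 1

theorem add_inv_ne_zero_of_transcendental (hq : Transcendental ℚ q) :
    (q : ℂ) + (q : ℂ)⁻¹ ≠ 0 := by
  have h0 := ne_zero_of_transcendental hq
  have h1 : Polynomial.aeval (q : ℂ) (Polynomial.X ^ 2 + 1 : Polynomial ℚ) ≠ 0 :=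
    aeval_ne_zero_of_transcendental hq fun h => by
      have := congrArg (Polynomial.eval 0) h
      simp at this
  intro h
  apply h1
  have : (q : ℂ) * ((q : ℂ) + (q : ℂ)⁻¹) = 0 := by rw [h, mul_zero]
  rw [mul_add, mul_inv_cancel₀ h0] at this
  simp only [map_add, map_pow, Polynomial.aeval_X, map_one]
  linear_combination this

theorem sub_inv_ne_zero_of_transcendental (hq : Transcendental ℚ q) :
    (q : ℂ) - (q : ℂ)⁻¹ ≠ 0 := by
  have h0 := ne_zero_of_transcendental hq
  intro h
  have h2 : ((q : ℂ) - 1) * (q - (-1)) = 0 := by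
    have : (q : ℂ) * ((q : ℂ) - (q : ℂ)⁻¹) = 0 := by rw [h, mul_zero]
    rw [mul_sub, mul_inv_cancel₀ h0] at this
    linear_combination this
  rcases mul_eq_zero.mp h2 with h | h
  · exact ne_one_of_transcendental hq (sub_eq_zero.mp h)
  · exact ne_ratCast_of_transcendental hq (-1) (by push_cast; exact sub_eq_zero.mp h)

theorem div_mem_localSubring (hq : Transcendental ℚ q) {p s : Polynomial ℚ}
    (hs : s.eval 1 ≠ 0) :
    Polynomial.aeval (q : ℂ) p / Polynomial.aeval (q : ℂ) s ∈ localSubring q := by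
  have : s ≠ 0 := fun h => by simp [h] at hs
  exact ⟨p, s, hs, div_mul_cancel₀ _ (aeval_ne_zero_of_transcendental hq this)⟩

theorem self_mem_localSubring : (q : ℂ) ∈ localSubring q :=
  ⟨Polynomial.X, 1, by simp, by simp⟩

theorem inv_mem_localSubring (hq : Transcendental ℚ q) : (q : ℂ)⁻¹ ∈ localSubring q := by
  simpa using div_mem_localSubring hq (p := 1) (s := Polynomial.X) (by simp)

theorem inv_natCast_mem_localSubring {n : ℕ} (hn : n ≠ 0) : (n : ℂ)⁻¹ ∈ localSubring q :=
  ⟨1, Polynomial.C (n : ℚ), by simpa using hn, by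
    simp [inv_mul_cancel₀ (Nat.cast_ne_zero.mpr hn : (n : ℂ) ≠ 0)]⟩

theorem zpow_mem_localSubring (hq : Transcendental ℚ q) (c : ℤ) :
    (q : ℂ) ^ c ∈ localSubring q := by
  cases c with
  | ofNat n => simpa using (localSubring q).pow_mem self_mem_localSubring n
  | negSucc n =>
    rw [zpow_negSucc, ← inv_pow]
    exact (localSubring q).pow_mem (inv_mem_localSubring hq) _

/-- The uniformizer `q - 1`. -/
def qSubOne (q : ℝ) : localSubring q :=
  ⟨(q : ℂ) - 1, (localSubring q).sub_mem self_mem_localSubring (localSubring q).one_mem⟩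

theorem coe_qSubOne : ((qSubOne q : localSubring q) : ℂ) = q - 1 := rfl

theorem qSubOne_mem_jacobson (hq : Transcendental ℚ q) :
    Ideal.span {qSubOne q} ≤ (⊥ : Ideal (localSubring q)).jacobson := by
  rw [Ideal.span_le, Set.singleton_subset_iff, SetLike.mem_coe, Ideal.mem_jacobson_bot]
  rintro ⟨a, p, s, hs, ha⟩
  have hs0 : s ≠ 0 := fun h => by simp [h] at hs
  have h1 : (s + (Polynomial.X - 1) * p).eval 1 ≠ 0 := by simpa using hs
  have h10 : s + (Polynomial.X - 1) * p ≠ 0 := fun h => by rw [h] at h1; simp at h1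
  have h2 := aeval_ne_zero_of_transcendental hq hs0
  have h3 := aeval_ne_zero_of_transcendental hq h10
  refine IsUnit.of_mul_eq_one ⟨_, div_mem_localSubring hq (p := s) h1⟩ (Subtype.ext ?_)
  rw [Subring.coe_mul, Subring.coe_add, Subring.coe_mul, coe_qSubOne, Subring.coe_one]
  rw [mul_div_assoc', div_eq_one_iff_eq h3, map_add, map_mul]
  simp only [map_sub, Polynomial.aeval_X, map_one]
  linear_combination ((q : ℂ) - 1) * ha

theorem exists_zpow_sub_one (hq : Transcendental ℚ q) (c : ℤ) :
    ∃ a ∈ localSubring q, (q : ℂ) ^ c - 1 = (q - 1) * a := by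
  have h0 := ne_zero_of_transcendental hq
  have hn : ∀ n : ℕ, ∃ a ∈ localSubring q, (q : ℂ) ^ (n : ℤ) - 1 = (q - 1) * a := by
    intro n
    refine ⟨∑ i ∈ Finset.range n, (q : ℂ) ^ i, Subring.sum_mem _ fun i _ =>
      Subring.pow_mem _ self_mem_localSubring i, ?_⟩
    rw [zpow_natCast, mul_comm, geom_sum_mul]
  obtain ⟨n, rfl | rfl⟩ := c.eq_nat_or_neg
  · exact hn n
  · obtain ⟨a, ha, h⟩ := hn n
    refine ⟨-((q : ℂ) ^ (-n : ℤ) * a), Subring.neg_mem _ (Subring.mul_mem _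
      (zpow_mem_localSubring hq _) ha), ?_⟩
    rw [mul_neg, mul_left_comm, ← h, zpow_neg]
    have : (q : ℂ) ^ (n : ℤ) ≠ 0 := zpow_ne_zero _ h0
    field_simp; ring

theorem quantum_int_mem_localSubring (hq : Transcendental ℚ q) (c : ℤ) :
    ((q : ℂ) - (q : ℂ)⁻¹)⁻¹ * ((q : ℂ) ^ c - (q : ℂ) ^ (-c)) ∈ localSubring q := by
  have h0 := ne_zero_of_transcendental hq
  have h1 := sub_inv_ne_zero_of_transcendental hq
  have hn : ∀ n : ℕ, ((q : ℂ) - (q : ℂ)⁻¹)⁻¹ * ((q : ℂ) ^ (n : ℤ) - (q : ℂ) ^ (-(n : ℤ))) ∈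
      localSubring q := by
    intro n
    induction n with
    | zero => simp
    | succ n ih =>
      have := Subring.add_mem _ (Subring.mul_mem _ self_mem_localSubring ih)
        (zpow_mem_localSubring hq (-n))
      convert this using 1
      rw [inv_mul_eq_div, div_eq_iff h1, add_mul, mul_assoc, inv_mul_eq_div, div_mul_cancel₀ _ h1]
      push_cast
      rw [neg_add, zpow_add₀ h0, zpow_add₀ h0, zpow_one, zpow_neg_one]
      ring
  obtain ⟨n, rfl | rfl⟩ := c.eq_nat_or_neg
  · exact hn n
  · have := Subring.neg_mem _ (hn n)
    convert this using 1
    rw [neg_neg]; ring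

end LocalSubring

/-- A right ideal `J` together with elements `x γ`, and a subring `A` of scalars
with a distinguished element `h`. -/
structure FiltData (U : Type) [Ring U] [Algebra ℂ U] where
  A : Subring ℂ
  h : A
  J : Submodule ℂ U
  mul_mem : ∀ j ∈ J, ∀ u, j * u ∈ J
  ι : Type
  x : ι → U

namespace FiltData

variable {U : Type} [Ring U] [Algebra ℂ U] (S : FiltData U)

/-- The `A`-span of `J`, `1` and products of at most `n - 1` of the `x γ`. -/
def L : ℕ → Submodule S.A U
  | 0 => S.J.restrictScalars S.A
  | n + 1 => Submodule.span S.A ({1} ∪ (L n : Set U) ∪ {z | ∃ y ∈ L n, ∃ γ, z = y * S.x γ})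

/-- The complex span of `L n`. -/
def G (n : ℕ) : Submodule ℂ U := Submodule.span ℂ (S.L n : Set U)

/-- The elements of `L n` that are negligible at `h = 0` and in lower degree. -/
def B (n : ℕ) : Submodule S.A U :=
  (S.L n).map (S.h • (LinearMap.id : U →ₗ[S.A] U)) ⊔ (S.G (n - 1)).restrictScalars S.A

theorem one_mem_L (n : ℕ) : 1 ∈ S.L (n + 1) :=
  Submodule.subset_span (Or.inl (Or.inl rfl))

theorem L_le_succ (n : ℕ) : S.L n ≤ S.L (n + 1) := fun _ h =>
  Submodule.subset_span (Or.inl (Or.inr h))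

theorem L_mono : Monotone S.L := monotone_nat_of_le_succ S.L_le_succ

theorem mul_x_mem_L {n : ℕ} {y : U} (hy : y ∈ S.L n) (γ : S.ι) : y * S.x γ ∈ S.L (n + 1) :=
  Submodule.subset_span (Or.inr ⟨y, hy, γ, rfl⟩)

theorem J_le_L (n : ℕ) {y : U} (hy : y ∈ S.J) : y ∈ S.L n := S.L_mono (Nat.zero_le n) hy

theorem L_succ_le {n : ℕ} {P : Submodule S.A U} (h1 : 1 ∈ P) (h2 : S.L n ≤ P)
    (h3 : ∀ y ∈ S.L n, ∀ γ, y * S.x γ ∈ P) : S.L (n + 1) ≤ P := by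
  rw [L, Submodule.span_le]
  rintro z ((rfl | hz) | ⟨y, hy, γ, rfl⟩)
  exacts [h1, h2 hz, h3 y hy γ]

theorem smul_mem' (P : Submodule S.A U) {a : ℂ} (ha : a ∈ S.A) {y : U} (hy : y ∈ P) :
    a • y ∈ P := P.smul_mem (⟨a, ha⟩ : S.A) hy

theorem L_le_G {n : ℕ} {y : U} (hy : y ∈ S.L n) : y ∈ S.G n := Submodule.subset_span hy

theorem G_mono : Monotone S.G := fun _ _ h => Submodule.span_mono (S.L_mono h)

theorem G_zero : S.G 0 = S.J := Submodule.span_eq S.J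

theorem J_le_G (n : ℕ) {y : U} (hy : y ∈ S.J) : y ∈ S.G n := S.L_le_G (S.J_le_L n hy)

theorem G_one : S.G 1 = Submodule.span ℂ {1} ⊔ S.J := by
  refine le_antisymm (Submodule.span_le.2 ?_) (sup_le ?_ fun y hy => S.J_le_G 1 hy)
  · refine S.L_succ_le (P := (Submodule.span ℂ {1} ⊔ S.J).restrictScalars S.A)
      (Submodule.mem_sup_left (Submodule.mem_span_singleton_self 1))
      (fun y hy => Submodule.mem_sup_right hy)
      fun y hy γ => Submodule.mem_sup_right (S.mul_mem y hy _)
  · rw [Submodule.span_singleton_le_iff_mem]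
    exact S.L_le_G (S.one_mem_L 0)

theorem one_mem_G (n : ℕ) : 1 ∈ S.G (n + 1) := S.L_le_G (S.one_mem_L n)

theorem mem_B {n : ℕ} {z : U} :
    z ∈ S.B n ↔ ∃ y ∈ S.L n, ∃ w ∈ S.G (n - 1), z = S.h • y + w := by
  simp only [B, Submodule.mem_sup, Submodule.mem_map, Submodule.restrictScalars_mem,
    LinearMap.smul_apply, LinearMap.id_apply]
  constructor
  · rintro ⟨_, ⟨y, hy, rfl⟩, w, hw, rfl⟩; exact ⟨y, hy, w, hw, rfl⟩
  · rintro ⟨y, hy, w, hw, rfl⟩; exact ⟨_, ⟨y, hy, rfl⟩, w, hw, rfl⟩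

theorem h_smul_mem_B {n : ℕ} {y : U} (hy : y ∈ S.L n) : (S.h : ℂ) • y ∈ S.B n :=
  S.mem_B.2 ⟨y, hy, 0, zero_mem _, (add_zero _).symm⟩

theorem G_le_B {n : ℕ} {y : U} (hy : y ∈ S.G (n - 1)) : y ∈ S.B n :=
  S.mem_B.2 ⟨0, zero_mem _, y, hy, by simp⟩

theorem J_le_B (n : ℕ) {y : U} (hy : y ∈ S.J) : y ∈ S.B n := S.G_le_B (S.J_le_G _ hy)

theorem B_le {n : ℕ} {P : Submodule S.A U} (h1 : ∀ y ∈ S.L n, (S.h : ℂ) • y ∈ P)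
    (h2 : ∀ y ∈ S.G (n - 1), y ∈ P) : S.B n ≤ P := by
  intro z hz
  obtain ⟨y, hy, w, hw, rfl⟩ := S.mem_B.1 hz
  exact P.add_mem (h1 y hy) (h2 w hw)

theorem B_mono : Monotone S.B := fun _ n h => S.B_le
  (fun _ hy => S.h_smul_mem_B (S.L_mono h hy))
  (fun _ hy => S.G_le_B (S.G_mono (by omega) hy))

theorem B_le_G {n : ℕ} {y : U} (hy : y ∈ S.B n) : y ∈ S.G n :=
  S.B_le (P := (S.G n).restrictScalars S.A)
    (fun _ hy => (S.G n).smul_mem _ (S.L_le_G hy)) (fun _ hy => S.G_mono (by omega) hy) hy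

/-- Elements that raise the degree by at most `k` under right multiplication. -/
def Deg (k : ℕ) : Submodule S.A U where
  carrier := {u | ∀ n, ∀ y ∈ S.L n, y * u ∈ S.L (n + k)}
  add_mem' ha hb n y hy := by rw [mul_add]; exact add_mem (ha n y hy) (hb n y hy)
  zero_mem' n y hy := by simp
  smul_mem' c u hu n y hy := by rw [mul_smul_comm]; exact Submodule.smul_mem _ c (hu n y hy)

/-- Elements that are negligible as operators of degree `k`. -/
def Neg (k : ℕ) : Submodule S.A U where
  carrier := {u | ∀ n, ∀ y ∈ S.L n, y * u ∈ S.B (n + k)}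
  add_mem' ha hb n y hy := by rw [mul_add]; exact add_mem (ha n y hy) (hb n y hy)
  zero_mem' n y hy := by simp
  smul_mem' c u hu n y hy := by rw [mul_smul_comm]; exact Submodule.smul_mem _ c (hu n y hy)

variable {S}

theorem Deg.L {k n m : ℕ} {u y : U} (hu : u ∈ S.Deg k) (hy : y ∈ S.L n)
    (h : n + k = m := by omega) : y * u ∈ S.L m := h ▸ hu n y hy

theorem Neg.L {k n m : ℕ} {u y : U} (hu : u ∈ S.Neg k) (hy : y ∈ S.L n)
    (h : n + k = m := by omega) : y * u ∈ S.B m := h ▸ hu n y hy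

theorem Deg.mul {k l m : ℕ} {u v : U} (hu : u ∈ S.Deg k) (hv : v ∈ S.Deg l)
    (h : k + l = m := by omega) : u * v ∈ S.Deg m := fun n y hy => by
  rw [← mul_assoc]; exact Deg.L hv (hu n y hy)

theorem Deg.G {k n m : ℕ} {u y : U} (hu : u ∈ S.Deg k) (hy : y ∈ S.G n)
    (h : n + k = m := by omega) : y * u ∈ S.G m := by
  have : S.G n ≤ (S.G m).comap (LinearMap.mulRight ℂ u) :=
    Submodule.span_le.2 fun z hz => S.L_le_G (Deg.L hu hz)
  exact this hy

theorem Deg.G_pred {k n m : ℕ} {u y : U} (hu : u ∈ S.Deg k) (hy : y ∈ S.G (n - 1))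
    (h : n + k - 1 = m := by omega) : y * u ∈ S.G m := by
  cases n with
  | zero => rw [Nat.zero_sub, G_zero] at hy; exact S.J_le_G _ (S.mul_mem y hy u)
  | succ n => exact Deg.G hu hy

theorem Deg.B {k n m : ℕ} {u y : U} (hu : u ∈ S.Deg k) (hy : y ∈ S.B n)
    (h : n + k = m := by omega) : y * u ∈ S.B m := by
  have : S.B n ≤ (S.B m).comap (LinearMap.mulRight S.A u) := S.B_le
    (fun z hz => by
      rw [Submodule.mem_comap, LinearMap.mulRight_apply, smul_mul_assoc]
      exact S.h_smul_mem_B (Deg.L hu hz))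
    (fun z hz => S.G_le_B (Deg.G_pred hu hz))
  exact this hy

theorem Deg.mul_neg {k l m : ℕ} {u v : U} (hu : u ∈ S.Deg k) (hv : v ∈ S.Neg l)
    (h : k + l = m := by omega) : u * v ∈ S.Neg m := fun n y hy => by
  rw [← mul_assoc]; exact Neg.L hv (hu n y hy)

theorem Neg.mul_deg {k l m : ℕ} {u v : U} (hu : u ∈ S.Neg k) (hv : v ∈ S.Deg l)
    (h : k + l = m := by omega) : u * v ∈ S.Neg m := fun n y hy => by
  rw [← mul_assoc]; exact Deg.B hv (hu n y hy)

theorem Deg.h_smul {k : ℕ} {u : U} (hu : u ∈ S.Deg k) : (S.h : ℂ) • u ∈ S.Neg k :=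
  fun n y hy => by rw [mul_smul_comm]; exact S.h_smul_mem_B (hu n y hy)

theorem Deg.one : 1 ∈ S.Deg 0 := fun n y hy => by simpa using hy

theorem Deg.x (γ : S.ι) : S.x γ ∈ S.Deg 1 := fun _ _ hy => S.mul_x_mem_L hy γ

end FiltData

namespace FiltData

variable {U : Type} [Ring U] [Algebra ℂ U] (S : FiltData U)

theorem exists_finite_span_L [Finite S.ι] (n : ℕ) :
    ∃ s : Set U, s.Finite ∧ S.L n = S.J.restrictScalars S.A ⊔ Submodule.span S.A s := by
  induction n with
  | zero => exact ⟨∅, Set.finite_empty, by rw [Submodule.span_empty, sup_bot_eq]; rfl⟩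
  | succ n ih =>
    obtain ⟨s, hs, hL⟩ := ih
    have hsL : s ⊆ S.L n := fun z hz => hL ▸ Submodule.mem_sup_right (Submodule.subset_span hz)
    refine ⟨insert 1 (s ∪ ⋃ γ, (fun y => y * S.x γ) '' s), ((hs.union
      (Set.finite_iUnion fun γ => hs.image _)).insert _), le_antisymm ?_ (sup_le
        (fun y hy => S.J_le_L _ hy) (Submodule.span_le.2 ?_))⟩
    · refine S.L_succ_le ?_ ?_ ?_
      · exact Submodule.mem_sup_right (Submodule.subset_span (Set.mem_insert _ _))
      · rw [hL]
        exact sup_le_sup le_rfl (Submodule.span_mono fun z hz => Or.inr (Or.inl hz))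
      · intro y hy γ
        rw [hL] at hy
        obtain ⟨j, hj, w, hw, rfl⟩ := Submodule.mem_sup.1 hy
        rw [add_mul]
        refine Submodule.add_mem_sup (S.mul_mem j hj _) ?_
        have : Submodule.span S.A s ≤ (Submodule.span S.A (insert 1 (s ∪ ⋃ γ,
            (fun y => y * S.x γ) '' s))).comap (LinearMap.mulRight S.A (S.x γ)) :=
          Submodule.span_le.2 fun z hz => Submodule.subset_span
            (Or.inr (Or.inr (Set.mem_iUnion.2 ⟨γ, z, hz, rfl⟩)))
        exact this hw
    · rintro z (rfl | hz | hz)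
      · exact S.one_mem_L n
      · exact S.L_le_succ n (hsL hz)
      · obtain ⟨γ, y, hy, rfl⟩ := Set.mem_iUnion.1 hz
        exact S.mul_x_mem_L (hsL hy) γ

/-- If `T` acts on the degree `m` part of the filtration as multiplication by `m`, up to
negligible terms, then it is injective on the degree `m` part of the associated graded space. -/
theorem mem_G_of_euler [Finite S.ι] (hjac : Ideal.span {S.h} ≤ (⊥ : Ideal S.A).jacobson)
    (T : U →ₗ[ℂ] U) (hT : ∀ n, ∀ y ∈ S.L (n + 1), T y - (n : ℂ) • y ∈ S.B (n + 1))
    {m : ℕ} (hm : (((m + 1 : ℕ) : ℂ))⁻¹ ∈ S.A) {x : U} (hx : x ∈ S.G (m + 2))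
    (hTx : T x ∈ S.G (m + 1)) : x ∈ S.G (m + 1) := by
  have hTG : ∀ n, S.G (n + 1) ≤ (S.G (n + 1)).comap T := fun n => Submodule.span_le.2 fun y hy => by
    have := add_mem (S.B_le_G (hT n y hy)) ((S.G (n + 1)).smul_mem (n : ℂ) (S.L_le_G hy))
    rwa [sub_add_cancel] at this
  set π := (S.G (m + 1)).mkQ with hπ
  set T' : (U ⧸ S.G (m + 1)) →ₗ[ℂ] (U ⧸ S.G (m + 1)) := (S.G (m + 1)).mapQ _ T (hTG m) with hT'
  have hTπ : ∀ y, T' (π y) = π (T y) := fun y => Submodule.mapQ_apply _ _ _ _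
  set M : Submodule S.A (U ⧸ S.G (m + 1)) := (S.L (m + 2)).map (π.restrictScalars S.A) with hM
  have hπ0 : ∀ y ∈ S.G (m + 1), π y = 0 := fun y hy => (Submodule.Quotient.mk_eq_zero _).2 hy
  obtain ⟨s, hs, hL⟩ := S.exists_finite_span_L (m + 2)
  have hMs : M = Submodule.span S.A (π '' s) := by
    rw [hM, hL, Submodule.map_sup, Submodule.map_span]
    refine sup_eq_right.2 ?_
    rintro _ ⟨j, hj, rfl⟩
    rw [LinearMap.restrictScalars_apply, hπ0 j (S.J_le_G _ hj)]
    exact zero_mem _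
  have hfg : M.FG := Submodule.fg_def.2 ⟨_, hs.image π, hMs.symm⟩
  have hnak : M ≤ M.map (T'.restrictScalars S.A) := by
    refine Submodule.le_of_le_smul_of_le_jacobson_bot hfg hjac ?_
    rintro _ ⟨y, hy, rfl⟩
    obtain ⟨y', hy', w, hw, h⟩ := S.mem_B.1 (hT _ y hy)
    set a : S.A := ⟨_, hm⟩ with ha
    have hm0 : ((m + 1 : ℕ) : ℂ) ≠ 0 := Nat.cast_ne_zero.2 (Nat.succ_ne_zero m)
    have h1 : π y = T' (π (a • y)) - S.h • π (a • y') := by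
      have h2 : T (a • y) = y + S.h • (a • y') + a • w := by
        have h3 : T (a • y) = (((m + 1 : ℕ) : ℂ)⁻¹) • T y := T.map_smul _ y
        have h4 : a • w = (((m + 1 : ℕ) : ℂ)⁻¹) • w := rfl
        have h5 : S.h • (a • y') = (((m + 1 : ℕ) : ℂ)⁻¹) • (S.h • y') :=
          smul_comm (S.h : ℂ) _ y'
        rw [h3, h4, h5, sub_eq_iff_eq_add.1 h, smul_add, smul_add, smul_smul, inv_mul_cancel₀ hm0,
          one_smul]
        abel
      have h6 : π (S.h • (a • y')) = S.h • π (a • y') := π.map_smul (S.h : ℂ) _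
      rw [hTπ, h2, map_add, map_add, hπ0 (a • w) ((S.G _).smul_mem _ hw), h6]
      abel
    rw [LinearMap.restrictScalars_apply, h1]
    refine sub_mem (Submodule.mem_sup_left ⟨π (a • y), ⟨a • y, (S.L _).smul_mem a hy, rfl⟩, rfl⟩)
      (Submodule.mem_sup_right (Submodule.smul_mem_smul (Ideal.mem_span_singleton_self _)
        ⟨a • y', (S.L _).smul_mem a hy', rfl⟩))
  set V : Submodule ℂ (U ⧸ S.G (m + 1)) := Submodule.span ℂ (π '' s) with hV
  have hVG : V = (S.G (m + 2)).map π := by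
    have hMV : (M : Set (U ⧸ S.G (m + 1))) ⊆ V := by
      rw [hMs]
      exact Submodule.span_subset_span S.A ℂ _
    refine le_antisymm (Submodule.span_le.2 ?_) ?_
    · rintro _ ⟨y, hy, rfl⟩
      exact ⟨y, S.L_le_G (hL ▸ Submodule.mem_sup_right (Submodule.subset_span hy)), rfl⟩
    · change (Submodule.span ℂ (S.L (m + 2) : Set U)).map π ≤ V
      rw [Submodule.map_span, Submodule.span_le]
      rintro _ ⟨y, hy, rfl⟩
      exact hMV ⟨y, hy, rfl⟩
  have hTV : ∀ v ∈ V, T' v ∈ V := by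
    rw [hVG]
    rintro _ ⟨y, hy, rfl⟩
    exact ⟨T y, hTG _ hy, (hTπ y).symm⟩
  have : FiniteDimensional ℂ V := FiniteDimensional.span_of_finite ℂ (hs.image π)
  have hsurj : Function.Surjective (T'.restrict hTV) := by
    rintro ⟨v, hv⟩
    have : V ≤ V.map T' := by
      rw [hV, Submodule.map_span, Submodule.span_le]
      rintro _ ⟨y, hy, rfl⟩
      have hyM : π y ∈ M := hMs ▸ Submodule.subset_span ⟨y, hy, rfl⟩
      obtain ⟨z, hz, hzy⟩ := hnak hyM
      have hz' : z ∈ V := by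
        rw [hMs] at hz
        exact Submodule.span_subset_span S.A ℂ _ hz
      rw [← Submodule.map_span]
      exact ⟨z, hz', hzy⟩
    obtain ⟨w, hw, rfl⟩ := this hv
    exact ⟨⟨w, hw⟩, rfl⟩
  have hinj := (LinearMap.injective_iff_surjective (f := T'.restrict hTV)).2 hsurj
  have hxV : π x ∈ V := hVG ▸ ⟨x, hx, rfl⟩
  have h0 : (⟨π x, hxV⟩ : V) = 0 := hinj (Subtype.ext (by
    rw [map_zero, LinearMap.coe_restrict_apply, hTπ, hπ0 _ hTx]; rfl))
  exact (Submodule.Quotient.mk_eq_zero _).1 (congrArg Subtype.val h0)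

end FiltData

section Der

variable {U : Type} [Ring U] [Bialgebra ℂ U]

/-- The map `a ⊗ b ↦ g b • a`. -/
def derTensor (g : U →ₗ[ℂ] ℂ) : U ⊗[ℂ] U →ₗ[ℂ] U :=
  (TensorProduct.rid ℂ U).toLinearMap ∘ₗ LinearMap.lTensor U g

/-- The left convolution action `u ↦ u₁ g(u₂)` of a functional. -/
def der (g : U →ₗ[ℂ] ℂ) : U →ₗ[ℂ] U := derTensor g ∘ₗ Coalgebra.comul

/-- The functional `u ↦ g (u b)`. -/
def mulArg (g : U →ₗ[ℂ] ℂ) (b : U) : U →ₗ[ℂ] ℂ := g ∘ₗ LinearMap.mulRight ℂ b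

theorem mulArg_apply (g : U →ₗ[ℂ] ℂ) (b u : U) : mulArg g b u = g (u * b) := rfl

theorem derTensor_tmul (g : U →ₗ[ℂ] ℂ) (a b : U) : derTensor g (a ⊗ₜ[ℂ] b) = g b • a := by
  simp [derTensor]

theorem derTensor_mul_tmul (g : U →ₗ[ℂ] ℂ) (t : U ⊗[ℂ] U) (a b : U) :
    derTensor g (t * a ⊗ₜ[ℂ] b) = derTensor (mulArg g b) t * a := by
  induction t with
  | zero => simp
  | tmul u v =>
    simp [Algebra.TensorProduct.tmul_mul_tmul, derTensor_tmul, mulArg_apply]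
  | add t t' h h' => rw [add_mul, map_add, h, h', map_add, add_mul]

theorem derTensor_tmul_mul (g : U →ₗ[ℂ] ℂ) (t : U ⊗[ℂ] U) (a b : U) :
    derTensor g (a ⊗ₜ[ℂ] b * t) = a * derTensor (g ∘ₗ LinearMap.mulLeft ℂ b) t := by
  induction t with
  | zero => simp
  | tmul u v =>
    simp [Algebra.TensorProduct.tmul_mul_tmul, derTensor_tmul]
  | add t t' h h' => rw [mul_add, map_add, h, h', map_add, mul_add]

theorem der_mul_of_comul (g : U →ₗ[ℂ] ℂ) {c p p' : U}
    (hc : Coalgebra.comul (R := ℂ) c = c ⊗ₜ[ℂ] p + p' ⊗ₜ[ℂ] c) (u : U) :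
    der g (u * c) = der (mulArg g p) u * c + der (mulArg g c) u * p' := by
  simp only [der, LinearMap.comp_apply, Bialgebra.comul_mul, hc, mul_add, map_add,
    derTensor_mul_tmul]

theorem der_one (g : U →ₗ[ℂ] ℂ) : der g 1 = g 1 • 1 := by
  rw [der, LinearMap.comp_apply, Bialgebra.comul_one, Algebra.TensorProduct.one_def,
    derTensor_tmul]

theorem der_add (g g' : U →ₗ[ℂ] ℂ) (u : U) : der (g + g') u = der g u + der g' u := by
  simp [der, derTensor, LinearMap.lTensor_add]

theorem der_smul (a : ℂ) (g : U →ₗ[ℂ] ℂ) (u : U) : der (a • g) u = a • der g u := by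
  simp [der, derTensor, LinearMap.lTensor_smul]

theorem der_counit (u : U) : der (Coalgebra.counit (R := ℂ)) u = u := by
  simp [der, derTensor]

end Der

/-- Elements obtained from `base` by iterated `q`-commutators with elements of `C`. -/
inductive IsWord {U : Type} [Ring U] [Algebra ℂ U] (q : ℂ) (base C : Set U) : U → Prop
  | of_base {u : U} (hu : u ∈ base) : IsWord q base C u
  | step {u c : U} (hu : IsWord q base C u) (hc : c ∈ C) : IsWord q base C (qComm q u c)

/-- A filtration of a bialgebra whose generators are iterated `q`-commutators of skew primitive
elements, compatible with the convolution action of functionals vanishing on `J`. -/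
structure SkewFilt (U : Type) [Ring U] [Bialgebra ℂ U] extends FiltData U where
  q : ℂ
  q_ne_zero : q ≠ 0
  q_inv_mem : q⁻¹ ∈ A
  h_eq : (h : ℂ) = q - 1
  h_ne_zero : (h : ℂ) ≠ 0
  base : Set U
  C : Set U
  P : Set U
  skew : ∀ c ∈ base ∪ C, ∃ p ∈ P, ∃ p' ∈ P,
    Coalgebra.comul (R := ℂ) c = c ⊗ₜ[ℂ] p + p' ⊗ₜ[ℂ] c
  P_deg : ∀ p ∈ P, p ∈ toFiltData.Deg 0
  P_neg : ∀ p ∈ P, p - 1 ∈ toFiltData.Neg 0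
  P_J : ∀ p ∈ P, p - 1 ∈ J
  base_deg : ∀ u ∈ base, u ∈ toFiltData.Deg 1
  C_deg : ∀ c ∈ C, c ∈ toFiltData.Deg 0
  C_J : ∀ c ∈ C, c ∈ J
  isWord : ∀ γ, IsWord q base C (x γ)
  counit_J : ∀ j ∈ J, Coalgebra.counit (R := ℂ) j = 0
  der_J : ∀ g : U →ₗ[ℂ] ℂ, (∀ j ∈ J, g j = 0) → ∀ j ∈ J, der g j ∈ J

namespace FiltData

variable {U : Type} [Ring U] [Algebra ℂ U] (S : FiltData U)

/-- `L n` enlarged by the complex span of the lower degree part. -/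
def M (n : ℕ) : Submodule S.A U := S.L n ⊔ (S.G (n - 1)).restrictScalars S.A

variable {S}

theorem mem_M {n : ℕ} {z : U} : z ∈ S.M n ↔ ∃ y ∈ S.L n, ∃ w ∈ S.G (n - 1), y + w = z :=
  Submodule.mem_sup

theorem M_mono : Monotone S.M := fun _ _ h => sup_le_sup (S.L_mono h) (S.G_mono (by omega))

theorem L_le_M {n : ℕ} {y : U} (hy : y ∈ S.L n) : y ∈ S.M n := Submodule.mem_sup_left hy

theorem G_le_M {n : ℕ} {y : U} (hy : y ∈ S.G (n - 1)) : y ∈ S.M n := Submodule.mem_sup_right hy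

theorem J_le_M (n : ℕ) {y : U} (hy : y ∈ S.J) : y ∈ S.M n := L_le_M (S.J_le_L n hy)

theorem Deg.M {n k m : ℕ} {y u : U} (hu : u ∈ S.Deg k) (hy : y ∈ S.M n)
    (h : n + k = m := by omega) : y * u ∈ S.M m := by
  obtain ⟨z, hz, w, hw, rfl⟩ := mem_M.1 hy
  rw [add_mul]
  exact add_mem (L_le_M (Deg.L hu hz)) (G_le_M (Deg.G_pred hu hw))

theorem Neg.M {n k m : ℕ} {y u : U} (hu : u ∈ S.Neg k) (hu' : u ∈ S.Deg k) (hy : y ∈ S.M n)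
    (h : n + k = m := by omega) : y * u ∈ S.B m := by
  obtain ⟨z, hz, w, hw, rfl⟩ := mem_M.1 hy
  rw [add_mul]
  exact add_mem (Neg.L hu hz) (S.G_le_B (Deg.G_pred hu' hw))

theorem h_smul_M {n : ℕ} {y : U} (hy : y ∈ S.M n) : (S.h : ℂ) • y ∈ S.B n := by
  obtain ⟨z, hz, w, hw, rfl⟩ := mem_M.1 hy
  rw [smul_add]
  exact add_mem (S.h_smul_mem_B hz) (S.G_le_B ((S.G _).smul_mem _ hw))

variable (S)

/-- Functionals killing `J` and `1` that take values in `A` on `L 2`. -/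
structure IsInt (g : U →ₗ[ℂ] ℂ) : Prop where
  J : ∀ j ∈ S.J, g j = 0
  one : g 1 = 0
  mem : ∀ y ∈ S.L 2, g y ∈ S.A

end FiltData

namespace SkewFilt

open FiltData

variable {U : Type} [Ring U] [Bialgebra ℂ U] (S : SkewFilt U)

theorem word_deg {u : U} (hu : IsWord S.q S.base S.C u) : u ∈ S.Deg 1 := by
  induction hu with
  | of_base hu => exact S.base_deg _ hu
  | @step u c hu hc ih =>
    have h1 : u * c ∈ S.Deg 1 := Deg.mul ih (S.C_deg _ hc)
    have h2 : c * u ∈ S.Deg 1 := Deg.mul (S.C_deg _ hc) ih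
    exact sub_mem h1 (S.smul_mem' _ S.q_inv_mem h2)

variable {S}

theorem mulArg_eq_zero {k p m : ℕ} {u : U} {g : U →ₗ[ℂ] ℂ} (hg : ∀ y ∈ S.G m, g y = 0)
    (hu : u ∈ S.Deg k) (h : p + k = m) : ∀ y ∈ S.G p, mulArg g u y = 0 :=
  fun _ hy => hg _ (Deg.G hu hy h)

variable (S)

/-- Functionals killing `G p` lower the degree by at least `p`. -/
theorem der_mem_G (n : ℕ) : ∀ (p : ℕ) (g : U →ₗ[ℂ] ℂ), (∀ y ∈ S.G p, g y = 0) →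
    ∀ y ∈ S.G n, der g y ∈ S.G (n - p) := by
  induction n with
  | zero =>
    intro p g hg y hy
    rw [Nat.zero_sub, G_zero] at *
    exact S.der_J g (fun j hj => hg j (S.J_le_G p hj)) y hy
  | succ n ih =>
    have hword : ∀ u, IsWord S.q S.base S.C u → ∀ (p : ℕ) (g : U →ₗ[ℂ] ℂ),
        (∀ y ∈ S.G p, g y = 0) → ∀ y ∈ S.G n, der g (y * u) ∈ S.G (n + 1 - p) := by
      intro u hu
      induction hu with
      | @of_base u hu =>
        intro p g hg y hy
        obtain ⟨k, hk, k', hk', hc⟩ := S.skew _ (Or.inl hu)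
        rw [der_mul_of_comul g hc]
        have h1 := ih p (mulArg g k) (mulArg_eq_zero hg (S.P_deg k hk) rfl) y hy
        have h2 : der (mulArg g u) y ∈ S.G (n + 1 - p) := by
          cases p with
          | zero =>
            have h3 : ∀ z ∈ S.G 0, mulArg g u z = 0 := by
              intro z hz
              refine hg _ ?_
              rw [G_zero] at hz ⊢
              exact S.mul_mem _ hz _
            exact S.G_mono (Nat.le_succ n) (ih 0 _ h3 y hy)
          | succ p =>
            rw [Nat.add_sub_add_right]
            exact ih p _ (mulArg_eq_zero hg (S.base_deg _ hu) rfl) y hy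
        refine add_mem ?_ (Deg.G (S.P_deg k' hk') h2)
        rcases Nat.lt_or_ge n p with hnp | hnp
        · rw [Nat.sub_eq_zero_of_le hnp.le, G_zero] at h1
          exact S.J_le_G _ (S.mul_mem _ h1 _)
        · exact Deg.G (S.base_deg _ hu) h1
      | @step u c hu hc ihu =>
        intro p g hg y hy
        obtain ⟨k, hk, k', hk', hcc⟩ := S.skew _ (Or.inr hc)
        rw [qComm, mul_sub, mul_smul_comm, map_sub, map_smul, ← mul_assoc, ← mul_assoc,
          der_mul_of_comul g hcc]
        have h1 := ihu p _ (mulArg_eq_zero hg (S.P_deg k hk) rfl) y hy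
        have h2 := ihu p _ (mulArg_eq_zero hg (S.C_deg c hc) rfl) y hy
        have h3 : y * c ∈ S.G n := Deg.G (S.C_deg c hc) hy
        exact sub_mem (add_mem (Deg.G (S.C_deg c hc) h1) (Deg.G (S.P_deg k' hk') h2))
          ((S.G _).smul_mem _ (ihu p g hg _ h3))
    intro p g hg
    refine fun y hy => (Submodule.span_le (p := (S.G (n + 1 - p)).comap (der g))).2
      (S.L_succ_le (P := ((S.G (n + 1 - p)).comap (der g)).restrictScalars S.A) ?_ ?_ ?_) hy
    · change der g 1 ∈ S.G (n + 1 - p)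
      rw [der_one]
      cases p with
      | zero => exact (S.G _).smul_mem _ (S.one_mem_G n)
      | succ p => rw [hg 1 (S.one_mem_G p), zero_smul]; exact zero_mem _
    · exact fun y hy => S.G_mono (by omega) (ih p g hg y (S.L_le_G hy))
    · exact fun y hy γ => hword _ (S.isWord γ) p g hg y (S.L_le_G hy)

variable {S}

theorem isInt_mulArg_C {g : U →ₗ[ℂ] ℂ} (hg : S.IsInt g) {c : U} (hc : c ∈ S.C) :
    S.IsInt (mulArg g c) where
  J j hj := hg.J _ (S.mul_mem j hj c)
  one := by rw [mulArg_apply, one_mul]; exact hg.J _ (S.C_J c hc)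
  mem y hy := hg.mem _ (Deg.L (S.C_deg c hc) hy)

theorem isInt_mulArg_P {g : U →ₗ[ℂ] ℂ} (hg : S.IsInt g) {p : U} (hp : p ∈ S.P) :
    ∃ g', S.IsInt g' ∧ mulArg g p = g + (S.h : ℂ) • g' := by
  have hG : ∀ w ∈ S.G 1, g w = 0 := by
    intro w hw
    rw [G_one] at hw
    obtain ⟨a, ha, j, hj, rfl⟩ := Submodule.mem_sup.1 hw
    obtain ⟨t, rfl⟩ := Submodule.mem_span_singleton.1 ha
    rw [map_add, map_smul, hg.one, hg.J j hj, smul_zero, add_zero]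
  refine ⟨(S.h : ℂ)⁻¹ • mulArg g (p - 1), ⟨fun j hj => ?_, ?_, fun y hy => ?_⟩, ?_⟩
  · rw [LinearMap.smul_apply, mulArg_apply, hg.J _ (S.mul_mem j hj _), smul_zero]
  · rw [LinearMap.smul_apply, mulArg_apply, one_mul, hg.J _ (S.P_J p hp), smul_zero]
  · obtain ⟨z, hz, w, hw, h⟩ := S.mem_B.1 (Neg.L (m := 2) (S.P_neg p hp) hy)
    have : g (S.h • z) = (S.h : ℂ) * g z := g.map_smul (S.h : ℂ) z
    rw [LinearMap.smul_apply, mulArg_apply, h, map_add, hG w hw, add_zero, this, smul_eq_mul,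
      inv_mul_cancel_left₀ S.h_ne_zero]
    exact hg.mem z hz
  · ext y
    simp [mulArg_apply, mul_sub, S.h_ne_zero]

/-- Integral functionals lower the degree by one. -/
theorem isInt_der_mem {n : ℕ} : ∀ {g : U →ₗ[ℂ] ℂ}, S.IsInt g → ∀ y ∈ S.L n,
    der g y ∈ S.M (n - 1) := by
  induction n with
  | zero => exact fun hg y hy => J_le_M 0 (S.der_J _ hg.J y hy)
  | succ n ih =>
    have hword : ∀ u, IsWord S.q S.base S.C u → ∀ {g : U →ₗ[ℂ] ℂ}, S.IsInt g →
        ∀ y ∈ S.L n, der g (y * u) ∈ S.M n := by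
      intro u hu
      induction hu with
      | @of_base u hu =>
        intro g hg y hy
        rcases n with _ | n
        · exact J_le_M 0 (S.der_J _ hg.J _ (S.mul_mem _ hy _))
        obtain ⟨k, hk, k', hk', hc⟩ := S.skew _ (Or.inl hu)
        rw [der_mul_of_comul g hc]
        have h1 : der (mulArg g k) y ∈ S.M n := by
          obtain ⟨g', hg', h⟩ := isInt_mulArg_P hg hk
          rw [h, der_add, der_smul]
          exact add_mem (ih hg y hy) (S.smul_mem' _ S.h.2 (ih hg' y hy))
        have h2 : der (mulArg g u) y ∈ S.M (n + 1) := by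
          have hu1 : g u ∈ S.A := hg.mem u (by
            have : 1 * u ∈ S.L 2 := Deg.L (S.base_deg u hu) (S.one_mem_L 0)
            rwa [one_mul] at this)
          have h3 : ∀ z ∈ S.G 1, (mulArg g u - g u • (Coalgebra.counit : U →ₗ[ℂ] ℂ)) z = 0 := by
            intro w hw
            rw [G_one] at hw
            obtain ⟨a, ha, j, hj, rfl⟩ := Submodule.mem_sup.1 hw
            obtain ⟨t, rfl⟩ := Submodule.mem_span_singleton.1 ha
            simp [mulArg_apply, add_mul, hg.J _ (S.mul_mem j hj u), S.counit_J j hj, mul_comm]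
          have h4 := S.der_mem_G (n + 1) 1 _ h3 y (S.L_le_G hy)
          have h5 : mulArg g u = (mulArg g u - g u • (Coalgebra.counit : U →ₗ[ℂ] ℂ)) +
            g u • (Coalgebra.counit : U →ₗ[ℂ] ℂ) := (sub_add_cancel _ _).symm
          rw [h5, der_add, der_smul, der_counit]
          exact add_mem (G_le_M h4) (L_le_M (S.smul_mem' _ hu1 hy))
        exact add_mem (Deg.M (S.base_deg u hu) h1) (Deg.M (S.P_deg k' hk') h2)
      | @step u c hu hc ihu =>
        intro g hg y hy
        obtain ⟨k, hk, k', hk', hcc⟩ := S.skew _ (Or.inr hc)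
        rw [qComm, mul_sub, mul_smul_comm, map_sub, map_smul, ← mul_assoc, ← mul_assoc,
          der_mul_of_comul g hcc]
        have h1 : der (mulArg g k) (y * u) ∈ S.M n := by
          obtain ⟨g', hg', h⟩ := isInt_mulArg_P hg hk
          rw [h, der_add, der_smul]
          exact add_mem (ihu hg y hy) (S.smul_mem' _ S.h.2 (ihu hg' y hy))
        have h2 := ihu (isInt_mulArg_C hg hc) y hy
        have h3 : y * c ∈ S.L n := Deg.L (S.C_deg c hc) hy
        exact sub_mem (add_mem (Deg.M (S.C_deg c hc) h1) (Deg.M (S.P_deg k' hk') h2))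
          (S.smul_mem' _ S.q_inv_mem (ihu hg _ h3))
    intro g hg
    refine S.L_succ_le (P := (S.M n).comap ((der g).restrictScalars S.A)) ?_ ?_ ?_
    · change der g 1 ∈ S.M n
      rw [der_one, hg.one, zero_smul]
      exact zero_mem _
    · exact fun y hy => M_mono (Nat.sub_le n 1) (ih hg y hy)
    · exact fun y hy γ => hword _ (S.isWord γ) hg y hy

end SkewFilt

namespace SkewFilt

open FiltData

variable {U : Type} [Ring U] [Bialgebra ℂ U] {S : SkewFilt U}

variable (S) in
/-- The Leibniz rule for right multiplication by `u`, up to negligible terms. -/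
def Leibniz (u : U) : Prop :=
  ∀ g : U →ₗ[ℂ] ℂ, S.IsInt g → ∀ n, ∀ y ∈ S.L n,
    der g (y * u) - der g y * u - g u • y ∈ S.B n

theorem isInt_der_mulArg_P {g : U →ₗ[ℂ] ℂ} (hg : S.IsInt g) {k : U} (hk : k ∈ S.P) {n : ℕ}
    {y : U} (hy : y ∈ S.L n) : der (mulArg g k) y - der g y ∈ S.B (n - 1) := by
  obtain ⟨g', hg', h⟩ := isInt_mulArg_P hg hk
  rw [h, der_add, der_smul, add_sub_cancel_left]
  exact h_smul_M (isInt_der_mem hg' y hy)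

theorem isInt_mem {g : U →ₗ[ℂ] ℂ} (hg : S.IsInt g) {u : U} (hu : u ∈ S.Deg 1) : g u ∈ S.A :=
  hg.mem u (by
    have : 1 * u ∈ S.L 2 := Deg.L hu (S.one_mem_L 0)
    rwa [one_mul] at this)

theorem leibniz_zero {g : U →ₗ[ℂ] ℂ} (hg : S.IsInt g) {u y : U} (hy : y ∈ S.L 0) :
    der g (y * u) - der g y * u - g u • y ∈ S.B 0 :=
  S.J_le_B 0 (sub_mem (sub_mem (S.der_J _ hg.J _ (S.mul_mem _ hy _))
    (S.mul_mem _ (S.der_J _ hg.J _ hy) _)) (S.J.smul_mem _ hy))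

theorem leibniz_base {u : U} (hu : u ∈ S.base) : S.Leibniz u := by
  intro g hg n y hy
  rcases n with _ | n
  · exact leibniz_zero hg hy
  obtain ⟨k, hk, k', hk', hc⟩ := S.skew _ (Or.inl hu)
  have h1 : (der (mulArg g k) y - der g y) * u ∈ S.B (n + 1) :=
    Deg.B (S.base_deg u hu) (isInt_der_mulArg_P hg hk hy)
  have h3 : ∀ z ∈ S.G 1, (mulArg g u - g u • (Coalgebra.counit : U →ₗ[ℂ] ℂ)) z = 0 := by
    intro w hw
    rw [G_one] at hw
    obtain ⟨a, ha, j, hj, rfl⟩ := Submodule.mem_sup.1 hw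
    obtain ⟨t, rfl⟩ := Submodule.mem_span_singleton.1 ha
    simp [mulArg_apply, add_mul, hg.J _ (S.mul_mem j hj u), S.counit_J j hj, mul_comm]
  have h4 : der (mulArg g u - g u • (Coalgebra.counit : U →ₗ[ℂ] ℂ)) y ∈ S.B (n + 1) :=
    S.G_le_B (S.der_mem_G (n + 1) 1 _ h3 y (S.L_le_G hy))
  have h5 : mulArg g u = (mulArg g u - g u • (Coalgebra.counit : U →ₗ[ℂ] ℂ)) +
    g u • (Coalgebra.counit : U →ₗ[ℂ] ℂ) := (sub_add_cancel _ _).symm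
  have h6 : y * (k' - 1) ∈ S.B (n + 1) := Neg.L (S.P_neg k' hk') hy
  have h7 := add_mem (add_mem h1 (Deg.B (m := n + 1) (S.P_deg k' hk') h4))
    (S.smul_mem' _ (isInt_mem hg (S.base_deg u hu)) h6)
  rw [der_mul_of_comul g hc]
  convert h7 using 1
  conv_lhs => rw [h5, der_add, der_smul, der_counit]
  simp only [sub_mul, add_mul, mul_sub, mul_one, smul_sub, smul_mul_assoc]
  abel

theorem Leibniz.step {u c : U} (hu : S.Leibniz u) (hud : u ∈ S.Deg 1) (hc : c ∈ S.C) :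
    S.Leibniz (qComm S.q u c) := by
  intro g hg n y hy
  rcases n with _ | n
  · exact leibniz_zero hg hy
  obtain ⟨k, hk, k', hk', hcc⟩ := S.skew _ (Or.inr hc)
  have hgc := isInt_mulArg_C hg hc
  have hq : (1 : ℂ) - S.q⁻¹ = S.q⁻¹ * S.h := by
    rw [S.h_eq, mul_sub, inv_mul_cancel₀ S.q_ne_zero, mul_one]
  have hyu : y * u ∈ S.L (n + 2) := Deg.L hud hy
  have hyc : y * c ∈ S.L (n + 1) := Deg.L (S.C_deg c hc) hy
  -- replace `mulArg g k` by `g`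
  have e1 : (der (mulArg g k) (y * u) - der g (y * u)) * c ∈ S.B (n + 1) :=
    Deg.B (S.C_deg c hc) (isInt_der_mulArg_P hg hk hyu)
  have e2 : (der (mulArg g k) y - der g y) * c ∈ S.B n :=
    Deg.B (S.C_deg c hc) (isInt_der_mulArg_P hg hk hy)
  have e2' : (der (mulArg g k) y - der g y) * c * u ∈ S.B (n + 1) := Deg.B hud e2
  have e3 : (der g (y * u) - der g y * u - g u • y) * c ∈ S.B (n + 1) :=
    Deg.B (S.C_deg c hc) (hu g hg _ y hy)
  have e4 : (der (mulArg g c) (y * u) - der (mulArg g c) y * u - mulArg g c u • y) * k' ∈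
      S.B (n + 1) := Deg.B (S.P_deg k' hk') (hu _ hgc _ y hy)
  have e5 := hu g hg _ _ hyc
  -- the remaining terms
  have f1 : (S.h : ℂ) • (y * c) ∈ S.B (n + 1) := S.h_smul_mem_B hyc
  have f2 : y * (k' - 1) ∈ S.B (n + 1) := Neg.L (S.P_neg k' hk') hy
  have f3 : der (mulArg g c) y * (u * (k' - 1)) ∈ S.B (n + 1) :=
    Neg.M (k := 1) (Deg.mul_neg hud (S.P_neg k' hk'))
      (Deg.mul hud (sub_mem (S.P_deg k' hk') Deg.one)) (isInt_der_mem hgc y hy)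
  have f4 : der (mulArg g c) y * ((k' - 1) * u) ∈ S.B (n + 1) :=
    Neg.M (k := 1) (Neg.mul_deg (S.P_neg k' hk') hud)
      (Deg.mul (sub_mem (S.P_deg k' hk') Deg.one) hud) (isInt_der_mem hgc y hy)
  have f5 : (S.h : ℂ) • (der (mulArg g c) y * u) ∈ S.B (n + 1) :=
    h_smul_M (Deg.M hud (isInt_der_mem hgc y hy))
  have hcu : g (c * u) = 0 := hg.J _ (S.mul_mem _ (S.C_J c hc) _)
  have key := add_mem (add_mem (add_mem (add_mem e1 e3) e4) (add_mem (add_mem (S.smul_mem' _ (isInt_mem hgc hud) f2) f3)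
    (S.smul_mem' _ (S.A.mul_mem S.q_inv_mem (isInt_mem hg hud)) f1)))
    (S.smul_mem' _ S.q_inv_mem (sub_mem (sub_mem f5 f4) (add_mem e2' e5)))
  convert key using 1
  have hyc' : der g (y * c) = der (mulArg g k) y * c + der (mulArg g c) y * k' :=
    der_mul_of_comul g hcc y
  have hyuc : der g (y * u * c) =
      der (mulArg g k) (y * u) * c + der (mulArg g c) (y * u) * k' :=
    der_mul_of_comul g hcc _
  rw [qComm, hyc', mul_sub, mul_smul_comm, ← mul_assoc, ← mul_assoc, map_sub, hyuc, map_sub,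
    map_smul, map_smul, hcu, smul_zero, sub_zero, mulArg_apply]
  simp only [sub_mul, add_mul, mul_sub, mul_one, one_mul, smul_mul_assoc, mul_smul_comm,
    ← mul_assoc]
  linear_combination (norm := module) hq • (g u • (y * c) + der (mulArg g c) y * u)

theorem leibniz_word {u : U} (hu : IsWord S.q S.base S.C u) : S.Leibniz u := by
  induction hu with
  | of_base hu => exact leibniz_base hu
  | step hu hc ih => exact ih.step (S.word_deg hu) hc

end SkewFilt

namespace FiltData

variable {U : Type} [Ring U] [Algebra ℂ U] {S : FiltData U}

theorem isInt_of_x [DecidableEq S.ι] {g : U →ₗ[ℂ] ℂ} (hJ : ∀ j ∈ S.J, g j = 0) (h1 : g 1 = 0)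
    {γ : S.ι} (hx : ∀ γ', g (S.x γ') = if γ = γ' then 1 else 0) : S.IsInt g := by
  have hL1 : ∀ y ∈ S.L 1, ∃ a ∈ S.A, ∃ j ∈ S.J, y = a • 1 + j := by
    set P : Submodule S.A U := Submodule.span S.A {1} ⊔ S.J.restrictScalars S.A with hP
    have : S.L 1 ≤ P := S.L_succ_le
      (Submodule.mem_sup_left (Submodule.mem_span_singleton_self 1))
      (fun y hy => Submodule.mem_sup_right hy)
      fun y hy γ => Submodule.mem_sup_right (S.mul_mem y hy _)
    intro y hy
    obtain ⟨a, ha, j, hj, rfl⟩ := Submodule.mem_sup.1 (this hy)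
    obtain ⟨t, rfl⟩ := Submodule.mem_span_singleton.1 ha
    exact ⟨t, t.2, j, hj, rfl⟩
  set P : Submodule S.A U :=
    (Submodule.span S.A {(1 : ℂ)}).comap (g.restrictScalars S.A) with hP
  have hmem : ∀ z : ℂ, z ∈ Submodule.span S.A {(1 : ℂ)} ↔ z ∈ S.A := by
    intro z
    rw [Submodule.mem_span_singleton]
    constructor
    · rintro ⟨a, rfl⟩
      have : a • (1 : ℂ) = a := mul_one _
      rw [this]
      exact a.2
    · exact fun hz => ⟨⟨z, hz⟩, mul_one _⟩
  refine ⟨hJ, h1, fun y hy => ?_⟩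
  have : S.L 2 ≤ P := by
    refine S.L_succ_le ?_ ?_ ?_
    · exact (hmem _).2 (by
        change g 1 ∈ S.A
        rw [h1]; exact S.A.zero_mem)
    · intro y hy
      obtain ⟨a, ha, j, hj, rfl⟩ := hL1 y hy
      exact (hmem _).2 (by
        change g (a • 1 + j) ∈ S.A
        rw [map_add, map_smul, h1, hJ j hj, smul_zero, add_zero]; exact S.A.zero_mem)
    · intro y hy γ'
      obtain ⟨a, ha, j, hj, rfl⟩ := hL1 y hy
      refine (hmem _).2 ?_
      change g ((a • 1 + j) * S.x γ') ∈ S.A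
      rw [add_mul, map_add, hJ _ (S.mul_mem j hj _), smul_mul_assoc, one_mul, map_smul, hx,
        add_zero]
      split_ifs
      · rw [smul_eq_mul, mul_one]; exact ha
      · rw [smul_zero]; exact S.A.zero_mem
  exact (hmem _).1 (this hy)

theorem G_two : S.G 2 = Submodule.span ℂ {1} ⊔ Submodule.span ℂ (Set.range S.x) ⊔ S.J := by
  refine le_antisymm (Submodule.span_le.2 ?_) (sup_le (sup_le ?_ ?_) fun y hy => S.J_le_G 2 hy)
  · have hG1 : S.G 1 ≤ Submodule.span ℂ {1} ⊔ Submodule.span ℂ (Set.range S.x) ⊔ S.J := by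
      rw [G_one]; exact sup_le_sup_right le_sup_left _
    refine S.L_succ_le (P := (Submodule.span ℂ {1} ⊔ Submodule.span ℂ (Set.range S.x) ⊔
      S.J).restrictScalars S.A) (hG1 (S.one_mem_G 0)) (fun y hy => hG1 (S.L_le_G hy)) ?_
    intro y hy γ
    have hy' := S.L_le_G hy
    rw [G_one] at hy'
    obtain ⟨a, ha, j, hj, rfl⟩ := Submodule.mem_sup.1 hy'
    obtain ⟨t, rfl⟩ := Submodule.mem_span_singleton.1 ha
    rw [add_mul, smul_mul_assoc, one_mul]
    exact add_mem (Submodule.smul_mem _ _ (Submodule.mem_sup_left (Submodule.mem_sup_right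
      (Submodule.subset_span (Set.mem_range_self γ))))) (Submodule.mem_sup_right (S.mul_mem j hj _))
  · rw [Submodule.span_singleton_le_iff_mem]
    exact S.one_mem_G 1
  · rw [Submodule.span_le]
    rintro _ ⟨γ, rfl⟩
    have h := S.L_le_G (S.mul_x_mem_L (S.one_mem_L 0) γ)
    rwa [one_mul] at h

end FiltData

namespace SkewFilt

open FiltData

variable {U : Type} [Ring U] [Bialgebra ℂ U] {S : SkewFilt U}

/-- The Euler operator `∑ γ, (der (f γ) y) x γ`. -/
def euler [Fintype S.ι] (f : S.ι → U →ₗ[ℂ] ℂ) : U →ₗ[ℂ] U :=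
  ∑ γ, LinearMap.mulRight ℂ (S.x γ) ∘ₗ der (f γ)

theorem euler_apply [Fintype S.ι] (f : S.ι → U →ₗ[ℂ] ℂ) (y : U) :
    euler f y = ∑ γ, der (f γ) y * S.x γ := by
  simp [euler]

theorem euler_sub_smul_mem [Fintype S.ι] [DecidableEq S.ι] {f : S.ι → U →ₗ[ℂ] ℂ}
    (hf : ∀ γ, S.IsInt (f γ)) (hx : ∀ γ γ', f γ (S.x γ') = if γ = γ' then 1 else 0)
    (hcomm : ∀ γ γ', S.x γ * S.x γ' - S.x γ' * S.x γ ∈ S.Neg 2) (n : ℕ) :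
    ∀ y ∈ S.L (n + 1), euler f y - (n : ℂ) • y ∈ S.B (n + 1) := by
  have hJ : ∀ y ∈ S.J, euler f y ∈ S.J := fun y hy => by
    rw [euler_apply]
    exact sum_mem fun γ _ => S.mul_mem _ (S.der_J _ (hf γ).J y hy) _
  have h1 : euler f 1 = 0 := by
    rw [euler_apply]
    exact Finset.sum_eq_zero fun γ _ => by rw [der_one, (hf γ).one, zero_smul, zero_mul]
  induction n with
  | zero =>
    set P : Submodule S.A U := (S.J.restrictScalars S.A).comap ((euler f).restrictScalars S.A)
    have : S.L 1 ≤ P := S.L_succ_le (by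
        change euler f 1 ∈ S.J
        rw [h1]; exact zero_mem _) (fun y hy => hJ y hy)
      fun y hy γ => hJ _ (S.mul_mem _ hy _)
    intro y hy
    rw [Nat.cast_zero, zero_smul, sub_zero]
    exact S.J_le_B _ (this hy)
  | succ n ih =>
    set P : Submodule S.A U := (S.B (n + 2)).comap
      ((euler f - ((n + 1 : ℕ) : ℂ) • LinearMap.id).restrictScalars S.A) with hP
    have hP' : ∀ y, euler f y - ((n + 1 : ℕ) : ℂ) • y ∈ S.B (n + 2) → y ∈ P := fun y hy => hy
    have : S.L (n + 2) ≤ P := by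
      refine S.L_succ_le (hP' _ ?_) (fun y hy => hP' _ ?_) (fun y hy γ => hP' _ ?_)
      · rw [h1]
        exact sub_mem (zero_mem _) (S.G_le_B ((S.G _).smul_mem _ (S.one_mem_G _)))
      · have h2 := S.B_mono (Nat.le_succ (n + 1)) (ih y hy)
        have h3 : y ∈ S.B (n + 2) := S.G_le_B (S.L_le_G hy)
        have h4 : (1 : ℂ) • y ∈ S.B (n + 2) := by rwa [one_smul]
        have h5 := sub_mem h2 h4
        rwa [sub_sub, ← add_smul, ← Nat.cast_succ] at h5
      · have h2 : ∀ γ', (der (f γ') (y * S.x γ) - der (f γ') y * S.x γ -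
            (f γ' (S.x γ)) • y) * S.x γ' ∈ S.B (n + 2) := fun γ' =>
          Deg.B (Deg.x γ') (leibniz_word (S.isWord γ) _ (hf γ') _ y hy)
        have h3 : ∀ γ', der (f γ') y * (S.x γ * S.x γ' - S.x γ' * S.x γ) ∈ S.B (n + 2) :=
          fun γ' => Neg.M (hcomm γ γ') (sub_mem (Deg.mul (Deg.x γ) (Deg.x γ'))
            (Deg.mul (Deg.x γ') (Deg.x γ))) (isInt_der_mem (hf γ') y hy)
        have h4 : (euler f y - (n : ℂ) • y) * S.x γ ∈ S.B (n + 2) := Deg.B (Deg.x γ) (ih y hy)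
        have h5 := add_mem (add_mem (sum_mem fun γ' (_ : γ' ∈ Finset.univ) => h2 γ')
          (sum_mem fun γ' (_ : γ' ∈ Finset.univ) => h3 γ')) h4
        convert h5 using 1
        rw [euler_apply, euler_apply, sub_mul, Finset.sum_mul]
        have h6 : ∑ γ', f γ' (S.x γ) • (y * S.x γ') = y * S.x γ := by
          rw [Finset.sum_eq_single γ]
          · rw [hx, if_pos rfl, one_smul]
          · intro b _ hb
            rw [hx, if_neg hb, zero_smul]
          · exact fun h => absurd (Finset.mem_univ _) h
        simp only [sub_mul, mul_sub, Finset.sum_sub_distrib, ← mul_assoc, Nat.cast_succ,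
          add_smul, one_smul, smul_mul_assoc]
        rw [h6]
        abel
    exact fun y hy => this hy

/-- An element of bounded degree whose image under the Euler operator is linear, is linear. -/
theorem mem_G_two_of_euler [Fintype S.ι] [DecidableEq S.ι] {f : S.ι → U →ₗ[ℂ] ℂ}
    (hjac : Ideal.span {S.h} ≤ (⊥ : Ideal S.A).jacobson)
    (hinv : ∀ m : ℕ, (((m + 1 : ℕ) : ℂ))⁻¹ ∈ S.A)
    (hf : ∀ γ, S.IsInt (f γ)) (hx : ∀ γ γ', f γ (S.x γ') = if γ = γ' then 1 else 0)
    (hcomm : ∀ γ γ', S.x γ * S.x γ' - S.x γ' * S.x γ ∈ S.Neg 2) {x : U}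
    (hTx : euler f x ∈ S.G 2) (n : ℕ) : x ∈ S.G (n + 2) → x ∈ S.G 2 := by
  induction n with
  | zero => exact id
  | succ n ih =>
    refine fun hn => ih (S.mem_G_of_euler hjac _ (euler_sub_smul_mem hf hx hcomm)
      (hinv _) hn (S.G_mono (by omega) hTx))

end SkewFilt

section Relations

variable {q : ℝ} {N : ℕ} {V : Type} [Ring V] [Algebra ℂ V] {e f kg ki : ℕ → V}

/-- Commuting past an inverse. -/
theorem inv_mul_eq_smul_of_mul_eq_smul {k k' u : V} (h1 : k * k' = 1) (h2 : k' * k = 1) {s : ℂ}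
    (hs : s ≠ 0) (h : k * u = s • (u * k)) : k' * u = s⁻¹ • (u * k') := by
  have h3 : k' * (k * u) * k' = k' * (s • (u * k)) * k' := by rw [h]
  have h4 : u * k' = s • (k' * u) := by
    rw [← mul_assoc, h2, one_mul] at h3
    rw [h3, mul_smul_comm, smul_mul_assoc, ← mul_assoc, mul_assoc (k' * u), h1, mul_one]
  rw [h4, smul_smul, inv_mul_cancel₀ hs, one_smul]

theorem UqslRels.serreRels_e (h : UqslRels q N e f kg ki) : SerreRels (q : ℂ) N e where
  serre i hi j hj hij := h.2.2.2.2.2.1 i hi j hj hij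
  commute i hi j hj hij := h.2.2.2.2.2.2.1 i hi j hj hij

theorem UqslRels.swap (hq : (q : ℂ) ≠ 0) (h : UqslRels q N e f kg ki) :
    UqslRels q N f e ki kg := by
  obtain ⟨h1, h2, h3, h4, h5, h6, h7, h8, h9⟩ := h
  refine ⟨fun i hi => (h1 i hi).symm, fun i hi j hj => ?_, fun i hi j hj => ?_,
    fun i hi j hj => ?_, fun i hi j hj => ?_, h8, h9, h6, h7⟩
  · have h10 := inv_mul_eq_smul_of_mul_eq_smul (s := 1) (u := kg i) (h1 j hj).1 (h1 j hj).2 one_ne_zero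
      (by rw [one_smul]; exact h2 j hj i hi)
    have h11 := inv_mul_eq_smul_of_mul_eq_smul (s := 1) (h1 i hi).1 (h1 i hi).2 one_ne_zero
      (u := ki j) (by rw [h10, inv_one, smul_smul, one_mul, one_smul])
    rw [h11, inv_one, one_smul]
  · have h10 := inv_mul_eq_smul_of_mul_eq_smul (h1 i hi).1 (h1 i hi).2 (zpow_ne_zero _ hq)
      (h4 i hi j hj)
    rw [h10, ← zpow_neg, neg_neg]
  · have h10 := inv_mul_eq_smul_of_mul_eq_smul (h1 i hi).1 (h1 i hi).2 (zpow_ne_zero _ hq)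
      (h3 i hi j hj)
    rw [h10, ← zpow_neg]
  · rw [← neg_sub, h5 j hj i hi]
    split_ifs with h10 h11 h11
    · rw [← smul_neg, neg_sub, h10]
    · exact absurd h10.symm h11
    · exact absurd h11.symm h10
    · rw [neg_zero]

theorem UqslRels.exists_weight (hq : (q : ℂ) ≠ 0) (h : UqslRels q N e f kg ki) {r a b k : ℕ}
    (hr1 : 1 ≤ r) (hr2 : r ≤ N - 1) (ha : a < r) (hb : b < N - r) (hk : k ∈ Finset.Icc 1 (N - 1)) :
    ∃ c : ℤ, rootVec (q : ℂ) e r a b * kg k = (q : ℂ) ^ c • (kg k * rootVec (q : ℂ) e r a b) ∧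
      rootVec (q : ℂ) e r a b * ki k = (q : ℂ) ^ (-c) • (ki k * rootVec (q : ℂ) e r a b) := by
  have hgen : ∀ j ∈ Finset.Icc 1 (N - 1), ∃ c : ℤ, e j * kg k = (q : ℂ) ^ c • (kg k * e j) := by
    intro j hj
    refine ⟨-cartanSL k j, ?_⟩
    rw [h.2.2.1 k hk j hj, smul_smul, ← zpow_add₀ hq, neg_add_cancel, zpow_zero, one_smul]
  have h1 : ∃ c : ℤ, rootVec (q : ℂ) e r a b * kg k =
      (q : ℂ) ^ c • (kg k * rootVec (q : ℂ) e r a b) := by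
    refine rootVec_induction (P := fun x => ∃ c : ℤ, x * kg k = (q : ℂ) ^ c • (kg k * x))
      (hgen r (by simp; omega)) ?_ ha hb
    rintro a - b - j hj - ⟨c, hc⟩
    set x := rootVec (q : ℂ) e r a b
    obtain ⟨d, hd⟩ := hgen j hj
    refine ⟨c + d, ?_⟩
    have h2 : x * e j * kg k = (q : ℂ) ^ (c + d) • (kg k * (x * e j)) := by
      rw [mul_assoc, hd, mul_smul_comm, ← mul_assoc, hc, smul_mul_assoc, smul_smul, mul_assoc,
        zpow_add₀ hq, mul_comm]
    have h3 : e j * x * kg k = (q : ℂ) ^ (c + d) • (kg k * (e j * x)) := by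
      rw [mul_assoc, hc, mul_smul_comm, ← mul_assoc, hd, smul_mul_assoc, smul_smul, mul_assoc,
        zpow_add₀ hq]
    rw [qComm, sub_mul, smul_mul_assoc, h2, h3, mul_sub, mul_smul_comm, smul_sub, smul_comm]
  obtain ⟨c, hc⟩ := h1
  refine ⟨c, hc, ?_⟩
  have h2 : kg k * rootVec (q : ℂ) e r a b = (q : ℂ) ^ (-c) • (rootVec (q : ℂ) e r a b * kg k) := by
    rw [hc, smul_smul, ← zpow_add₀ hq, neg_add_cancel, zpow_zero, one_smul]
  have h3 := inv_mul_eq_smul_of_mul_eq_smul (h.1 k hk).1 (h.1 k hk).2 (zpow_ne_zero _ hq) h2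
  rw [h3, smul_smul, zpow_neg, inv_inv, inv_mul_cancel₀ (zpow_ne_zero _ hq), one_smul]

/-- Commuting `[e k, f k]` past a root vector. -/
theorem UqslRels.exists_rootVec_mul_bracket (hq : (q : ℂ) ≠ 0) (h : UqslRels q N e f kg ki)
    {r a b k : ℕ} (hr1 : 1 ≤ r) (hr2 : r ≤ N - 1) (ha : a < r) (hb : b < N - r)
    (hk : k ∈ Finset.Icc 1 (N - 1)) : ∃ c : ℤ,
      rootVec (q : ℂ) e r a b * (e k * f k - f k * e k) =
        (q : ℂ) ^ c • ((e k * f k - f k * e k) * rootVec (q : ℂ) e r a b) +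
        (((q : ℂ) - (q : ℂ)⁻¹)⁻¹ * ((q : ℂ) ^ c - (q : ℂ) ^ (-c))) •
          (ki k * rootVec (q : ℂ) e r a b) := by
  obtain ⟨c, hc1, hc2⟩ := h.exists_weight hq hr1 hr2 ha hb hk
  refine ⟨c, ?_⟩
  rw [h.2.2.2.2.1 k hk k hk, if_pos rfl, mul_smul_comm, mul_sub, hc1, hc2, smul_mul_assoc, sub_mul]
  module

end Relations

/-- Hypotheses ensuring that the filtration attached to the root vectors built from `e` and `f`
is stable under the generators other than `e r` and `f r`. -/
structure QFilt {U : Type} [Ring U] [Algebra ℂ U] (q : ℝ) (N r : ℕ) (S : FiltData U)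
    (e f kg ki : ℕ → U) : Prop where
  r_pos : 1 ≤ r
  r_le : r ≤ N - 1
  ne_zero : (q : ℂ) ≠ 0
  add_inv_ne_zero : (q : ℂ) + (q : ℂ)⁻¹ ≠ 0
  h_eq : (S.h : ℂ) = q - 1
  zpow_mem : ∀ c : ℤ, (q : ℂ) ^ c ∈ S.A
  zpow_sub_one : ∀ c : ℤ, ∃ a ∈ S.A, (q : ℂ) ^ c - 1 = (q - 1) * a
  quantum_int_mem : ∀ c : ℤ, ((q : ℂ) - (q : ℂ)⁻¹)⁻¹ * ((q : ℂ) ^ c - (q : ℂ) ^ (-c)) ∈ S.A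
  half_mem : (2 : ℂ)⁻¹ ∈ S.A
  rels : UqslRels q N e f kg ki
  e_mem : ∀ k ∈ Finset.Icc 1 (N - 1), k ≠ r → e k ∈ S.J
  f_mem : ∀ k ∈ Finset.Icc 1 (N - 1), k ≠ r → f k ∈ S.J
  kg_mem : ∀ k ∈ Finset.Icc 1 (N - 1), kg k - 1 ∈ S.J
  ki_mem : ∀ k ∈ Finset.Icc 1 (N - 1), ki k - 1 ∈ S.J
  exists_x_e : ∀ a < r, ∀ b < N - r, ∃ γ, S.x γ = rootVec (q : ℂ) e r a b
  exists_x_f : ∀ a < r, ∀ b < N - r, ∃ γ, S.x γ = rootVec (q : ℂ) f r a b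
  x_eq : ∀ γ, ∃ a < r, ∃ b < N - r,
    S.x γ = rootVec (q : ℂ) e r a b ∨ S.x γ = rootVec (q : ℂ) f r a b

namespace QFilt

section Generators

variable {U : Type} {N r : ℕ} {e f kg ki : ℕ → U}

variable (N r e f kg ki) in
/-- The generators of the coideal subalgebra. -/
def kGen : Set U := {c | ∃ k ∈ Finset.Icc 1 (N - 1), k ≠ r ∧ (c = e k ∨ c = f k)} ∪
  {c | ∃ k ∈ Finset.Icc 1 (N - 1), c = kg k ∨ c = ki k}

theorem kGen_swap : kGen N r f e ki kg = kGen N r e f kg ki := by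
  ext c
  simp only [kGen, Set.mem_union, Set.mem_ofPred_eq, or_comm]

theorem e_mem_kGen {k : ℕ} (hk : k ∈ Finset.Icc 1 (N - 1)) (hkr : k ≠ r) :
    e k ∈ kGen N r e f kg ki := Or.inl ⟨k, hk, hkr, Or.inl rfl⟩

theorem f_mem_kGen {k : ℕ} (hk : k ∈ Finset.Icc 1 (N - 1)) (hkr : k ≠ r) :
    f k ∈ kGen N r e f kg ki := Or.inl ⟨k, hk, hkr, Or.inr rfl⟩

theorem kg_mem_kGen {k : ℕ} (hk : k ∈ Finset.Icc 1 (N - 1)) :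
    kg k ∈ kGen N r e f kg ki := Or.inr ⟨k, hk, Or.inl rfl⟩

theorem ki_mem_kGen {k : ℕ} (hk : k ∈ Finset.Icc 1 (N - 1)) :
    ki k ∈ kGen N r e f kg ki := Or.inr ⟨k, hk, Or.inr rfl⟩

end Generators

open FiltData

variable {U : Type} [Ring U] [Algebra ℂ U] {q : ℝ} {N r : ℕ} {S : FiltData U}
  {e f kg ki : ℕ → U}

theorem swap (H : QFilt q N r S e f kg ki) : QFilt q N r S f e ki kg :=
  { H with
    rels := H.rels.swap H.ne_zero
    e_mem := H.f_mem
    f_mem := H.e_mem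
    kg_mem := H.ki_mem
    ki_mem := H.kg_mem
    exists_x_e := H.exists_x_f
    exists_x_f := H.exists_x_e
    x_eq := fun γ => by
      obtain ⟨a, ha, b, hb, h⟩ := H.x_eq γ
      exact ⟨a, ha, b, hb, h.symm⟩ }

variable (S) in
/-- The span of the products `t * x` with `t` a product of elements of `T` and `x ∈ X`. -/
def leftSpan (T X : Set U) : Submodule S.A U :=
  Submodule.span S.A {u | ∃ t ∈ Submonoid.closure T, ∃ x ∈ X, u = t * x}

theorem mul_mem_leftSpan {T X : Set U} {t u : U} (ht : t ∈ T) (hu : u ∈ leftSpan S T X) :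
    t * u ∈ leftSpan S T X := by
  have : leftSpan S T X ≤ (leftSpan S T X).comap (LinearMap.mulLeft S.A t) := by
    refine Submodule.span_le.2 ?_
    rintro _ ⟨s, hs, x, hx, rfl⟩
    exact Submodule.subset_span ⟨t * s, mul_mem (Submonoid.subset_closure ht) hs, x, hx,
      (mul_assoc _ _ _).symm⟩
  exact this hu

theorem mem_leftSpan {T X : Set U} {x : U} (hx : x ∈ X) : x ∈ leftSpan S T X :=
  Submodule.subset_span ⟨1, one_mem _, x, hx, (one_mul _).symm⟩

theorem leftSpan_mul_mem {T X : Set U} {c : U} (h : ∀ x ∈ X, x * c ∈ leftSpan S T X) {u : U}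
    (hu : u ∈ leftSpan S T X) : u * c ∈ leftSpan S T X := by
  have : leftSpan S T X ≤ (leftSpan S T X).comap (LinearMap.mulRight S.A c) := by
    refine Submodule.span_le.2 ?_
    rintro _ ⟨s, hs, x, hx, rfl⟩
    change s * x * c ∈ leftSpan S T X
    rw [mul_assoc]
    induction hs using Submonoid.closure_induction_left with
    | one => rw [one_mul]; exact h x hx
    | mul_left t ht s _ ih => rw [mul_assoc]; exact mul_mem_leftSpan ht ih
  exact this hu

theorem leftSpan_mono {T X Y : Set U} (h : X ⊆ Y) : leftSpan S T X ≤ leftSpan S T Y :=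
  Submodule.span_mono fun _ ⟨t, ht, x, hx, hu⟩ => ⟨t, ht, x, h hx, hu⟩

variable (q N r) in
/-- The root vectors built from `e`. -/
def rootVecs (e : ℕ → U) : Set U := {x | ∃ a < r, ∃ b < N - r, x = rootVec (q : ℂ) e r a b}

theorem rootVec_mem_rootVecs {a b : ℕ} (ha : a < r) (hb : b < N - r) :
    rootVec (q : ℂ) e r a b ∈ rootVecs q N r e := ⟨a, ha, b, hb, rfl⟩

theorem exists_inv_eq_zpow {q : ℝ} {s : ℂ} (hs : s = 1 ∨ s = q ∨ s = (q : ℂ)⁻¹) :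
    ∃ c : ℤ, s⁻¹ = (q : ℂ) ^ c := by
  rcases hs with rfl | rfl | rfl
  exacts [⟨0, by simp⟩, ⟨-1, by simp⟩, ⟨1, by simp⟩]

/-- Moving a generator of the same type past a root vector. -/
theorem rootVec_mul_e (H : QFilt q N r S e f kg ki) {a b k : ℕ} (ha : a < r) (hb : b < N - r)
    (hk : k ∈ Finset.Icc 1 (N - 1)) (hkr : k ≠ r) : ∃ c : ℤ,
      rootVec (q : ℂ) e r a b * e k = (q : ℂ) ^ c • (e k * rootVec (q : ℂ) e r a b) ∨
      ∃ a' < r, ∃ b' < N - r, rootVec (q : ℂ) e r a b * e k =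
        (q : ℂ) ^ c • (e k * rootVec (q : ℂ) e r a b) + rootVec (q : ℂ) e r a' b' := by
  obtain ⟨s, hs, h⟩ := H.rels.serreRels_e.exists_qComm_rootVec H.ne_zero H.add_inv_ne_zero H.r_pos
    ha hb hk hkr
  obtain ⟨c, hc⟩ := exists_inv_eq_zpow hs
  simp only [qComm, hc] at h
  refine ⟨c, h.imp (fun h => sub_eq_zero.1 h) ?_⟩
  rintro ⟨a', ha', b', hb', h⟩
  exact ⟨a', ha', b', hb', by rw [← h, add_sub_cancel]⟩

theorem mul_e_mem (H : QFilt q N r S e f kg ki) {x : U} (hx : x ∈ rootVecs q N r e) {k : ℕ}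
    (hk : k ∈ Finset.Icc 1 (N - 1)) (hkr : k ≠ r) :
    x * e k ∈ leftSpan S (kGen N r e f kg ki) (rootVecs q N r e) := by
  have h1 := mul_mem_leftSpan (e_mem_kGen (e := e) (f := f) (kg := kg) (ki := ki) hk hkr)
    (mem_leftSpan (S := S) (T := kGen N r e f kg ki) hx)
  obtain ⟨a, ha, b, hb, rfl⟩ := hx
  obtain ⟨c, h | ⟨a', ha', b', hb', h⟩⟩ := H.rootVec_mul_e ha hb hk hkr
  · rw [h]
    exact S.smul_mem' _ (H.zpow_mem c) h1
  · rw [h]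
    exact add_mem (S.smul_mem' _ (H.zpow_mem c) h1)
      (mem_leftSpan (rootVec_mem_rootVecs ha' hb'))

theorem mul_k_mem (H : QFilt q N r S e f kg ki) {x : U} (hx : x ∈ rootVecs q N r e) {k : ℕ}
    (hk : k ∈ Finset.Icc 1 (N - 1)) :
    x * kg k ∈ leftSpan S (kGen N r e f kg ki) (rootVecs q N r e) ∧
    x * ki k ∈ leftSpan S (kGen N r e f kg ki) (rootVecs q N r e) := by
  have h1 := mem_leftSpan (S := S) (T := kGen N r e f kg ki) hx
  obtain ⟨a, ha, b, hb, rfl⟩ := hx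
  obtain ⟨c, h2, h3⟩ := H.rels.exists_weight H.ne_zero H.r_pos H.r_le ha hb hk
  rw [h2, h3]
  exact ⟨S.smul_mem' _ (H.zpow_mem _) (mul_mem_leftSpan (kg_mem_kGen hk) h1),
    S.smul_mem' _ (H.zpow_mem _) (mul_mem_leftSpan (ki_mem_kGen hk) h1)⟩

theorem mul_bracket_mem (H : QFilt q N r S e f kg ki) {x : U} (hx : x ∈ rootVecs q N r e) {j k : ℕ}
    (hj : j ∈ Finset.Icc 1 (N - 1)) (hjr : j ≠ r) (hk : k ∈ Finset.Icc 1 (N - 1)) :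
    x * (e j * f k - f k * e j) ∈ leftSpan S (kGen N r e f kg ki) (rootVecs q N r e) := by
  rcases eq_or_ne j k with rfl | hjk
  · have h1 := mem_leftSpan (S := S) (T := kGen N r e f kg ki) hx
    obtain ⟨a, ha, b, hb, rfl⟩ := hx
    obtain ⟨c, h⟩ := H.rels.exists_rootVec_mul_bracket H.ne_zero H.r_pos H.r_le ha hb hj
    rw [h, sub_mul, mul_assoc, mul_assoc]
    exact add_mem (S.smul_mem' _ (H.zpow_mem _) (sub_mem
      (mul_mem_leftSpan (e_mem_kGen hj hjr) (mul_mem_leftSpan (f_mem_kGen hj hjr) h1))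
      (mul_mem_leftSpan (f_mem_kGen hj hjr) (mul_mem_leftSpan (e_mem_kGen hj hjr) h1))))
      (S.smul_mem' _ (H.quantum_int_mem _) (mul_mem_leftSpan (ki_mem_kGen hj) h1))
  · rw [H.rels.2.2.2.2.1 j hj k hk, if_neg hjk, mul_zero]
    exact zero_mem _

theorem mul_f_mem (H : QFilt q N r S e f kg ki) {x : U} (hx : x ∈ rootVecs q N r e) {k : ℕ}
    (hk : k ∈ Finset.Icc 1 (N - 1)) (hkr : k ≠ r) :
    x * f k ∈ leftSpan S (kGen N r e f kg ki) (rootVecs q N r e) := by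
  have hr : r ∈ Finset.Icc 1 (N - 1) := Finset.mem_Icc.2 ⟨H.r_pos, H.r_le⟩
  have hqi : (q : ℂ)⁻¹ ∈ S.A := by simpa using H.zpow_mem (-1)
  obtain ⟨a, ha, b, hb, rfl⟩ := hx
  refine rootVec_induction (P := fun x => x * f k ∈
    leftSpan S (kGen N r e f kg ki) (rootVecs q N r e)) ?_ ?_ ha hb
  · have h1 : e r * f k - f k * e r = 0 := by
      rw [H.rels.2.2.2.2.1 r hr k hk, if_neg hkr.symm]
    rw [sub_eq_zero.1 h1]
    exact mul_mem_leftSpan (f_mem_kGen hk hkr) (mem_leftSpan ⟨0, H.r_pos, 0, by omega, rfl⟩)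
  · intro a ha b hb j hj hjr ih
    have h1 : qComm (q : ℂ) (rootVec (q : ℂ) e r a b) (e j) * f k =
        rootVec (q : ℂ) e r a b * f k * e j +
          rootVec (q : ℂ) e r a b * (e j * f k - f k * e j) -
          (q : ℂ)⁻¹ • (e j * (rootVec (q : ℂ) e r a b * f k)) := by
      rw [qComm, sub_mul, smul_mul_assoc, mul_sub]
      simp only [mul_assoc]
      abel
    rw [h1]
    exact sub_mem (add_mem (leftSpan_mul_mem (fun x hx => H.mul_e_mem hx hj hjr) ih)
      (H.mul_bracket_mem (rootVec_mem_rootVecs ha hb) hj hjr hk))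
      (S.smul_mem' _ hqi (mul_mem_leftSpan (e_mem_kGen hj hjr) ih))

theorem mul_kGen_mem (H : QFilt q N r S e f kg ki) {x c : U} (hx : x ∈ rootVecs q N r e)
    (hc : c ∈ kGen N r e f kg ki) :
    x * c ∈ leftSpan S (kGen N r e f kg ki) (rootVecs q N r e) := by
  obtain ⟨k, hk, hkr, rfl | rfl⟩ | ⟨k, hk, rfl | rfl⟩ := hc
  exacts [H.mul_e_mem hx hk hkr, H.mul_f_mem hx hk hkr, (H.mul_k_mem hx hk).1,
    (H.mul_k_mem hx hk).2]

theorem rootVecs_subset_range (H : QFilt q N r S e f kg ki) :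
    rootVecs q N r e ⊆ Set.range S.x := by
  rintro _ ⟨a, ha, b, hb, rfl⟩
  exact H.exists_x_e a ha b hb

theorem x_mul_kGen_mem (H : QFilt q N r S e f kg ki) (γ : S.ι) {c : U}
    (hc : c ∈ kGen N r e f kg ki) :
    S.x γ * c ∈ leftSpan S (kGen N r e f kg ki) (Set.range S.x) := by
  obtain ⟨a, ha, b, hb, h | h⟩ := H.x_eq γ
  · exact leftSpan_mono H.rootVecs_subset_range (H.mul_kGen_mem ⟨a, ha, b, hb, h⟩ hc)
  · have h1 := leftSpan_mono H.swap.rootVecs_subset_range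
      (H.swap.mul_kGen_mem ⟨a, ha, b, hb, h⟩ (c := c) (by rwa [kGen_swap]))
    rwa [kGen_swap] at h1

theorem kGen_mem_deg (H : QFilt q N r S e f kg ki) {c : U} (hc : c ∈ kGen N r e f kg ki) :
    c ∈ S.Deg 0 := by
  intro n
  induction n generalizing c with
  | zero => exact fun y hy => S.mul_mem y hy c
  | succ n ih =>
    refine S.L_succ_le (P := (S.L (n + 1)).comap (LinearMap.mulRight S.A c)) ?_
      (fun y hy => S.L_le_succ n (ih hc y hy)) ?_
    · change 1 * c ∈ S.L (n + 1)
      rw [one_mul]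
      obtain ⟨k, hk, hkr, rfl | rfl⟩ | ⟨k, hk, rfl | rfl⟩ := hc
      · exact S.J_le_L _ (H.e_mem k hk hkr)
      · exact S.J_le_L _ (H.f_mem k hk hkr)
      · rw [← sub_add_cancel (kg k) 1]
        exact add_mem (S.J_le_L _ (H.kg_mem k hk)) (S.one_mem_L n)
      · rw [← sub_add_cancel (ki k) 1]
        exact add_mem (S.J_le_L _ (H.ki_mem k hk)) (S.one_mem_L n)
    · intro y hy γ
      change y * S.x γ * c ∈ S.L (n + 1)
      rw [mul_assoc]
      have h1 : leftSpan S (kGen N r e f kg ki) (Set.range S.x) ≤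
          (S.L (n + 1)).comap (LinearMap.mulLeft S.A y) := by
        refine Submodule.span_le.2 ?_
        rintro _ ⟨t, ht, _, ⟨γ', rfl⟩, rfl⟩
        change y * (t * S.x γ') ∈ S.L (n + 1)
        rw [← mul_assoc]
        refine S.mul_x_mem_L ?_ γ'
        induction ht using Submonoid.closure_induction_right with
        | one => rwa [mul_one]
        | mul_right s hs t ht ih' => rw [← mul_assoc]; exact ih ht _ ih'
      exact h1 (H.x_mul_kGen_mem γ hc)

theorem kg_sub_one_mem_neg (H : QFilt q N r S e f kg ki) {k : ℕ} (hk : k ∈ Finset.Icc 1 (N - 1)) :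
    kg k - 1 ∈ S.Neg 0 := by
  have hdeg := H.kGen_mem_deg (kg_mem_kGen (r := r) (e := e) (f := f) (ki := ki) hk)
  have hweight : ∀ γ, ∃ c : ℤ, S.x γ * kg k = (q : ℂ) ^ c • (kg k * S.x γ) := by
    intro γ
    obtain ⟨a, ha, b, hb, h | h⟩ := H.x_eq γ
    · obtain ⟨c, hc, -⟩ := H.rels.exists_weight H.ne_zero H.r_pos H.r_le ha hb hk
      exact ⟨c, by rw [h, hc]⟩
    · obtain ⟨c, -, hc⟩ := H.swap.rels.exists_weight H.ne_zero H.r_pos H.r_le ha hb hk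
      exact ⟨-c, by rw [h, hc]⟩
  intro n
  induction n with
  | zero => exact fun y hy => S.J_le_B _ (S.mul_mem y hy _)
  | succ n ih =>
    refine S.L_succ_le (P := (S.B (n + 1)).comap (LinearMap.mulRight S.A (kg k - 1))) ?_
      (fun y hy => S.B_mono (Nat.le_succ n) (ih y hy)) ?_
    · change 1 * (kg k - 1) ∈ S.B (n + 1)
      rw [one_mul]
      exact S.J_le_B _ (H.kg_mem k hk)
    · intro y hy γ
      change y * S.x γ * (kg k - 1) ∈ S.B (n + 1)
      obtain ⟨c, hc⟩ := hweight γ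
      obtain ⟨a, ha, hca⟩ := H.zpow_sub_one c
      have h1 : y * S.x γ * (kg k - 1) =
          (S.h : ℂ) • (a • (y * kg k * S.x γ)) + y * (kg k - 1) * S.x γ := by
        have h2 : (q : ℂ) ^ c = 1 + (S.h : ℂ) * a := by rw [H.h_eq, ← hca]; ring
        rw [mul_sub, mul_assoc, hc, h2, mul_sub, sub_mul, mul_smul_comm, ← mul_assoc, mul_one,
          mul_one, smul_smul]
        module
      rw [h1]
      exact add_mem (S.h_smul_mem_B (S.smul_mem' _ ha (S.mul_x_mem_L (hdeg n y hy) γ)))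
        (Deg.B (Deg.x γ) (ih y hy))

theorem ki_sub_one_mem_neg (H : QFilt q N r S e f kg ki) {k : ℕ} (hk : k ∈ Finset.Icc 1 (N - 1)) :
    ki k - 1 ∈ S.Neg 0 := H.swap.kg_sub_one_mem_neg hk

end QFilt

namespace QFilt

open FiltData

variable {U : Type} [Ring U] [Algebra ℂ U] {q : ℝ} {N r : ℕ} {S : FiltData U}
  {e f kg ki : ℕ → U}

/-- The commutator of a `q`-commutator. -/
theorem qComm_bracket (s : ℂ) (x c y : U) : qComm s x c * y - y * qComm s x c =
    qComm s (x * y - y * x) c + qComm s x (c * y - y * c) := by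
  simp only [qComm, sub_mul, mul_sub, smul_mul_assoc, mul_smul_comm, mul_assoc, smul_sub]
  abel

theorem qComm_zero_right (s : ℂ) (x : U) : qComm s x 0 = 0 := by simp [qComm]

theorem inv_mem (H : QFilt q N r S e f kg ki) : (q : ℂ)⁻¹ ∈ S.A := by
  simpa using H.zpow_mem (-1)

theorem qComm_neg_deg (H : QFilt q N r S e f kg ki) {k l m : ℕ} {u v : U} (hu : u ∈ S.Neg k)
    (hv : v ∈ S.Deg l) (h : k + l = m := by omega) : qComm (q : ℂ) u v ∈ S.Neg m :=
  sub_mem (Neg.mul_deg hu hv h)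
    (S.smul_mem' _ H.inv_mem (Deg.mul_neg hv hu (by omega)))

theorem qComm_deg_neg (H : QFilt q N r S e f kg ki) {k l m : ℕ} {u v : U} (hu : u ∈ S.Deg k)
    (hv : v ∈ S.Neg l) (h : k + l = m := by omega) : qComm (q : ℂ) u v ∈ S.Neg m :=
  sub_mem (Deg.mul_neg hu hv h)
    (S.smul_mem' _ H.inv_mem (Neg.mul_deg hv hu (by omega)))

theorem sub_smul_mem_neg (H : QFilt q N r S e f kg ki) (c : ℤ) {k : ℕ} {u : U}
    (hu : u ∈ S.Deg k) : ((q : ℂ) ^ c - 1) • u ∈ S.Neg k := by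
  obtain ⟨a, ha, h⟩ := H.zpow_sub_one c
  rw [h, ← H.h_eq, mul_smul]
  exact Deg.h_smul (S.smul_mem' _ ha hu)

theorem qComm_sub_bracket_mem (H : QFilt q N r S e f kg ki) {k l m : ℕ} {u v : U}
    (hu : u ∈ S.Deg k) (hv : v ∈ S.Deg l) (h : k + l = m := by omega) :
    qComm (q : ℂ) u v - (u * v - v * u) ∈ S.Neg m := by
  have h1 : qComm (q : ℂ) u v - (u * v - v * u) = -(((q : ℂ) ^ (-1 : ℤ) - 1) • (v * u)) := by
    rw [qComm, zpow_neg_one]; module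
  rw [h1]
  exact neg_mem (H.sub_smul_mem_neg _ (Deg.mul hv hu (by omega)))

theorem e_deg (H : QFilt q N r S e f kg ki) {k : ℕ} (hk : k ∈ Finset.Icc 1 (N - 1))
    (hkr : k ≠ r) : e k ∈ S.Deg 0 := H.kGen_mem_deg (e_mem_kGen hk hkr)

theorem f_deg (H : QFilt q N r S e f kg ki) {k : ℕ} (hk : k ∈ Finset.Icc 1 (N - 1))
    (hkr : k ≠ r) : f k ∈ S.Deg 0 := H.kGen_mem_deg (f_mem_kGen hk hkr)

theorem rootVecs_deg (H : QFilt q N r S e f kg ki) {x : U} (hx : x ∈ rootVecs q N r e) :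
    x ∈ S.Deg 1 := by
  obtain ⟨γ, rfl⟩ := H.rootVecs_subset_range hx
  exact Deg.x γ

variable (q N r S e) in
/-- Combinations of root vectors, up to negligible elements. -/
def almostRoot : Submodule S.A U := Submodule.span S.A (rootVecs q N r e) ⊔ S.Neg 1

theorem bracket_e_mem (H : QFilt q N r S e f kg ki) {x : U} (hx : x ∈ rootVecs q N r e) {k : ℕ}
    (hk : k ∈ Finset.Icc 1 (N - 1)) (hkr : k ≠ r) :
    x * e k - e k * x ∈ almostRoot q N r S e := by
  have h1 : e k * x ∈ S.Deg 1 := Deg.mul (H.e_deg hk hkr) (H.rootVecs_deg hx)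
  obtain ⟨a, ha, b, hb, rfl⟩ := hx
  obtain ⟨c, h⟩ := H.rootVec_mul_e ha hb hk hkr
  have h2 := H.sub_smul_mem_neg c h1
  rw [sub_smul, one_smul] at h2
  obtain h | ⟨a', ha', b', hb', h⟩ := h
  · rw [h]
    exact Submodule.mem_sup_right h2
  · rw [h, add_sub_right_comm]
    exact add_mem (Submodule.mem_sup_right h2)
      (Submodule.mem_sup_left (Submodule.subset_span ⟨a', ha', b', hb', rfl⟩))

theorem qComm_e_mem (H : QFilt q N r S e f kg ki) {u : U} (hu : u ∈ almostRoot q N r S e) {k : ℕ}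
    (hk : k ∈ Finset.Icc 1 (N - 1)) (hkr : k ≠ r) :
    qComm (q : ℂ) u (e k) ∈ almostRoot q N r S e := by
  obtain ⟨v, hv, w, hw, rfl⟩ := Submodule.mem_sup.1 hu
  have h1 : qComm (q : ℂ) (v + w) (e k) = qComm (q : ℂ) v (e k) + qComm (q : ℂ) w (e k) := by
    simp only [qComm, add_mul, mul_add, smul_add]; abel
  rw [h1]
  refine add_mem ?_ (Submodule.mem_sup_right (H.qComm_neg_deg hw (H.e_deg hk hkr)))
  have h2 : Submodule.span S.A (rootVecs q N r e) ≤ (almostRoot q N r S e).comap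
      (LinearMap.mulRight S.A (e k) -
        (⟨_, H.inv_mem⟩ : S.A) • LinearMap.mulLeft S.A (e k)) := by
    refine Submodule.span_le.2 fun x hx => ?_
    change qComm (q : ℂ) x (e k) ∈ almostRoot q N r S e
    have h3 := H.qComm_sub_bracket_mem (m := 1) (H.rootVecs_deg hx) (H.e_deg hk hkr)
    rw [← sub_add_cancel (qComm (q : ℂ) x (e k)) (x * e k - e k * x)]
    exact add_mem (Submodule.mem_sup_right h3) (H.bracket_e_mem hx hk hkr)
  exact h2 hv

theorem qComm_bracket_mem (H : QFilt q N r S e f kg ki) {x : U} (hx : x ∈ rootVecs q N r e)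
    {k : ℕ} (hk : k ∈ Finset.Icc 1 (N - 1)) (hkr : k ≠ r) :
    qComm (q : ℂ) x (e k * f k - f k * e k) ∈ almostRoot q N r S e := by
  have hd := H.rootVecs_deg hx
  have h1 : e k * f k - f k * e k ∈ S.Deg 0 :=
    sub_mem (Deg.mul (H.e_deg hk hkr) (H.f_deg hk hkr))
      (Deg.mul (H.f_deg hk hkr) (H.e_deg hk hkr))
  have h2 : (e k * f k - f k * e k) * x ∈ S.Deg 1 := Deg.mul h1 hd
  have h3 : (ki k - 1) * x ∈ S.Neg 1 := Neg.mul_deg (H.ki_sub_one_mem_neg hk) hd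
  have h4 : x ∈ almostRoot q N r S e := Submodule.mem_sup_left (Submodule.subset_span hx)
  obtain ⟨a, ha, b, hb, rfl⟩ := hx
  obtain ⟨c, h⟩ := H.rels.exists_rootVec_mul_bracket H.ne_zero H.r_pos H.r_le ha hb hk
  have h5 := sub_mem (H.sub_smul_mem_neg c h2) (H.sub_smul_mem_neg (-1) h2)
  have h6 : ki k * rootVec (q : ℂ) e r a b = (ki k - 1) * rootVec (q : ℂ) e r a b +
    rootVec (q : ℂ) e r a b := by rw [sub_mul, one_mul, sub_add_cancel]
  rw [qComm, h, h6]
  have h7 := add_mem (Submodule.mem_sup_right (S := Submodule.span S.A (rootVecs q N r e)) h5)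
    (S.smul_mem' _ (H.quantum_int_mem c) (add_mem (Submodule.mem_sup_right h3) h4))
  refine Set.mem_of_eq_of_mem ?_ h7
  rw [zpow_neg_one]
  module

theorem bracket_f_mem (H : QFilt q N r S e f kg ki) {x : U} (hx : x ∈ rootVecs q N r e) {k : ℕ}
    (hk : k ∈ Finset.Icc 1 (N - 1)) (hkr : k ≠ r) :
    x * f k - f k * x ∈ almostRoot q N r S e := by
  have hr : r ∈ Finset.Icc 1 (N - 1) := Finset.mem_Icc.2 ⟨H.r_pos, H.r_le⟩
  obtain ⟨a, ha, b, hb, rfl⟩ := hx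
  refine rootVec_induction (P := fun x => x * f k - f k * x ∈ almostRoot q N r S e) ?_ ?_ ha hb
  · rw [H.rels.2.2.2.2.1 r hr k hk, if_neg hkr.symm]
    exact zero_mem _
  · intro a ha b hb j hj hjr ih
    rw [qComm_bracket]
    refine add_mem (H.qComm_e_mem ih hj hjr) ?_
    rcases eq_or_ne j k with rfl | hjk
    · exact H.qComm_bracket_mem (rootVec_mem_rootVecs ha hb) hj hjr
    · rw [H.rels.2.2.2.2.1 j hj k hk, if_neg hjk, qComm_zero_right]
      exact zero_mem _

/-- The bracket of `e r` with a root vector built from `f` is negligible. -/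
theorem bracket_base_f_mem (H : QFilt q N r S e f kg ki) {x : U} (hx : x ∈ rootVecs q N r f) :
    x * e r - e r * x ∈ S.Neg 2 := by
  have hr : r ∈ Finset.Icc 1 (N - 1) := Finset.mem_Icc.2 ⟨H.r_pos, H.r_le⟩
  obtain ⟨a, ha, b, hb, rfl⟩ := hx
  refine rootVec_induction (P := fun x => x * e r - e r * x ∈ S.Neg 2) ?_ ?_ ha hb
  · rw [← neg_sub, H.rels.2.2.2.2.1 r hr r hr, if_pos rfl]
    refine neg_mem fun n y hy => S.G_le_B (S.G_mono (show n ≤ n + 2 - 1 by omega) ?_)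
    rw [mul_smul_comm, mul_sub]
    refine (S.G n).smul_mem _ (sub_mem ?_ ?_)
    · exact Deg.G (H.kGen_mem_deg (kg_mem_kGen hr)) (S.L_le_G hy)
    · exact Deg.G (H.kGen_mem_deg (ki_mem_kGen hr)) (S.L_le_G hy)
  · intro a ha b hb j hj hjr ih
    rw [qComm_bracket, ← neg_sub (e r * f j), H.rels.2.2.2.2.1 r hr j hj, if_neg hjr.symm, neg_zero,
      qComm_zero_right, add_zero]
    exact H.qComm_neg_deg ih (H.f_deg hj hjr)

theorem bracket_qComm_of_commute (H : QFilt q N r S e f kg ki) {x : U} {k : ℕ}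
    (hk : k ∈ Finset.Icc 1 (N - 1)) (hkr : 2 ≤ ((k : ℤ) - r).natAbs)
    (hx : x * e r - e r * x ∈ S.Neg 2) :
    qComm (q : ℂ) x (e k) * e r - e r * qComm (q : ℂ) x (e k) ∈ S.Neg 2 := by
  have hr : r ∈ Finset.Icc 1 (N - 1) := Finset.mem_Icc.2 ⟨H.r_pos, H.r_le⟩
  have h1 : e k * e r - e r * e k = 0 :=
    sub_eq_zero.2 (H.rels.serreRels_e.commute k hk r hr hkr)
  rw [qComm_bracket, h1, qComm_zero_right, add_zero]
  exact H.qComm_neg_deg hx (H.e_deg hk (by rintro rfl; simp at hkr))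

theorem bracket_qComm_of_serre (H : QFilt q N r S e f kg ki) {k : ℕ}
    (hk : k ∈ Finset.Icc 1 (N - 1)) (hkr : ((r : ℤ) - k).natAbs = 1) (hd : e r ∈ S.Deg 1) :
    qComm (q : ℂ) (e r) (e k) * e r - e r * qComm (q : ℂ) (e r) (e k) ∈ S.Neg 2 := by
  have hr : r ∈ Finset.Icc 1 (N - 1) := Finset.mem_Icc.2 ⟨H.r_pos, H.r_le⟩
  have hkr' : k ≠ r := by rintro rfl; simp at hkr
  have h1 := H.rels.serreRels_e.serre r hr k hk hkr
  have h2 : qComm (q : ℂ) (e r) (e k) ∈ S.Deg 1 :=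
    sub_mem (Deg.mul hd (H.e_deg hk hkr')) (S.smul_mem' _ H.inv_mem (Deg.mul (H.e_deg hk hkr') hd))
  have h3 : qComm (q : ℂ) (e r) (e k) * e r - e r * qComm (q : ℂ) (e r) (e k) =
      -(((q : ℂ) ^ (1 : ℤ) - 1) • (qComm (q : ℂ) (e r) (e k) * e r)) := by
    have h4 : e k * e r * e r = ((q : ℂ) + (q : ℂ)⁻¹) • (e r * e k * e r) - e r * e r * e k := by
      rw [← sub_eq_zero, ← h1]; abel
    have hq := H.ne_zero
    simp only [qComm, sub_mul, mul_sub, smul_mul_assoc, mul_smul_comm, ← mul_assoc, h4, zpow_one]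
    match_scalars <;> field_simp <;> ring
  rw [h3]
  exact neg_mem (H.sub_smul_mem_neg 1 (Deg.mul h2 hd))

/-- The mixed case of the bracket with `e r`, from the symmetric roles of the two neighbours. -/
theorem bracket_one_one_mem (H : QFilt q N r S e f kg ki) (h1 : 1 < r) (h2 : 1 < N - r) :
    rootVec (q : ℂ) e r 1 1 * e r - e r * rootVec (q : ℂ) e r 1 1 ∈ S.Neg 2 := by
  have hr : r ∈ Finset.Icc 1 (N - 1) := Finset.mem_Icc.2 ⟨H.r_pos, H.r_le⟩
  have hc : r - 1 ∈ Finset.Icc 1 (N - 1) := Finset.mem_Icc.2 ⟨by omega, by omega⟩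
  have hd : r + 1 ∈ Finset.Icc 1 (N - 1) := Finset.mem_Icc.2 ⟨by omega, by omega⟩
  have hcd : Commute (e (r - 1)) (e (r + 1)) :=
    H.rels.serreRels_e.commute _ hc _ hd (by omega)
  have her : e r ∈ S.Deg 1 := by
    simpa [rootVec_zero_zero] using
      H.rootVecs_deg (rootVec_mem_rootVecs (e := e) (show 0 < r by omega) (show 0 < N - r by omega))
  have hone : ∀ {k : ℕ}, k ∈ Finset.Icc 1 (N - 1) → k ≠ r → ((r : ℤ) - k).natAbs = 1 →
      qComm (q : ℂ) (e r) (e k) ∈ S.Deg 1 := fun hk hkr h =>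
    sub_mem (Deg.mul her (H.e_deg hk hkr)) (S.smul_mem' _ H.inv_mem (Deg.mul (H.e_deg hk hkr) her))
  have hstep : ∀ {c d : ℕ}, c ∈ Finset.Icc 1 (N - 1) → c ≠ r → d ∈ Finset.Icc 1 (N - 1) → d ≠ r →
      ((r : ℤ) - d).natAbs = 1 → ∀ X, X = qComm (q : ℂ) (qComm (q : ℂ) (e r) (e d)) (e c) →
      X * e r - e r * X - ((e r * e d - e d * e r) * (e c * e r - e r * e c) -
        (e c * e r - e r * e c) * (e r * e d - e d * e r)) ∈ S.Neg 2 := by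
    rintro c d hc hcr hd hdr hrd _ rfl
    have hw : e c * e r - e r * e c ∈ S.Deg 1 :=
      sub_mem (Deg.mul (H.e_deg hc hcr) her) (Deg.mul her (H.e_deg hc hcr))
    have hv := hone hd hdr hrd
    have h1 := H.qComm_neg_deg (m := 2) (H.bracket_qComm_of_serre hd hrd her) (H.e_deg hc hcr)
    have h2 := H.qComm_sub_bracket_mem (m := 2) hv hw
    have h3 := H.qComm_sub_bracket_mem (m := 1) her (H.e_deg hd hdr)
    have h4 := sub_mem (Neg.mul_deg h3 hw (show 1 + 1 = 2 from rfl))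
      (Deg.mul_neg hw h3 (show 1 + 1 = 2 from rfl))
    rw [qComm_bracket]
    refine Set.mem_of_eq_of_mem ?_ (add_mem h1 (add_mem h2 h4))
    noncomm_ring
  have h3 := hstep hc (by omega) hd (by omega) (by omega) (rootVec (q : ℂ) e r 1 1) rfl
  have h4 := hstep hd (by omega) hc (by omega) (by omega) (rootVec (q : ℂ) e r 1 1)
    (qComm_right_comm _ _ hcd)
  refine Set.mem_of_eq_of_mem ?_ (S.smul_mem' _ H.half_mem (add_mem h3 h4))
  have h5 : ∀ V w X : U, X - (V * (-w) - -w * V) + (X - (w * (-V) - -V * w)) = (2 : ℂ) • X := by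
    intro V w X
    rw [two_smul]
    noncomm_ring
  rw [← neg_sub (e r * e (r - 1)), ← neg_sub (e r * e (r + 1)), h5, smul_smul]
  norm_num

/-- The bracket of `e r` with a root vector of the same type is negligible. -/
theorem bracket_base_e_mem (H : QFilt q N r S e f kg ki) {x : U} (hx : x ∈ rootVecs q N r e) :
    x * e r - e r * x ∈ S.Neg 2 := by
  have hr : r ∈ Finset.Icc 1 (N - 1) := Finset.mem_Icc.2 ⟨H.r_pos, H.r_le⟩
  have her : 0 < r → 0 < N - r → e r ∈ S.Deg 1 := fun h1 h2 => by
    simpa [rootVec_zero_zero] using H.rootVecs_deg (rootVec_mem_rootVecs (e := e) h1 h2)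
  obtain ⟨a, ha, b, hb, rfl⟩ := hx
  have hz : ∀ {b : ℕ}, b < N - r → rootVec (q : ℂ) e r 0 b * e r - e r * rootVec (q : ℂ) e r 0 b ∈
      S.Neg 2 := by
    intro b hb
    induction b with
    | zero => rw [rootVec_zero_zero, sub_self]; exact zero_mem _
    | succ b ih =>
      have hk : r + 1 + b ∈ Finset.Icc 1 (N - 1) := Finset.mem_Icc.2 ⟨by omega, by omega⟩
      rw [rootVec_zero_succ]
      rcases Nat.eq_zero_or_pos b with rfl | hb0
      · exact H.bracket_qComm_of_serre hk (by omega) (her (by omega) (by omega))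
      · exact H.bracket_qComm_of_commute hk (by omega) (ih (by omega))
  induction a with
  | zero => exact hz hb
  | succ a ih =>
    have hk : r - 1 - a ∈ Finset.Icc 1 (N - 1) := Finset.mem_Icc.2 ⟨by omega, by omega⟩
    rcases Nat.eq_zero_or_pos a with rfl | ha0
    · clear ih
      induction b with
      | zero => exact H.bracket_qComm_of_serre hk (by rw [Nat.sub_zero]; omega) (her (by omega) hb)
      | succ b ih =>
        rcases Nat.eq_zero_or_pos b with rfl | hb0
        · exact H.bracket_one_one_mem (by omega) (by omega)
        · have hd : r + 1 + b ∈ Finset.Icc 1 (N - 1) := Finset.mem_Icc.2 ⟨by omega, by omega⟩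
          rw [rootVec_succ_left, rootVec_zero_succ,
            qComm_right_comm _ _ (H.rels.serreRels_e.commute _ hk _ hd (by omega)),
            ← rootVec_succ_left]
          exact H.bracket_qComm_of_commute hd (by omega) (ih (by omega))
    · rw [rootVec_succ_left]
      exact H.bracket_qComm_of_commute hk (by omega) (ih (by omega))

/-- The bracket of a generator with a generator-type root vector is again almost a root vector. -/
theorem bracket_x_e_mem (H : QFilt q N r S e f kg ki) (γ : S.ι) {k : ℕ}
    (hk : k ∈ Finset.Icc 1 (N - 1)) (hkr : k ≠ r) :
    S.x γ * e k - e k * S.x γ ∈ Submodule.span S.A (Set.range S.x) ⊔ S.Neg 1 := by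
  have h1 : almostRoot q N r S e ≤ Submodule.span S.A (Set.range S.x) ⊔ S.Neg 1 :=
    sup_le_sup_right (Submodule.span_mono H.rootVecs_subset_range) _
  have h2 : almostRoot q N r S f ≤ Submodule.span S.A (Set.range S.x) ⊔ S.Neg 1 :=
    sup_le_sup_right (Submodule.span_mono H.swap.rootVecs_subset_range) _
  obtain ⟨a, ha, b, hb, h | h⟩ := H.x_eq γ
  · exact h1 (H.bracket_e_mem ⟨a, ha, b, hb, h⟩ hk hkr)
  · exact h2 (H.swap.bracket_f_mem ⟨a, ha, b, hb, h⟩ hk hkr)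

theorem bracket_rootVec_mem (H : QFilt q N r S e f kg ki) {x : U} (hx : x ∈ rootVecs q N r e)
    (γ : S.ι) : x * S.x γ - S.x γ * x ∈ S.Neg 2 := by
  obtain ⟨a, ha, b, hb, rfl⟩ := hx
  refine rootVec_induction (P := fun x => ∀ γ, x * S.x γ - S.x γ * x ∈ S.Neg 2) ?_ ?_ ha hb γ
  · intro γ
    rw [← neg_sub]
    refine neg_mem ?_
    obtain ⟨a, ha, b, hb, h | h⟩ := H.x_eq γ
    · exact H.bracket_base_e_mem ⟨a, ha, b, hb, h⟩
    · exact H.bracket_base_f_mem ⟨a, ha, b, hb, h⟩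
  · intro a ha b hb k hk hkr ih γ
    have hd := H.rootVecs_deg (rootVec_mem_rootVecs (e := e) ha hb)
    rw [qComm_bracket]
    refine add_mem (H.qComm_neg_deg (ih γ) (H.e_deg hk hkr)) ?_
    obtain ⟨v, hv, w, hw, h⟩ := Submodule.mem_sup.1 (H.bracket_x_e_mem γ hk hkr)
    have h1 : e k * S.x γ - S.x γ * e k = -(v + w) := by rw [h, neg_sub]
    have h2 : ∀ x : U, qComm (q : ℂ) x (-(v + w)) = -(qComm (q : ℂ) x v + qComm (q : ℂ) x w) := by
      intro x; simp only [qComm, mul_neg, neg_mul, mul_add, add_mul, smul_add, smul_neg]; abel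
    rw [h1, h2]
    refine neg_mem (add_mem ?_ (H.qComm_deg_neg hd hw))
    set x := rootVec (q : ℂ) e r a b
    have h3 : Submodule.span S.A (Set.range S.x) ≤ (S.Neg 2).comap
        (LinearMap.mulLeft S.A x - (⟨_, H.inv_mem⟩ : S.A) • LinearMap.mulRight S.A x) := by
      refine Submodule.span_le.2 ?_
      rintro _ ⟨γ', rfl⟩
      change qComm (q : ℂ) x (S.x γ') ∈ S.Neg 2
      rw [← sub_add_cancel (qComm (q : ℂ) x (S.x γ')) (x * S.x γ' - S.x γ' * x)]
      exact add_mem (H.qComm_sub_bracket_mem hd (Deg.x γ')) (ih γ')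
    exact h3 hv

/-- The elements `x γ` commute up to negligible elements. -/
theorem bracket_x_mem (H : QFilt q N r S e f kg ki) (γ γ' : S.ι) :
    S.x γ * S.x γ' - S.x γ' * S.x γ ∈ S.Neg 2 := by
  obtain ⟨a, ha, b, hb, h | h⟩ := H.x_eq γ
  · exact H.bracket_rootVec_mem ⟨a, ha, b, hb, h⟩ γ'
  · exact H.swap.bracket_rootVec_mem ⟨a, ha, b, hb, h⟩ γ'

end QFilt

namespace UqslData

open FiltData

variable {q : ℝ} {N : ℕ} (D : UqslData q N) {r : ℕ}

theorem mul_mem_Jsub {k : D.U} (hk : k ∈ D.Ksub r) (h : Coalgebra.counit (R := ℂ) k = 0) (u : D.U) :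
    k * u ∈ D.Jsub r := Submodule.subset_span ⟨k, hk, h, u, rfl⟩

theorem mem_Jsub {k : D.U} (hk : k ∈ D.Ksub r) (h : Coalgebra.counit (R := ℂ) k = 0) :
    k ∈ D.Jsub r := by
  simpa using D.mul_mem_Jsub hk h 1

theorem Jsub_mul_mem {j : D.U} (hj : j ∈ D.Jsub r) (u : D.U) : j * u ∈ D.Jsub r := by
  have : D.Jsub r ≤ (D.Jsub r).comap (LinearMap.mulRight ℂ u) := by
    refine Submodule.span_le.2 ?_
    rintro _ ⟨k, hk, h, v, rfl⟩
    change k * v * u ∈ D.Jsub r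
    rw [mul_assoc]
    exact D.mul_mem_Jsub hk h _
  exact this hj

theorem counit_Jsub {j : D.U} (hj : j ∈ D.Jsub r) : Coalgebra.counit (R := ℂ) j = 0 := by
  have : D.Jsub r ≤ LinearMap.ker (Coalgebra.counit (R := ℂ) (A := D.U)) := by
    refine Submodule.span_le.2 ?_
    rintro _ ⟨k, -, h, v, rfl⟩
    simp [h]
  exact this hj

theorem E_mem_Ksub {k : ℕ} (hk : k ∈ Finset.Icc 1 (N - 1)) (hkr : k ≠ r) : D.E k ∈ D.Ksub r :=
  Algebra.subset_adjoin (Or.inl ⟨k, hk, hkr, Or.inl rfl⟩)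

theorem F_mem_Ksub {k : ℕ} (hk : k ∈ Finset.Icc 1 (N - 1)) (hkr : k ≠ r) : D.F k ∈ D.Ksub r :=
  Algebra.subset_adjoin (Or.inl ⟨k, hk, hkr, Or.inr rfl⟩)

theorem Kg_mem_Ksub {k : ℕ} (hk : k ∈ Finset.Icc 1 (N - 1)) : D.Kg k ∈ D.Ksub r :=
  Algebra.subset_adjoin (Or.inr ⟨k, hk, Or.inl rfl⟩)

theorem Ki_mem_Ksub {k : ℕ} (hk : k ∈ Finset.Icc 1 (N - 1)) : D.Ki k ∈ D.Ksub r :=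
  Algebra.subset_adjoin (Or.inr ⟨k, hk, Or.inr rfl⟩)

theorem E_mem_Jsub {k : ℕ} (hk : k ∈ Finset.Icc 1 (N - 1)) (hkr : k ≠ r) : D.E k ∈ D.Jsub r :=
  D.mem_Jsub (D.E_mem_Ksub hk hkr) (D.counit_E k hk)

theorem F_mem_Jsub {k : ℕ} (hk : k ∈ Finset.Icc 1 (N - 1)) (hkr : k ≠ r) : D.F k ∈ D.Jsub r :=
  D.mem_Jsub (D.F_mem_Ksub hk hkr) (D.counit_F k hk)

theorem Kg_sub_one_mem_Jsub {k : ℕ} (hk : k ∈ Finset.Icc 1 (N - 1)) : D.Kg k - 1 ∈ D.Jsub r :=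
  D.mem_Jsub (sub_mem (D.Kg_mem_Ksub hk) (one_mem _)) (by simp [D.counit_Kg k hk])

theorem Ki_sub_one_mem_Jsub {k : ℕ} (hk : k ∈ Finset.Icc 1 (N - 1)) : D.Ki k - 1 ∈ D.Jsub r :=
  D.mem_Jsub (sub_mem (D.Ki_mem_Ksub hk) (one_mem _)) (by simp [D.counit_Ki k hk])

theorem der_Ksub_mul {g : D.U →ₗ[ℂ] ℂ} (hg : ∀ j ∈ D.Jsub r, g j = 0) {k : D.U}
    (hk : k ∈ D.Ksub r) : ∀ u, der g (k * u) = k * der g u := by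
  have hzero : ∀ {c : D.U}, c ∈ D.Jsub r → g ∘ₗ LinearMap.mulLeft ℂ c = 0 := fun hc =>
    LinearMap.ext fun v => hg _ (D.Jsub_mul_mem hc v)
  have hone : ∀ {c : D.U}, c - 1 ∈ D.Jsub r → g ∘ₗ LinearMap.mulLeft ℂ c = g := fun {c} hc =>
    LinearMap.ext fun v => by
      have := hg _ (D.Jsub_mul_mem hc v)
      rwa [sub_mul, one_mul, map_sub, sub_eq_zero] at this
  have h1 : g ∘ₗ LinearMap.mulLeft ℂ (1 : D.U) = g := hone (by rw [sub_self]; exact zero_mem _)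
  have h0 : ∀ t : D.U ⊗[ℂ] D.U, derTensor (0 : D.U →ₗ[ℂ] ℂ) t = 0 := fun t => by
    simp [derTensor]
  have key : ∀ k u : D.U, der g (k * u) =
      derTensor g (Coalgebra.comul (R := ℂ) k * Coalgebra.comul (R := ℂ) u) := fun k u => by
    rw [der, LinearMap.comp_apply, Bialgebra.comul_mul]
  induction hk using Algebra.adjoin_induction with
  | mem c hc =>
    intro u
    rw [key]
    obtain ⟨j, hj, hjr, rfl | rfl⟩ | ⟨j, hj, rfl | rfl⟩ := hc
    · rw [D.comul_E j hj, add_mul, map_add, derTensor_tmul_mul, derTensor_tmul_mul, h1,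
        hzero (D.E_mem_Jsub hj hjr), h0, mul_zero, add_zero]
      rfl
    · rw [D.comul_F j hj, add_mul, map_add, derTensor_tmul_mul, derTensor_tmul_mul,
        hone (D.Ki_sub_one_mem_Jsub hj), hzero (D.F_mem_Jsub hj hjr), h0, mul_zero, add_zero]
      rfl
    · rw [D.comul_Kg j hj, derTensor_tmul_mul, hone (D.Kg_sub_one_mem_Jsub hj)]
      rfl
    · rw [D.comul_Ki j hj, derTensor_tmul_mul, hone (D.Ki_sub_one_mem_Jsub hj)]
      rfl
  | algebraMap a =>
    intro u
    rw [← Algebra.smul_def, map_smul, Algebra.smul_def]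
  | add a b _ _ ha hb => intro u; rw [add_mul, map_add, ha, hb, add_mul]
  | mul a b _ _ ha hb => intro u; rw [mul_assoc, ha, hb, mul_assoc]

theorem der_Jsub {g : D.U →ₗ[ℂ] ℂ} (hg : ∀ j ∈ D.Jsub r, g j = 0) {j : D.U}
    (hj : j ∈ D.Jsub r) : der g j ∈ D.Jsub r := by
  have : D.Jsub r ≤ (D.Jsub r).comap (der g) := by
    refine Submodule.span_le.2 ?_
    rintro _ ⟨k, hk, h, v, rfl⟩
    change der g (k * v) ∈ D.Jsub r
    rw [D.der_Ksub_mul hg hk]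
    exact D.mul_mem_Jsub hk h _
  exact this hj

variable (r) in
/-- The filtration of `U` by the number of root vectors. -/
def filt : FiltData D.U where
  A := localSubring q
  h := qSubOne q
  J := D.Jsub r
  mul_mem _ hj u := D.Jsub_mul_mem hj u
  ι := Bool × Fin r × Fin (N - r)
  x γ := rootVec (q : ℂ) (bif γ.1 then D.E else D.F) r γ.2.1 γ.2.2

theorem qFilt (hq : Transcendental ℚ q) (hr1 : 1 ≤ r) (hr2 : r ≤ N - 1) :
    QFilt q N r (D.filt r) D.E D.F D.Kg D.Ki where
  r_pos := hr1
  r_le := hr2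
  ne_zero := ne_zero_of_transcendental hq
  add_inv_ne_zero := add_inv_ne_zero_of_transcendental hq
  h_eq := coe_qSubOne
  zpow_mem := zpow_mem_localSubring hq
  zpow_sub_one := exists_zpow_sub_one hq
  quantum_int_mem := quantum_int_mem_localSubring hq
  half_mem := inv_natCast_mem_localSubring (q := q) (n := 2) two_ne_zero
  rels := D.rels
  e_mem _ hk hkr := D.E_mem_Jsub hk hkr
  f_mem _ hk hkr := D.F_mem_Jsub hk hkr
  kg_mem _ hk := D.Kg_sub_one_mem_Jsub hk
  ki_mem _ hk := D.Ki_sub_one_mem_Jsub hk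
  exists_x_e a ha b hb := ⟨(true, ⟨a, ha⟩, ⟨b, hb⟩), rfl⟩
  exists_x_f a ha b hb := ⟨(false, ⟨a, ha⟩, ⟨b, hb⟩), rfl⟩
  x_eq := by
    rintro ⟨_ | _, a, b⟩
    exacts [⟨a, a.2, b, b.2, Or.inr rfl⟩, ⟨a, a.2, b, b.2, Or.inl rfl⟩]

/-- The filtration together with the generators used to control the coproduct. -/
def skewFilt (hq : Transcendental ℚ q) (hr1 : 1 ≤ r) (hr2 : r ≤ N - 1) : SkewFilt D.U where
  toFiltData := D.filt r
  q := q
  q_ne_zero := ne_zero_of_transcendental hq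
  q_inv_mem := inv_mem_localSubring hq
  h_eq := coe_qSubOne
  h_ne_zero := by
    change (q : ℂ) - 1 ≠ 0
    exact sub_ne_zero.2 (ne_one_of_transcendental hq)
  base := {D.E r, D.F r}
  C := {c | ∃ k ∈ Finset.Icc 1 (N - 1), k ≠ r ∧ (c = D.E k ∨ c = D.F k)}
  P := {1} ∪ {c | ∃ k ∈ Finset.Icc 1 (N - 1), c = D.Kg k ∨ c = D.Ki k}
  skew := by
    have hr : r ∈ Finset.Icc 1 (N - 1) := Finset.mem_Icc.2 ⟨hr1, hr2⟩
    have hE : ∀ k ∈ Finset.Icc 1 (N - 1), _ := fun k hk =>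
      (⟨1, Or.inl rfl, D.Kg k, Or.inr ⟨k, hk, Or.inl rfl⟩, D.comul_E k hk⟩ :
        ∃ p ∈ {1} ∪ {c | ∃ k ∈ Finset.Icc 1 (N - 1), c = D.Kg k ∨ c = D.Ki k},
        ∃ p' ∈ {1} ∪ {c | ∃ k ∈ Finset.Icc 1 (N - 1), c = D.Kg k ∨ c = D.Ki k},
        Coalgebra.comul (R := ℂ) (D.E k) = D.E k ⊗ₜ[ℂ] p + p' ⊗ₜ[ℂ] D.E k)
    have hF : ∀ k ∈ Finset.Icc 1 (N - 1), _ := fun k hk =>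
      (⟨D.Ki k, Or.inr ⟨k, hk, Or.inr rfl⟩, 1, Or.inl rfl, D.comul_F k hk⟩ :
        ∃ p ∈ {1} ∪ {c | ∃ k ∈ Finset.Icc 1 (N - 1), c = D.Kg k ∨ c = D.Ki k},
        ∃ p' ∈ {1} ∪ {c | ∃ k ∈ Finset.Icc 1 (N - 1), c = D.Kg k ∨ c = D.Ki k},
        Coalgebra.comul (R := ℂ) (D.F k) = D.F k ⊗ₜ[ℂ] p + p' ⊗ₜ[ℂ] D.F k)
    rintro c ((rfl | rfl) | ⟨k, hk, -, rfl | rfl⟩)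
    exacts [hE r hr, hF r hr, hE k hk, hF k hk]
  P_deg := by
    rintro p (rfl | ⟨k, hk, rfl | rfl⟩)
    exacts [Deg.one, (D.qFilt hq hr1 hr2).kGen_mem_deg (QFilt.kg_mem_kGen hk),
      (D.qFilt hq hr1 hr2).kGen_mem_deg (QFilt.ki_mem_kGen hk)]
  P_neg := by
    rintro p (rfl | ⟨k, hk, rfl | rfl⟩)
    · rw [sub_self]; exact zero_mem _
    exacts [(D.qFilt hq hr1 hr2).kg_sub_one_mem_neg hk, (D.qFilt hq hr1 hr2).ki_sub_one_mem_neg hk]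
  P_J := by
    rintro p (rfl | ⟨k, hk, rfl | rfl⟩)
    · rw [sub_self]; exact zero_mem _
    exacts [D.Kg_sub_one_mem_Jsub hk, D.Ki_sub_one_mem_Jsub hk]
  base_deg := by
    rintro _ (rfl | rfl)
    exacts [Deg.x (S := D.filt r) (true, ⟨0, hr1⟩, ⟨0, by omega⟩),
      Deg.x (S := D.filt r) (false, ⟨0, hr1⟩, ⟨0, by omega⟩)]
  C_deg := by
    rintro _ ⟨k, hk, hkr, rfl | rfl⟩
    exacts [(D.qFilt hq hr1 hr2).e_deg hk hkr, (D.qFilt hq hr1 hr2).f_deg hk hkr]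
  C_J := by
    rintro _ ⟨k, hk, hkr, rfl | rfl⟩
    exacts [D.E_mem_Jsub hk hkr, D.F_mem_Jsub hk hkr]
  isWord := by
    rintro ⟨_ | _, a, b⟩
    · exact rootVec_induction (.of_base (Or.inr rfl))
        (fun _ _ _ _ k hk hkr ih => ih.step ⟨k, hk, hkr, Or.inr rfl⟩) a.2 b.2
    · exact rootVec_induction (.of_base (Or.inl rfl))
        (fun _ _ _ _ k hk hkr ih => ih.step ⟨k, hk, hkr, Or.inl rfl⟩) a.2 b.2
  counit_J _ hj := D.counit_Jsub hj
  der_J _ hg _ hj := D.der_Jsub hg hj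

/-- The filtration is exhaustive. -/
theorem exists_mem_G (hq : Transcendental ℚ q) (hr1 : 1 ≤ r) (hr2 : r ≤ N - 1) (u : D.U) :
    ∃ n, u ∈ (D.filt r).G n := by
  have H := D.qFilt hq hr1 hr2
  have hu : u ∈ Algebra.adjoin ℂ
      {x : D.U | ∃ i ∈ Finset.Icc 1 (N - 1), x = D.E i ∨ x = D.F i ∨ x = D.Kg i ∨ x = D.Ki i} :=
    D.gen ▸ Algebra.mem_top
  have key : ∀ n, ∀ y ∈ (D.filt r).G n, ∃ m, y * u ∈ (D.filt r).G m := by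
    induction hu using Algebra.adjoin_induction with
    | mem c hc =>
      have hdeg : ∃ k, c ∈ (D.filt r).Deg k := by
        obtain ⟨j, hj, rfl | rfl | rfl | rfl⟩ := hc
        · rcases eq_or_ne j r with rfl | hjr
          · exact ⟨1, Deg.x (S := D.filt j) (true, ⟨0, hr1⟩, ⟨0, by omega⟩)⟩
          · exact ⟨0, H.e_deg hj hjr⟩
        · rcases eq_or_ne j r with rfl | hjr
          · exact ⟨1, Deg.x (S := D.filt j) (false, ⟨0, hr1⟩, ⟨0, by omega⟩)⟩
          · exact ⟨0, H.f_deg hj hjr⟩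
        · exact ⟨0, H.kGen_mem_deg (QFilt.kg_mem_kGen hj)⟩
        · exact ⟨0, H.kGen_mem_deg (QFilt.ki_mem_kGen hj)⟩
      obtain ⟨k, hk⟩ := hdeg
      exact fun n y hy => ⟨n + k, Deg.G hk hy⟩
    | algebraMap a =>
      refine fun n y hy => ⟨n, ?_⟩
      rw [← Algebra.commutes, ← Algebra.smul_def]
      exact Submodule.smul_mem _ a hy
    | add a b _ _ ha hb =>
      intro n y hy
      obtain ⟨k, hk⟩ := ha n y hy
      obtain ⟨l, hl⟩ := hb n y hy
      exact ⟨max k l, by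
        rw [mul_add]
        exact add_mem (FiltData.G_mono _ (le_max_left k l) hk)
          (FiltData.G_mono _ (le_max_right k l) hl)⟩
    | mul a b _ _ ha hb =>
      intro n y hy
      obtain ⟨k, hk⟩ := ha n y hy
      rw [← mul_assoc]
      exact hb k _ hk
  obtain ⟨m, hm⟩ := key 1 1 (FiltData.one_mem_G _ 0)
  exact ⟨m, by rwa [one_mul] at hm⟩

end UqslData

section MatrixUnits

/-- The matrix units acting on `ℕ → ℂ`. -/
def munit (a b : ℕ) : Module.End ℂ (ℕ → ℂ) :=
  LinearMap.single ℂ (fun _ : ℕ => ℂ) a ∘ₗ LinearMap.proj b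

theorem munit_mul_munit (a b c d : ℕ) :
    munit a b * munit c d = if b = c then munit a d else 0 := by
  split_ifs with h
  · subst h
    ext v i
    simp [munit]
  · refine LinearMap.ext fun v => ?_
    simp [munit, Pi.single_eq_of_ne h]

/-- The projection onto the coordinates of index at most `r`. -/
def lowProj (r : ℕ) : Module.End ℂ (ℕ → ℂ) where
  toFun v i := if i ≤ r then v i else 0
  map_add' v w := by ext i; simp only [Pi.add_apply]; split_ifs <;> simp
  map_smul' c v := by ext i; simp

theorem lowProj_mul_munit (r a b : ℕ) :
    lowProj r * munit a b = if a ≤ r then munit a b else 0 := by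
  refine LinearMap.ext fun v => funext fun i => ?_
  rcases eq_or_ne i a with rfl | hi
  · split_ifs with h <;> simp [lowProj, munit, h]
  · split_ifs with h <;> simp [lowProj, munit, hi]

theorem munit_mul_lowProj (r a b : ℕ) :
    munit a b * lowProj r = if b ≤ r then munit a b else 0 := by
  refine LinearMap.ext fun v => ?_
  split_ifs with h <;> simp [lowProj, munit, h]

/-- Matrix entries. -/
def entry (a b : ℕ) : Module.End ℂ (ℕ → ℂ) →ₗ[ℂ] ℂ :=
  LinearMap.proj a ∘ₗ LinearMap.applyₗ (Pi.single b 1)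

theorem entry_munit (a b c d : ℕ) : entry a b (munit c d) = if a = c ∧ b = d then 1 else 0 := by
  by_cases h1 : a = c <;> by_cases h2 : b = d <;> simp [entry, munit, h1, h2]

theorem entry_lowProj (r : ℕ) {a b : ℕ} (h : a ≠ b) : entry a b (lowProj r) = 0 := by
  simp [entry, lowProj, h]

/-- The action of the Cartan generators on the vector representation. -/
def vecK (s : ℂ) (i : ℕ) : Module.End ℂ (ℕ → ℂ) :=
  1 + (s - 1) • munit i i + (s⁻¹ - 1) • munit (i + 1) (i + 1)

theorem vecK_mul_munit (s : ℂ) (i a b : ℕ) :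
    vecK s i * munit a b = (if a = i then s else if a = i + 1 then s⁻¹ else 1) • munit a b := by
  simp only [vecK, add_mul, one_mul, smul_mul_assoc, munit_mul_munit]
  by_cases h1 : i = a
  · subst h1; simp; module
  · by_cases h2 : i + 1 = a
    · subst h2; simp; module
    · simp [h1, h2, Ne.symm h1, Ne.symm h2]

theorem munit_mul_vecK (s : ℂ) (i a b : ℕ) :
    munit a b * vecK s i = (if b = i then s else if b = i + 1 then s⁻¹ else 1) • munit a b := by
  simp only [vecK, mul_add, mul_one, mul_smul_comm, munit_mul_munit]
  by_cases h1 : b = i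
  · subst h1; simp; module
  · by_cases h2 : b = i + 1
    · subst h2; simp; module
    · simp [h1, h2]

theorem vecK_mul_vecK_inv {s : ℂ} (hs : s ≠ 0) (i : ℕ) : vecK s i * vecK s⁻¹ i = 1 := by
  have h : vecK s⁻¹ i = 1 + (s⁻¹ - 1) • munit i i + (s - 1) • munit (i + 1) (i + 1) := by
    rw [vecK, inv_inv]
  rw [h, mul_add, mul_add, mul_smul_comm, mul_smul_comm, vecK_mul_munit, vecK_mul_munit, vecK]
  simp only [if_true, mul_one, Nat.succ_ne_self, if_false]
  match_scalars <;> field_simp <;> ring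

/-- The vector representation. -/
theorem uqslRels_munit {q : ℝ} (hq0 : (q : ℂ) ≠ 0) (hq1 : (q : ℂ) - (q : ℂ)⁻¹ ≠ 0) (N : ℕ) :
    UqslRels q N (fun i => munit i (i + 1)) (fun i => munit (i + 1) i) (vecK q)
      (vecK (q : ℂ)⁻¹) := by
  refine ⟨fun i _ => ⟨vecK_mul_vecK_inv hq0 i, ?_⟩, fun i _ j _ => ?_, fun i _ j _ => ?_,
    fun i _ j _ => ?_, fun i _ j _ => ?_, fun i _ j _ hij => ?_, fun i _ j _ hij => ?_,
    fun i _ j _ hij => ?_, fun i _ j _ hij => ?_⟩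
  · simpa using vecK_mul_vecK_inv (inv_ne_zero hq0) i
  · have h : vecK q j = 1 + ((q : ℂ) - 1) • munit j j +
      ((q : ℂ)⁻¹ - 1) • munit (j + 1) (j + 1) := rfl
    rw [h, mul_add, mul_add, add_mul, add_mul, mul_smul_comm, mul_smul_comm, smul_mul_assoc,
      smul_mul_assoc, vecK_mul_munit, vecK_mul_munit, munit_mul_vecK, munit_mul_vecK, mul_one,
      one_mul]
  · rw [vecK_mul_munit, munit_mul_vecK, smul_smul]
    congr 1
    rcases lt_trichotomy i j with h | rfl | h
    · rcases Nat.lt_or_eq_of_le (Nat.succ_le_of_lt h) with h' | rfl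
      · have h1 : ¬ ((i : ℤ) - j).natAbs = 1 := by omega
        rw [cartanSL, if_neg h.ne, if_neg h1]
        repeat rw [if_neg (by omega)]
        simp
      · have h1 : ¬ i + 1 + 1 = i := by omega
        simp [cartanSL, h1]
    · simp [cartanSL]; field_simp
    · rcases Nat.lt_or_eq_of_le (Nat.succ_le_of_lt h) with h' | rfl
      · have h1 : ¬ ((i : ℤ) - j).natAbs = 1 := by omega
        rw [cartanSL, if_neg h.ne', if_neg h1]
        repeat rw [if_neg (by omega)]
        simp
      · have h1 : ¬ j = j + 1 + 1 := by omega
        simp [cartanSL, h1, hq0]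
  · rw [vecK_mul_munit, munit_mul_vecK, smul_smul]
    congr 1
    rcases lt_trichotomy i j with h | rfl | h
    · rcases Nat.lt_or_eq_of_le (Nat.succ_le_of_lt h) with h' | rfl
      · have h1 : ¬ ((i : ℤ) - j).natAbs = 1 := by omega
        rw [cartanSL, if_neg h.ne, if_neg h1]
        repeat rw [if_neg (by omega)]
        simp
      · have h1 : ¬ i + 1 + 1 = i := by omega
        simp [cartanSL, h1, hq0]
    · simp [cartanSL]; field_simp
    · rcases Nat.lt_or_eq_of_le (Nat.succ_le_of_lt h) with h' | rfl
      · have h1 : ¬ ((i : ℤ) - j).natAbs = 1 := by omega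
        rw [cartanSL, if_neg h.ne', if_neg h1]
        repeat rw [if_neg (by omega)]
        simp
      · have h1 : ¬ j = j + 1 + 1 := by omega
        simp [cartanSL, h1]
  · rw [munit_mul_munit, munit_mul_munit]
    by_cases h : i = j
    · subst h
      have h1 : vecK q i - vecK (q : ℂ)⁻¹ i =
          ((q : ℂ) - (q : ℂ)⁻¹) • (munit i i - munit (i + 1) (i + 1)) := by
        rw [vecK, vecK, inv_inv]; module
      rw [if_pos rfl, if_pos rfl, if_pos rfl, h1, smul_smul, inv_mul_cancel₀ hq1, one_smul]
    · simp [h, Ne.symm h]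
  · have h1 : munit i (i + 1) * munit i (i + 1) = 0 := by simp [munit_mul_munit]
    have h2 : munit i (i + 1) * munit j (j + 1) * munit i (i + 1) = 0 := by
      rw [munit_mul_munit]
      split_ifs with h
      · rw [munit_mul_munit, if_neg (by omega)]
      · rw [zero_mul]
    rw [h2, mul_assoc (munit j _), h1]
    simp
  · have h1 : i + 1 ≠ j := by omega
    have h2 : j + 1 ≠ i := by omega
    simp [munit_mul_munit, h1, h2]
  · have h1 : munit (i + 1) i * munit (i + 1) i = 0 := by simp [munit_mul_munit]
    have h2 : munit (i + 1) i * munit (j + 1) j * munit (i + 1) i = 0 := by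
      rw [munit_mul_munit]
      split_ifs with h
      · rw [munit_mul_munit, if_neg (by omega)]
      · rw [zero_mul]
    rw [h2, mul_assoc (munit (j + 1) _), h1]
    simp
  · have h1 : i + 1 ≠ j := by omega
    have h2 : j + 1 ≠ i := by omega
    simp [munit_mul_munit, Ne.symm h1, Ne.symm h2]

end MatrixUnits

section Conj

variable {U : Type} [Ring U] [HopfAlgebra ℂ U] {V : Type} [Ring V] [Algebra ℂ V]

/-- The map `a ⊗ b ↦ ρ (S a) * Q * ρ b`. -/
def adjTensor (ρ : U →ₐ[ℂ] V) (Q : V) : U ⊗[ℂ] U →ₗ[ℂ] V :=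
  TensorProduct.lift ((LinearMap.mul ℂ V).compl₁₂
    (LinearMap.mulRight ℂ Q ∘ₗ ρ.toLinearMap ∘ₗ HopfAlgebra.antipode ℂ) ρ.toLinearMap)

theorem adjTensor_tmul (ρ : U →ₐ[ℂ] V) (Q : V) (a b : U) :
    adjTensor ρ Q (a ⊗ₜ[ℂ] b) = ρ (HopfAlgebra.antipode ℂ a) * Q * ρ b := by
  simp [adjTensor]

theorem adjTensor_mul (ρ : U →ₐ[ℂ] V) (Q : V) (s t : U ⊗[ℂ] U) :
    adjTensor ρ Q (s * t) = adjTensor ρ (adjTensor ρ Q s) t := by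
  induction t with
  | zero => simp
  | add t t' ht ht' => rw [mul_add, map_add, ht, ht', map_add]
  | tmul a b =>
    induction s with
    | zero => simp [adjTensor_tmul]
    | add s s' hs hs' =>
      rw [add_mul, map_add, hs, hs', map_add]
      simp only [adjTensor_tmul, mul_add, add_mul]
    | tmul c d =>
      rw [Algebra.TensorProduct.tmul_mul_tmul]
      simp only [adjTensor_tmul, HopfAlgebra.antipode_mul_antidistrib, map_mul, mul_assoc]

/-- The right adjoint action of `u` on `Q` through `ρ`. -/
def adjAct (ρ : U →ₐ[ℂ] V) (Q : V) : U →ₗ[ℂ] V := adjTensor ρ Q ∘ₗ Coalgebra.comul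

theorem adjAct_apply (ρ : U →ₐ[ℂ] V) (Q : V) (u : U) :
    adjAct ρ Q u = adjTensor ρ Q (Coalgebra.comul u) := rfl

theorem adjAct_mul (ρ : U →ₐ[ℂ] V) (Q : V) (u v : U) :
    adjAct ρ Q (u * v) = adjAct ρ (adjAct ρ Q u) v := by
  rw [adjAct_apply, Bialgebra.comul_mul, adjTensor_mul]
  rfl

theorem adjAct_one (ρ : U →ₐ[ℂ] V) (Q : V) : adjAct ρ Q 1 = Q := by
  rw [adjAct_apply, Bialgebra.comul_one, Algebra.TensorProduct.one_def, adjTensor_tmul]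
  simp

theorem adjAct_smul (ρ : U →ₐ[ℂ] V) (a : ℂ) (Q : V) (u : U) :
    adjAct ρ (a • Q) u = a • adjAct ρ Q u := by
  rw [adjAct_apply, adjAct_apply]
  induction Coalgebra.comul (R := ℂ) u with
  | zero => simp
  | add s t hs ht => rw [map_add, map_add, hs, ht, smul_add]
  | tmul c d => simp [adjTensor_tmul]

end Conj

namespace UqslData

variable {q : ℝ} {N : ℕ} (D : UqslData q N) {r : ℕ} {V : Type} [Ring V] [Algebra ℂ V]

theorem antipode_Kg {k : ℕ} (hk : k ∈ Finset.Icc 1 (N - 1)) :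
    HopfAlgebra.antipode ℂ (D.Kg k) = D.Ki k := by
  have h := HopfAlgebra.mul_antipode_rTensor_comul_apply (R := ℂ) (D.Kg k)
  rw [D.comul_Kg k hk, D.counit_Kg k hk] at h
  simp only [LinearMap.rTensor_tmul, LinearMap.mul'_apply, map_one] at h
  rw [← mul_one (HopfAlgebra.antipode ℂ (D.Kg k)), ← (D.rels.1 k hk).1, ← mul_assoc, h, one_mul]

theorem antipode_Ki {k : ℕ} (hk : k ∈ Finset.Icc 1 (N - 1)) :
    HopfAlgebra.antipode ℂ (D.Ki k) = D.Kg k := by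
  have h := HopfAlgebra.mul_antipode_rTensor_comul_apply (R := ℂ) (D.Ki k)
  rw [D.comul_Ki k hk, D.counit_Ki k hk] at h
  simp only [LinearMap.rTensor_tmul, LinearMap.mul'_apply, map_one] at h
  rw [← mul_one (HopfAlgebra.antipode ℂ (D.Ki k)), ← (D.rels.1 k hk).2, ← mul_assoc, h, one_mul]

theorem antipode_E {k : ℕ} (hk : k ∈ Finset.Icc 1 (N - 1)) :
    HopfAlgebra.antipode ℂ (D.E k) = -(D.Ki k * D.E k) := by
  have h := HopfAlgebra.mul_antipode_rTensor_comul_apply (R := ℂ) (D.E k)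
  rw [D.comul_E k hk, D.counit_E k hk] at h
  simp only [map_add, LinearMap.rTensor_tmul, LinearMap.mul'_apply, map_zero, mul_one,
    D.antipode_Kg hk] at h
  exact eq_neg_of_add_eq_zero_left h

theorem antipode_F {k : ℕ} (hk : k ∈ Finset.Icc 1 (N - 1)) :
    HopfAlgebra.antipode ℂ (D.F k) = -(D.F k * D.Kg k) := by
  have h := HopfAlgebra.mul_antipode_rTensor_comul_apply (R := ℂ) (D.F k)
  rw [D.comul_F k hk, D.counit_F k hk] at h
  simp only [map_add, LinearMap.rTensor_tmul, LinearMap.mul'_apply, map_zero,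
    HopfAlgebra.antipode_one, one_mul] at h
  rw [← mul_one (HopfAlgebra.antipode ℂ (D.F k)), ← (D.rels.1 k hk).2, ← mul_assoc,
    eq_neg_of_add_eq_zero_left h, neg_mul]

theorem adjAct_E (ρ : D.U →ₐ[ℂ] V) (Q : V) {k : ℕ} (hk : k ∈ Finset.Icc 1 (N - 1)) :
    adjAct ρ Q (D.E k) = ρ (D.Ki k) * (Q * ρ (D.E k) - ρ (D.E k) * Q) := by
  rw [adjAct_apply, D.comul_E k hk, map_add, adjTensor_tmul, adjTensor_tmul, D.antipode_E hk,
    D.antipode_Kg hk, map_neg, map_mul, map_one]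
  noncomm_ring

theorem adjAct_F (ρ : D.U →ₐ[ℂ] V) (Q : V) {k : ℕ} (hk : k ∈ Finset.Icc 1 (N - 1)) :
    adjAct ρ Q (D.F k) = Q * ρ (D.F k) - ρ (D.F k) * (ρ (D.Kg k) * Q * ρ (D.Ki k)) := by
  rw [adjAct_apply, D.comul_F k hk, map_add, adjTensor_tmul, adjTensor_tmul, D.antipode_F hk,
    HopfAlgebra.antipode_one, map_neg, map_mul, map_one]
  noncomm_ring

theorem adjAct_Kg (ρ : D.U →ₐ[ℂ] V) (Q : V) {k : ℕ} (hk : k ∈ Finset.Icc 1 (N - 1)) :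
    adjAct ρ Q (D.Kg k) = ρ (D.Ki k) * Q * ρ (D.Kg k) := by
  rw [adjAct_apply, D.comul_Kg k hk, adjTensor_tmul, D.antipode_Kg hk]

theorem adjAct_Ki (ρ : D.U →ₐ[ℂ] V) (Q : V) {k : ℕ} (hk : k ∈ Finset.Icc 1 (N - 1)) :
    adjAct ρ Q (D.Ki k) = ρ (D.Kg k) * Q * ρ (D.Ki k) := by
  rw [adjAct_apply, D.comul_Ki k hk, adjTensor_tmul, D.antipode_Ki hk]

theorem adjAct_Ksub {ρ : D.U →ₐ[ℂ] V} {P : V}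
    (hK : ∀ k ∈ Finset.Icc 1 (N - 1), Commute P (ρ (D.Kg k)))
    (hEF : ∀ k ∈ Finset.Icc 1 (N - 1), k ≠ r → Commute P (ρ (D.E k)) ∧ Commute P (ρ (D.F k)))
    {u : D.U} (hu : u ∈ D.Ksub r) : adjAct ρ P u = Coalgebra.counit (R := ℂ) u • P := by
  have h1 : ∀ k ∈ Finset.Icc 1 (N - 1), ρ (D.Kg k) * ρ (D.Ki k) = 1 := fun k hk => by
    rw [← map_mul, (D.rels.1 k hk).1, map_one]
  have h2 : ∀ k ∈ Finset.Icc 1 (N - 1), ρ (D.Ki k) * ρ (D.Kg k) = 1 := fun k hk => by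
    rw [← map_mul, (D.rels.1 k hk).2, map_one]
  have h3 : ∀ k ∈ Finset.Icc 1 (N - 1), ρ (D.Kg k) * P * ρ (D.Ki k) = P := fun k hk => by
    rw [← (hK k hk).eq, mul_assoc, h1 k hk, mul_one]
  induction hu using Algebra.adjoin_induction with
  | mem c hc =>
    obtain ⟨k, hk, hkr, rfl | rfl⟩ | ⟨k, hk, rfl | rfl⟩ := hc
    · rw [D.adjAct_E _ _ hk, D.counit_E k hk, (hEF k hk hkr).1.eq]; simp
    · rw [D.adjAct_F _ _ hk, D.counit_F k hk, h3 k hk, (hEF k hk hkr).2.eq]; simp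
    · rw [D.adjAct_Kg _ _ hk, D.counit_Kg k hk, one_smul, mul_assoc, (hK k hk).eq, ← mul_assoc,
        h2 k hk, one_mul]
    · rw [D.adjAct_Ki _ _ hk, D.counit_Ki k hk, one_smul, h3 k hk]
  | algebraMap a =>
    rw [Algebra.algebraMap_eq_smul_one, map_smul, adjAct_one, map_smul, Bialgebra.counit_one,
      smul_eq_mul, mul_one]
  | add a b _ _ ha hb => rw [map_add, ha, hb, map_add, add_smul]
  | mul a b _ _ ha hb => rw [adjAct_mul, ha, adjAct_smul, hb, Bialgebra.counit_mul, smul_smul]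

theorem adjAct_Jsub {ρ : D.U →ₐ[ℂ] V} {P : V}
    (hK : ∀ k ∈ Finset.Icc 1 (N - 1), Commute P (ρ (D.Kg k)))
    (hEF : ∀ k ∈ Finset.Icc 1 (N - 1), k ≠ r → Commute P (ρ (D.E k)) ∧ Commute P (ρ (D.F k)))
    {j : D.U} (hj : j ∈ D.Jsub r) : adjAct ρ P j = 0 := by
  have : D.Jsub r ≤ LinearMap.ker (adjAct ρ P) := by
    refine Submodule.span_le.2 ?_
    rintro _ ⟨k, hk, h, v, rfl⟩
    change adjAct ρ P (k * v) = 0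
    rw [adjAct_mul, D.adjAct_Ksub hK hEF hk, adjAct_smul, h, zero_smul]
  exact this hj

theorem adjAct_qComm {ρ : D.U →ₐ[ℂ] V} {P : V}
    (hK : ∀ k ∈ Finset.Icc 1 (N - 1), Commute P (ρ (D.Kg k)))
    (hEF : ∀ k ∈ Finset.Icc 1 (N - 1), k ≠ r → Commute P (ρ (D.E k)) ∧ Commute P (ρ (D.F k)))
    (s : ℂ) (x : D.U) {c : D.U} (hc : c ∈ D.Jsub r) :
    adjAct ρ P (qComm s x c) = adjAct ρ (adjAct ρ P x) c := by
  rw [qComm, map_sub, map_smul, D.adjAct_Jsub hK hEF (D.Jsub_mul_mem hc x), smul_zero, sub_zero,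
    adjAct_mul]

/-- The functionals dual to the root vectors. -/
theorem exists_dual (hq : Transcendental ℚ q) (hr1 : 1 ≤ r) (hr2 : r ≤ N - 1) :
    ∃ f : Bool × Fin r × Fin (N - r) → D.U →ₗ[ℂ] ℂ, (∀ γ, ∀ j ∈ D.Jsub r, f γ j = 0) ∧
      (∀ γ, f γ 1 = 0) ∧
      ∀ γ γ' : Bool × Fin r × Fin (N - r), f γ ((D.filt r).x γ') = if γ = γ' then 1 else 0 := by
  have hq0 : (q : ℂ) ≠ 0 := ne_zero_of_transcendental hq
  obtain ⟨ρ, hρ⟩ := D.univ _ _ _ _ _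
    (uqslRels_munit (ne_zero_of_transcendental hq) (sub_inv_ne_zero_of_transcendental hq) N)
  have hr : r ∈ Finset.Icc 1 (N - 1) := Finset.mem_Icc.2 ⟨hr1, hr2⟩
  have hK : ∀ k ∈ Finset.Icc 1 (N - 1), Commute (lowProj r) (ρ (D.Kg k)) := fun k hk => by
    rw [(hρ k hk).2.2.1, commute_iff_eq, vecK]
    simp only [mul_add, add_mul, mul_one, one_mul, mul_smul_comm, smul_mul_assoc,
      lowProj_mul_munit, munit_mul_lowProj]
  have hEF : ∀ k ∈ Finset.Icc 1 (N - 1), k ≠ r →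
      Commute (lowProj r) (ρ (D.E k)) ∧ Commute (lowProj r) (ρ (D.F k)) := fun k hk hkr => by
    have h : k ≤ r ↔ k + 1 ≤ r := by omega
    rw [(hρ k hk).1, (hρ k hk).2.1, commute_iff_eq, commute_iff_eq, lowProj_mul_munit,
      munit_mul_lowProj, lowProj_mul_munit, munit_mul_lowProj]
    simp only [h, and_self]
  have hρE : ∀ {k : ℕ} (Q : Module.End ℂ (ℕ → ℂ)), k ∈ Finset.Icc 1 (N - 1) →
      adjAct ρ Q (D.E k) = vecK (q : ℂ)⁻¹ k * (Q * munit k (k + 1) - munit k (k + 1) * Q) :=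
    fun Q hk => by rw [D.adjAct_E _ _ hk, (hρ _ hk).1, (hρ _ hk).2.2.2]
  have hρF : ∀ {k : ℕ} (Q : Module.End ℂ (ℕ → ℂ)), k ∈ Finset.Icc 1 (N - 1) →
      adjAct ρ Q (D.F k) = Q * munit (k + 1) k -
        munit (k + 1) k * (vecK q k * Q * vecK (q : ℂ)⁻¹ k) :=
    fun Q hk => by rw [D.adjAct_F _ _ hk, (hρ _ hk).2.1, (hρ _ hk).2.2.1, (hρ _ hk).2.2.2]
  have hE : ∀ {a b : ℕ}, a < r → b < N - r → ∃ s : ℂ, s ≠ 0 ∧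
      adjAct ρ (lowProj r) (rootVec (q : ℂ) D.E r a b) = s • munit (r - a) (r + 1 + b) := by
    intro a b ha hb
    induction a with
    | zero =>
      induction b with
      | zero =>
        refine ⟨(q : ℂ)⁻¹, inv_ne_zero hq0, ?_⟩
        rw [rootVec_zero_zero, hρE _ hr, lowProj_mul_munit, munit_mul_lowProj, if_pos le_rfl,
          if_neg (by omega), sub_zero, vecK_mul_munit, if_pos rfl]
        rfl
      | succ b ih =>
        obtain ⟨s, hs, h⟩ := ih (by omega)
        have hk : r + 1 + b ∈ Finset.Icc 1 (N - 1) := by simp; omega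
        refine ⟨s, hs, ?_⟩
        rw [rootVec_zero_succ, D.adjAct_qComm hK hEF _ _ (D.E_mem_Jsub hk (by omega)), h,
          adjAct_smul, hρE _ hk, munit_mul_munit, munit_mul_munit, if_pos rfl, if_neg (by omega),
          sub_zero, vecK_mul_munit, if_neg (by omega), if_neg (by omega), one_smul]
        rfl
    | succ a ih =>
      obtain ⟨s, hs, h⟩ := ih (by omega)
      have hk : r - 1 - a ∈ Finset.Icc 1 (N - 1) := by simp; omega
      refine ⟨s * -(q : ℂ)⁻¹, mul_ne_zero hs (neg_ne_zero.2 (inv_ne_zero hq0)), ?_⟩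
      rw [rootVec_succ_left, D.adjAct_qComm hK hEF _ _ (D.E_mem_Jsub hk (by omega)), h,
        adjAct_smul, hρE _ hk, munit_mul_munit, munit_mul_munit, if_neg (by omega),
        if_pos (by omega), zero_sub, mul_neg (vecK _ _), vecK_mul_munit, if_pos rfl, mul_smul, neg_smul,
        show r - 1 - a = r - (a + 1) by omega]
  have hF : ∀ {a b : ℕ}, a < r → b < N - r → ∃ s : ℂ, s ≠ 0 ∧
      adjAct ρ (lowProj r) (rootVec (q : ℂ) D.F r a b) = s • munit (r + 1 + b) (r - a) := by
    intro a b ha hb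
    induction a with
    | zero =>
      induction b with
      | zero =>
        refine ⟨-1, by norm_num, ?_⟩
        have h : vecK q r * lowProj r * vecK (q : ℂ)⁻¹ r = lowProj r := by
          have := hK r hr
          rw [(hρ r hr).2.2.1] at this
          rw [← this.eq, mul_assoc, vecK_mul_vecK_inv hq0, mul_one]
        rw [rootVec_zero_zero, hρF _ hr, h, lowProj_mul_munit, munit_mul_lowProj, if_pos le_rfl,
          if_neg (by omega), zero_sub]
        exact (neg_one_smul ℂ _).symm
      | succ b ih =>
        obtain ⟨s, hs, h⟩ := ih (by omega)
        have hk : r + 1 + b ∈ Finset.Icc 1 (N - 1) := by simp; omega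
        refine ⟨s * -q, mul_ne_zero hs (neg_ne_zero.2 hq0), ?_⟩
        rw [rootVec_zero_succ, D.adjAct_qComm hK hEF _ _ (D.F_mem_Jsub hk (by omega)), h,
          adjAct_smul, hρF _ hk, munit_mul_munit, if_neg (by omega), vecK_mul_munit, if_pos rfl,
          smul_mul_assoc, munit_mul_vecK, if_neg (by omega), if_neg (by omega), one_smul,
          mul_smul_comm, munit_mul_munit, if_pos rfl, zero_sub, mul_smul, neg_smul]
        rfl
    | succ a ih =>
      obtain ⟨s, hs, h⟩ := ih (by omega)
      have hk : r - 1 - a ∈ Finset.Icc 1 (N - 1) := by simp; omega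
      refine ⟨s, hs, ?_⟩
      rw [rootVec_succ_left, D.adjAct_qComm hK hEF _ _ (D.F_mem_Jsub hk (by omega)), h,
        adjAct_smul, hρF _ hk, munit_mul_munit, if_pos (by omega), vecK_mul_munit,
        smul_mul_assoc, munit_mul_vecK, mul_smul_comm, mul_smul_comm, munit_mul_munit,
        if_neg (show ¬ r - 1 - a = r + 1 + b by omega), smul_zero, smul_zero, sub_zero,
        show r - 1 - a = r - (a + 1) by omega]
  let row : Bool × Fin r × Fin (N - r) → ℕ := fun γ => bif γ.1 then r - γ.2.1 else r + 1 + γ.2.2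
  let col : Bool × Fin r × Fin (N - r) → ℕ := fun γ => bif γ.1 then r + 1 + γ.2.2 else r - γ.2.1
  have hx : ∀ γ : Bool × Fin r × Fin (N - r), ∃ s : ℂ, s ≠ 0 ∧
      adjAct ρ (lowProj r) ((D.filt r).x γ) = s • munit (row γ) (col γ) := by
    rintro ⟨_ | _, a, b⟩
    exacts [hF a.2 b.2, hE a.2 b.2]
  choose s hs hsx using hx
  have hne : ∀ γ, row γ ≠ col γ := by
    rintro ⟨_ | _, a, b⟩ <;> simp only [row, col, cond_true, cond_false] <;> omega
  have hinj : ∀ γ γ', row γ = row γ' ∧ col γ = col γ' ↔ γ = γ' := by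
    rintro ⟨_ | _, a, b⟩ ⟨_ | _, a', b'⟩ <;>
      simp only [row, col, cond_true, cond_false, Prod.mk.injEq, Fin.ext_iff, true_and,
        reduceCtorEq, false_and, iff_false, not_and] <;> omega
  refine ⟨fun γ => (s γ)⁻¹ • entry (row γ) (col γ) ∘ₗ adjAct ρ (lowProj r), fun γ j hj => ?_,
    fun γ => ?_, fun γ γ' => ?_⟩
  · simp [D.adjAct_Jsub hK hEF hj]
  · simp [adjAct_one, entry_lowProj r (hne γ)]
  · rw [LinearMap.smul_apply, LinearMap.comp_apply, hsx, map_smul, entry_munit]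
    simp only [hinj]
    split_ifs with h
    · subst h; simp [hs γ]
    · simp

end UqslData

namespace UqslData

open FiltData SkewFilt

variable {q : ℝ} {N : ℕ} (D : UqslData q N) {r : ℕ}

section RootVectors

variable {e : ℕ → D.U} {V : ℕ → ℕ → D.U} {s t : ℂ}

theorem iterated_mem_Jsub (he : ∀ k ∈ Finset.Icc 1 (N - 1), k ≠ r → e k ∈ D.Jsub r)
    (hV0 : ∀ i, V 0 i = e i)
    (hV : ∀ d i, V (d + 1) i = s • (e i * V d (i + 1)) + t • (V d (i + 1) * e i)) {d : ℕ} :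
    ∀ {i : ℕ}, r < i → i + d ≤ N - 1 → V d i ∈ D.Jsub r := by
  induction d with
  | zero =>
    intro i hi hd
    rw [hV0]
    exact he i (by simp; omega) (by omega)
  | succ d ih =>
    intro i hi hd
    rw [hV]
    exact add_mem (Submodule.smul_mem _ _ (D.Jsub_mul_mem (he i (by simp; omega) (by omega)) _))
      (Submodule.smul_mem _ _ (D.Jsub_mul_mem (ih (by omega) (by omega)) _))

theorem rootVec_mul_sub_mem_Jsub (hr1 : 1 ≤ r) (hs : s ≠ 0)
    (he : ∀ k ∈ Finset.Icc 1 (N - 1), k ≠ r → e k ∈ D.Jsub r)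
    (hcomm : ∀ i ∈ Finset.Icc 1 (N - 1), ∀ j ∈ Finset.Icc 1 (N - 1),
      2 ≤ ((i : ℤ) - j).natAbs → Commute (e i) (e j))
    (hV0 : ∀ i, V 0 i = e i)
    (hV : ∀ d i, V (d + 1) i = s • (e i * V d (i + 1)) + t • (V d (i + 1) * e i)) {d : ℕ} :
    ∀ {b : ℕ}, r + 1 + b + d ≤ N - 1 → ∃ a : ℂ, a ≠ 0 ∧
      rootVec (q : ℂ) e r 0 b * V d (r + 1 + b) - a • rootVec (q : ℂ) e r 0 (b + 1 + d) ∈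
        D.Jsub r := by
  have hstep : ∀ {b : ℕ}, r + 1 + b ≤ N - 1 →
      rootVec (q : ℂ) e r 0 b * e (r + 1 + b) - rootVec (q : ℂ) e r 0 (b + 1) ∈ D.Jsub r := by
    intro b hb
    rw [rootVec_zero_succ, qComm, sub_sub_cancel]
    exact Submodule.smul_mem _ _ (D.Jsub_mul_mem (he _ (by simp; omega) (by omega)) _)
  have hx : ∀ {b k : ℕ}, r + 2 + b ≤ k → k ≤ N - 1 →
      Commute (rootVec (q : ℂ) e r 0 b) (e k) := by
    intro b k hk hkN
    induction b with
    | zero => exact hcomm r (by simp; omega) k (by simp; omega) (by omega)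
    | succ b ih =>
      exact (ih (by omega)).qComm_left (hcomm _ (by simp; omega) k (by simp; omega) (by omega))
  have hxV : ∀ {d b k : ℕ}, r + 2 + b ≤ k → k + d ≤ N - 1 →
      Commute (rootVec (q : ℂ) e r 0 b) (V d k) := by
    intro d
    induction d with
    | zero => intro b k hk hkN; rw [hV0]; exact hx hk hkN
    | succ d ih =>
      intro b k hk hkN
      have h1 := hx hk (show k ≤ N - 1 by omega)
      have h2 := ih (show r + 2 + b ≤ k + 1 by omega) (show k + 1 + d ≤ N - 1 by omega)
      rw [hV]
      exact ((h1.mul_right h2).smul_right _).add_right ((h2.mul_right h1).smul_right _)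
  induction d with
  | zero =>
    intro b hb
    refine ⟨1, one_ne_zero, ?_⟩
    rw [hV0, one_smul]
    exact hstep hb
  | succ d ih =>
    intro b hb
    obtain ⟨a, ha, h⟩ := ih (b := b + 1) (by omega)
    refine ⟨s * a, mul_ne_zero hs ha, ?_⟩
    have h1 := D.Jsub_mul_mem (hstep (b := b) (by omega)) (V d (r + 1 + (b + 1)))
    have h2 : rootVec (q : ℂ) e r 0 b * V d (r + 1 + (b + 1)) * e (r + 1 + b) ∈ D.Jsub r := by
      rw [(hxV (by omega) (by omega)).eq, mul_assoc]
      exact D.Jsub_mul_mem (D.iterated_mem_Jsub he hV0 hV (by omega) (by omega)) _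
    have h3 := add_mem (add_mem ((D.Jsub r).smul_mem s h) ((D.Jsub r).smul_mem s h1))
      ((D.Jsub r).smul_mem t h2)
    refine Set.mem_of_eq_of_mem ?_ h3
    rw [hV, show r + 1 + b + 1 = r + 1 + (b + 1) by ring,
      show b + 1 + (d + 1) = b + 1 + 1 + d by ring]
    simp only [mul_add, mul_smul_comm, sub_mul, smul_sub, smul_smul, ← mul_assoc]
    abel

theorem iterated_sub_mem_Jsub (hr1 : 1 ≤ r) (hs : s ≠ 0) (ht : t ≠ 0)
    (he : ∀ k ∈ Finset.Icc 1 (N - 1), k ≠ r → e k ∈ D.Jsub r)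
    (hcomm : ∀ i ∈ Finset.Icc 1 (N - 1), ∀ j ∈ Finset.Icc 1 (N - 1),
      2 ≤ ((i : ℤ) - j).natAbs → Commute (e i) (e j))
    (hV0 : ∀ i, V 0 i = e i)
    (hV : ∀ d i, V (d + 1) i = s • (e i * V d (i + 1)) + t • (V d (i + 1) * e i)) {b : ℕ}
    (hb : r + b ≤ N - 1) {a : ℕ} : a < r → ∃ c : ℂ, c ≠ 0 ∧
      V (a + b) (r - a) - c • rootVec (q : ℂ) e r a b ∈ D.Jsub r := by
  induction a with
  | zero =>
    intro _
    cases b with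
    | zero =>
      refine ⟨1, one_ne_zero, ?_⟩
      rw [hV0, one_smul, rootVec_zero_zero, Nat.sub_zero, sub_self]
      exact zero_mem _
    | succ b =>
      obtain ⟨c, hc, h⟩ := D.rootVec_mul_sub_mem_Jsub hr1 hs he hcomm hV0 hV (d := b) (b := 0)
        (by omega)
      refine ⟨s * c, mul_ne_zero hs hc, ?_⟩
      have h1 := D.Jsub_mul_mem (D.iterated_mem_Jsub he hV0 hV (d := b) (i := r + 1) (by omega)
        (by omega)) (e r)
      refine Set.mem_of_eq_of_mem ?_ (add_mem ((D.Jsub r).smul_mem s h) ((D.Jsub r).smul_mem t h1))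
      rw [show 0 + (b + 1) = b + 1 by ring, hV, Nat.sub_zero, rootVec_zero_zero, smul_sub,
        smul_smul, show 0 + 1 + b = b + 1 by ring]
      abel
  | succ a ih =>
    intro ha
    obtain ⟨c, hc, h⟩ := ih (by omega)
    refine ⟨t * c, mul_ne_zero ht hc, ?_⟩
    have hk : e (r - 1 - a) ∈ D.Jsub r := he _ (by simp; omega) (by omega)
    have h1 := D.Jsub_mul_mem hk (V (a + b) (r - a))
    have h2 := D.Jsub_mul_mem hk (rootVec (q : ℂ) e r a b)
    refine Set.mem_of_eq_of_mem ?_ (add_mem (add_mem ((D.Jsub r).smul_mem s h1)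
      ((D.Jsub r).smul_mem t (D.Jsub_mul_mem h (e (r - 1 - a)))))
      ((D.Jsub r).smul_mem (t * c * (q : ℂ)⁻¹) h2))
    rw [show a + 1 + b = a + b + 1 by ring, hV, rootVec_succ_left, qComm,
      show r - (a + 1) = r - 1 - a by omega, show r - 1 - a + 1 = r - a by omega]
    simp only [sub_mul, smul_mul_assoc]
    module

end RootVectors

theorem exists_Ev_sub_mem (hq : Transcendental ℚ q) (hr1 : 1 ≤ r) {a b : ℕ} (ha : a < r)
    (hb : r + b ≤ N - 1) : ∃ c : ℂ, c ≠ 0 ∧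
      D.Ev (a + b) (r - a) - c • rootVec (q : ℂ) D.E r a b ∈ D.Jsub r :=
  D.iterated_sub_mem_Jsub (s := 1) (t := -(q : ℂ)⁻¹) hr1 one_ne_zero
    (neg_ne_zero.2 (inv_ne_zero (ne_zero_of_transcendental hq)))
    (fun _ hk hkr => D.E_mem_Jsub hk hkr) D.rels.2.2.2.2.2.2.1 (fun _ => rfl)
    (fun d i => by rw [Ev, one_smul, neg_smul, sub_eq_add_neg]) hb ha

theorem exists_Fv_sub_mem (hq : Transcendental ℚ q) (hr1 : 1 ≤ r) {a b : ℕ} (ha : a < r)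
    (hb : r + b ≤ N - 1) : ∃ c : ℂ, c ≠ 0 ∧
      D.Fv (a + b) (r - a) - c • rootVec (q : ℂ) D.F r a b ∈ D.Jsub r :=
  D.iterated_sub_mem_Jsub (s := -(q : ℂ)⁻¹) (t := 1) hr1
    (neg_ne_zero.2 (inv_ne_zero (ne_zero_of_transcendental hq))) one_ne_zero
    (fun _ hk hkr => D.F_mem_Jsub hk hkr) D.rels.2.2.2.2.2.2.2.2 (fun _ => rfl)
    (fun d i => by rw [Fv, one_smul, neg_smul, sub_eq_add_neg, add_comm]) hb ha

/-- Modulo `K⁺U` the two families of root vectors span the same subspace. -/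
theorem span_root_vectors_sup_Jsub (hq : Transcendental ℚ q) (hr1 : 1 ≤ r) (hr2 : r ≤ N - 1) :
    Submodule.span ℂ (EvSet D r ∪ FvSet D r) ⊔ D.Jsub r =
      Submodule.span ℂ (Set.range (D.filt r).x) ⊔ D.Jsub r := by
  have key : ∀ {P : Submodule ℂ D.U} {v x : D.U}, (∃ c : ℂ, c ≠ 0 ∧ v - c • x ∈ D.Jsub r) →
      D.Jsub r ≤ P → (v ∈ P ↔ x ∈ P) := by
    rintro P v x ⟨c, hc, h⟩ hP
    rw [← P.smul_mem_iff hc (x := x)]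
    exact ⟨fun hv => by simpa using sub_mem hv (hP h), fun hx => by simpa using add_mem (hP h) hx⟩
  apply le_antisymm <;> refine sup_le (Submodule.span_le.2 ?_) le_sup_right
  · rintro _ (⟨⟨i, j⟩, ⟨hi1, hi2, hj1, hj2⟩, rfl⟩ | ⟨⟨i, j⟩, ⟨hi1, hi2, hj1, hj2⟩, rfl⟩) <;>
      dsimp only at hi1 hi2 hj1 hj2 ⊢
    · have h := D.exists_Ev_sub_mem hq hr1 (a := r - i) (b := j - r) (by omega) (by omega)
      rw [show r - i + (j - r) = j - i by omega, show r - (r - i) = i by omega] at h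
      exact (key h le_sup_right).2 (Submodule.mem_sup_left (Submodule.subset_span
        ⟨(true, ⟨r - i, by omega⟩, ⟨j - r, by omega⟩), rfl⟩))
    · have h := D.exists_Fv_sub_mem hq hr1 (a := r - i) (b := j - r) (by omega) (by omega)
      rw [show r - i + (j - r) = j - i by omega, show r - (r - i) = i by omega] at h
      exact (key h le_sup_right).2 (Submodule.mem_sup_left (Submodule.subset_span
        ⟨(false, ⟨r - i, by omega⟩, ⟨j - r, by omega⟩), rfl⟩))
  · rintro _ ⟨⟨_ | _, ⟨a, ha⟩, ⟨b, hb⟩⟩, rfl⟩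
    · refine (key (D.exists_Fv_sub_mem hq hr1 ha (b := b) (by omega)) le_sup_right).1
        (Submodule.mem_sup_left (Submodule.subset_span (Or.inr ⟨(r - a, r + b), ?_, ?_⟩)))
      · exact ⟨by dsimp only; omega, Nat.sub_le _ _, Nat.le_add_right _ _, by dsimp only; omega⟩
      · rw [show r + b - (r - a) = a + b by omega]
    · refine (key (D.exists_Ev_sub_mem hq hr1 ha (b := b) (by omega)) le_sup_right).1
        (Submodule.mem_sup_left (Submodule.subset_span (Or.inl ⟨(r - a, r + b), ?_, ?_⟩)))
      · exact ⟨by dsimp only; omega, Nat.sub_le _ _, Nat.le_add_right _ _, by dsimp only; omega⟩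
      · rw [show r + b - (r - a) = a + b by omega]

theorem tmul_mem_JUU_left {j : D.U} (hj : j ∈ D.Jsub r) (u : D.U) : j ⊗ₜ[ℂ] u ∈ D.JUU r :=
  Submodule.mem_sup_left ⟨⟨j, hj⟩ ⊗ₜ[ℂ] u, rfl⟩

theorem tmul_mem_JUU_right {j : D.U} (hj : j ∈ D.Jsub r) (u : D.U) : u ⊗ₜ[ℂ] j ∈ D.JUU r :=
  Submodule.mem_sup_right ⟨u ⊗ₜ[ℂ] ⟨j, hj⟩, rfl⟩

theorem JUU_le {P : Submodule ℂ (D.U ⊗[ℂ] D.U)}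
    (h1 : ∀ j ∈ D.Jsub r, ∀ u, j ⊗ₜ[ℂ] u ∈ P) (h2 : ∀ j ∈ D.Jsub r, ∀ u, u ⊗ₜ[ℂ] j ∈ P) :
    D.JUU r ≤ P := by
  refine sup_le ?_ ?_
  · rintro _ ⟨y, rfl⟩
    induction y with
    | zero => rw [map_zero]; exact zero_mem _
    | add y z hy hz => rw [map_add]; exact add_mem hy hz
    | tmul j u => exact h1 j j.2 u
  · rintro _ ⟨y, rfl⟩
    induction y with
    | zero => rw [map_zero]; exact zero_mem _
    | add y z hy hz => rw [map_add]; exact add_mem hy hz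
    | tmul u j => exact h2 j j.2 u

theorem JUU_mul_mem {y : D.U ⊗[ℂ] D.U} (hy : y ∈ D.JUU r) (z : D.U ⊗[ℂ] D.U) :
    y * z ∈ D.JUU r := by
  induction z with
  | zero => rw [mul_zero]; exact zero_mem _
  | add z w hz hw => rw [mul_add]; exact add_mem hz hw
  | tmul a b =>
    have : D.JUU r ≤ (D.JUU r).comap (LinearMap.mulRight ℂ (a ⊗ₜ[ℂ] b)) := by
      refine D.JUU_le (fun j hj u => ?_) (fun j hj u => ?_) <;>
        rw [Submodule.mem_comap, LinearMap.mulRight_apply, Algebra.TensorProduct.tmul_mul_tmul]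
      · exact D.tmul_mem_JUU_left (D.Jsub_mul_mem hj _) _
      · exact D.tmul_mem_JUU_right (D.Jsub_mul_mem hj _) _
    exact this hy

theorem comul_sub_counit_mem_JUU {k : D.U} (hk : k ∈ D.Ksub r) :
    Coalgebra.comul (R := ℂ) k - Coalgebra.counit (R := ℂ) k • 1 ∈ D.JUU r := by
  have hgroup : ∀ {g : D.U}, g - 1 ∈ D.Jsub r → g ⊗ₜ[ℂ] g - 1 ∈ D.JUU r := fun {g} hg => by
    refine Set.mem_of_eq_of_mem ?_
      (add_mem (D.tmul_mem_JUU_left hg g) (D.tmul_mem_JUU_right hg 1))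
    rw [TensorProduct.sub_tmul, TensorProduct.tmul_sub, Algebra.TensorProduct.one_def]
    abel
  induction hk using Algebra.adjoin_induction with
  | mem c hc =>
    obtain ⟨j, hj, hjr, rfl | rfl⟩ | ⟨j, hj, rfl | rfl⟩ := hc
    · rw [D.comul_E j hj, D.counit_E j hj, zero_smul, sub_zero]
      exact add_mem (D.tmul_mem_JUU_left (D.E_mem_Jsub hj hjr) _)
        (D.tmul_mem_JUU_right (D.E_mem_Jsub hj hjr) _)
    · rw [D.comul_F j hj, D.counit_F j hj, zero_smul, sub_zero]
      exact add_mem (D.tmul_mem_JUU_left (D.F_mem_Jsub hj hjr) _)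
        (D.tmul_mem_JUU_right (D.F_mem_Jsub hj hjr) _)
    · rw [D.comul_Kg j hj, D.counit_Kg j hj, one_smul]
      exact hgroup (D.Kg_sub_one_mem_Jsub hj)
    · rw [D.comul_Ki j hj, D.counit_Ki j hj, one_smul]
      exact hgroup (D.Ki_sub_one_mem_Jsub hj)
  | algebraMap a =>
    rw [Algebra.algebraMap_eq_smul_one, map_smul, map_smul, Bialgebra.comul_one,
      Bialgebra.counit_one, smul_eq_mul, mul_one, sub_self]
    exact zero_mem _
  | add a b _ _ ha hb =>
    rw [map_add, map_add, add_smul, add_sub_add_comm]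
    exact add_mem ha hb
  | mul a b _ _ ha hb =>
    refine Set.mem_of_eq_of_mem ?_ (add_mem (D.JUU_mul_mem ha (Coalgebra.comul (R := ℂ) b))
      ((D.JUU r).smul_mem (Coalgebra.counit (R := ℂ) a) hb))
    rw [Bialgebra.comul_mul, Bialgebra.counit_mul, sub_mul, smul_mul_assoc, one_mul, smul_sub,
      smul_smul, sub_add_sub_cancel]

theorem primDefect_apply (x : D.U) :
    primDefect D x = Coalgebra.comul (R := ℂ) x - x ⊗ₜ[ℂ] 1 - 1 ⊗ₜ[ℂ] x := rfl

theorem Jsub_le_comap_primDefect : D.Jsub r ≤ (D.JUU r).comap (primDefect D) := by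
  intro j hj
  have h1 : D.Jsub r ≤ (D.JUU r).comap (Coalgebra.comul (R := ℂ)) := by
    refine Submodule.span_le.2 ?_
    rintro _ ⟨k, hk, h, v, rfl⟩
    have := D.JUU_mul_mem (D.comul_sub_counit_mem_JUU hk) (Coalgebra.comul (R := ℂ) v)
    rw [h, zero_smul, sub_zero, ← Bialgebra.comul_mul] at this
    exact this
  rw [Submodule.mem_comap, primDefect_apply]
  exact sub_mem (sub_mem (h1 hj) (D.tmul_mem_JUU_left hj _)) (D.tmul_mem_JUU_right hj _)

theorem qComm_mem_comap_primDefect {x c p p' : D.U} (s : ℂ)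
    (hx : x ∈ (D.JUU r).comap (primDefect D)) (hc : c ∈ D.Jsub r) (hp : p - 1 ∈ D.Jsub r)
    (hp' : p' - 1 ∈ D.Jsub r) (h : Coalgebra.comul (R := ℂ) c = c ⊗ₜ[ℂ] p + p' ⊗ₜ[ℂ] c) :
    qComm s x c ∈ (D.JUU r).comap (primDefect D) := by
  refine sub_mem ?_ (Submodule.smul_mem _ _ (D.Jsub_le_comap_primDefect (D.Jsub_mul_mem hc x)))
  rw [Submodule.mem_comap, primDefect_apply] at hx ⊢
  have h1 := D.JUU_mul_mem hx (Coalgebra.comul (R := ℂ) c)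
  refine Set.mem_of_eq_of_mem ?_ (add_mem h1 (add_mem
    (add_mem (D.tmul_mem_JUU_right hp (x * c)) (D.tmul_mem_JUU_right hc (x * p')))
    (add_mem (D.tmul_mem_JUU_left hc (x * p)) (D.tmul_mem_JUU_left hp' (x * c)))))
  rw [Bialgebra.comul_mul, h]
  simp only [sub_mul, mul_add, Algebra.TensorProduct.tmul_mul_tmul, one_mul,
    TensorProduct.sub_tmul, TensorProduct.tmul_sub]
  abel

theorem x_mem_comap_primDefect (hq : Transcendental ℚ q) (hr1 : 1 ≤ r) (hr2 : r ≤ N - 1)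
    (γ : (D.filt r).ι) : (D.filt r).x γ ∈ (D.JUU r).comap (primDefect D) := by
  have key : ∀ u, IsWord (D.skewFilt hq hr1 hr2).q (D.skewFilt hq hr1 hr2).base
      (D.skewFilt hq hr1 hr2).C u → u ∈ (D.JUU r).comap (primDefect D) := by
    intro u hu
    induction hu with
    | @of_base u hu =>
      obtain ⟨p, hp, p', hp', h⟩ := (D.skewFilt hq hr1 hr2).skew u (Or.inl hu)
      rw [Submodule.mem_comap, primDefect_apply, h]
      refine Set.mem_of_eq_of_mem ?_ (add_mem
        (D.tmul_mem_JUU_right ((D.skewFilt hq hr1 hr2).P_J p hp) u)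
        (D.tmul_mem_JUU_left ((D.skewFilt hq hr1 hr2).P_J p' hp') u))
      rw [TensorProduct.sub_tmul, TensorProduct.tmul_sub]
      abel
    | @step u c hu hc ih =>
      obtain ⟨p, hp, p', hp', h⟩ := (D.skewFilt hq hr1 hr2).skew c (Or.inr hc)
      exact D.qComm_mem_comap_primDefect _ ih ((D.skewFilt hq hr1 hr2).C_J c hc)
        ((D.skewFilt hq hr1 hr2).P_J p hp) ((D.skewFilt hq hr1 hr2).P_J p' hp') h
  exact key _ ((D.skewFilt hq hr1 hr2).isWord γ)

theorem derTensor_mem_Jsub {g : D.U →ₗ[ℂ] ℂ} (hg : ∀ j ∈ D.Jsub r, g j = 0)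
    {y : D.U ⊗[ℂ] D.U} (hy : y ∈ D.JUU r) : derTensor g y ∈ D.Jsub r := by
  have : D.JUU r ≤ (D.Jsub r).comap (derTensor g) := by
    refine D.JUU_le (fun j hj u => ?_) (fun j hj u => ?_) <;>
      rw [Submodule.mem_comap, derTensor_tmul]
    · exact Submodule.smul_mem _ _ hj
    · rw [hg j hj, zero_smul]; exact zero_mem _
  exact this hy

theorem derTensor_primDefect (g : D.U →ₗ[ℂ] ℂ) (x : D.U) :
    derTensor g (primDefect D x) = der g x - g 1 • x - g x • 1 := by
  rw [primDefect_apply, map_sub, map_sub, derTensor_tmul, derTensor_tmul]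
  rfl

theorem comap_primDefect_eq (hq : Transcendental ℚ q) (hr1 : 1 ≤ r) (hr2 : r ≤ N - 1) :
    (D.JUU r).comap (primDefect D) =
      Submodule.span ℂ (Set.range (D.filt r).x) ⊔ D.Jsub r := by
  have hsub : Submodule.span ℂ (Set.range (D.filt r).x) ⊔ D.Jsub r ≤
      (D.JUU r).comap (primDefect D) := by
    refine sup_le (Submodule.span_le.2 ?_) D.Jsub_le_comap_primDefect
    rintro _ ⟨γ, rfl⟩
    exact D.x_mem_comap_primDefect hq hr1 hr2 γ
  refine le_antisymm (fun x hx => ?_) hsub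
  have hG2 : x ∈ (D.filt r).G 2 := by
    obtain ⟨f, hfJ, hf1, hfx⟩ := D.exists_dual hq hr1 hr2
    have hder : ∀ γ, der (f γ) x ∈ (D.filt r).G 1 := fun γ => by
      have h := D.derTensor_mem_Jsub (hfJ γ) hx
      rw [derTensor_primDefect, hf1, zero_smul, sub_zero] at h
      have h2 := (D.filt r).J_le_G 1 h
      have h3 := add_mem h2 (((D.filt r).G 1).smul_mem (f γ x) ((D.filt r).one_mem_G 0))
      rwa [sub_add_cancel] at h3
    let _ : Fintype (D.skewFilt hq hr1 hr2).ι :=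
      inferInstanceAs (Fintype (Bool × Fin r × Fin (N - r)))
    let _ : DecidableEq (D.skewFilt hq hr1 hr2).ι :=
      inferInstanceAs (DecidableEq (Bool × Fin r × Fin (N - r)))
    obtain ⟨n, hn⟩ := D.exists_mem_G hq hr1 hr2 x
    refine mem_G_two_of_euler (S := D.skewFilt hq hr1 hr2) (f := f) (qSubOne_mem_jacobson hq)
      (fun m => inv_natCast_mem_localSubring m.succ_ne_zero)
      (fun γ => FiltData.isInt_of_x (hfJ γ) (hf1 γ) (hfx γ)) hfx
      (fun γ γ' => (D.qFilt hq hr1 hr2).bracket_x_mem γ γ') ?_ n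
      ((D.filt r).G_mono (Nat.le_add_right n 2) hn)
    refine Set.mem_of_eq_of_mem (euler_apply (S := D.skewFilt hq hr1 hr2) f x)
      (sum_mem fun γ _ => ?_)
    exact Deg.G (Deg.x γ) (hder γ)
  rw [FiltData.G_two, sup_assoc] at hG2
  obtain ⟨y, hy, z, hz, rfl⟩ := Submodule.mem_sup.1 hG2
  obtain ⟨a, rfl⟩ := Submodule.mem_span_singleton.1 hy
  have h1 : a • (1 : D.U) ∈ (D.JUU r).comap (primDefect D) := by
    simpa using sub_mem hx (hsub hz)
  have h2 := D.derTensor_mem_Jsub (fun j hj => D.counit_Jsub hj) h1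
  rw [derTensor_primDefect, der_counit] at h2
  have h3 := D.counit_Jsub h2
  simp at h3
  rw [h3, zero_smul, zero_add]
  exact hz

end UqslData

/-- Lemma `prim`.  The primitive elements of `Ū = U/K⁺U` are exactly
`P(Ū) = span{F_β, E_{β'} | β, β' ∈ Φ⁺_r}`.  We state this on representatives: the
preimage in `U` of `P(Ū)` is `span{F_β, E_{β'}} + K⁺U`. -/
theorem primitives_of_U_mod_KplusU_eq_span_root_vectors
    (q : ℝ) (hq : Transcendental ℚ q)
    (N r : ℕ) (hN : 2 ≤ N) (hr1 : 1 ≤ r) (hr2 : r ≤ N - 1)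
    (D : UqslData q N) :
    Submodule.comap (primDefect D) (D.JUU r) =
      Submodule.span ℂ (EvSet D r ∪ FvSet D r) ⊔ D.Jsub r := by
  rw [D.comap_primDefect_eq hq hr1 hr2, D.span_root_vectors_sup_Jsub hq hr1 hr2]
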